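/- For every γ ∈ [0, 3/2] and every Borel probability measure μ on the unit sphere S² ⊂ ℝ³ with ∫_{S²} x dμ(x) = 0, one has D(μ‖σ) ≥ γ · E(μ), where E(μ) := 2 ∬_{S²×S²} log(1/|x−y|) dμ(x) dμ(y) + 2 log 2 − 1. Equality holds when μ = σ (for which both sides vanish); in the notation of the paper, F_γ(μ) := −γE(μ) + D(μ‖σ) ≥ 0 on 𝒫(X)₀ for γ ≤ 3/2. -/

import Mathlib

open MeasureTheory
open scoped ENNReal Classical

/-- Euclidean three-space, containing the unit two-sphere. -/
abbrev E3 : Type := EuclideanSpace ℝ (Fin 3)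

/-- The relative entropy (Kullback–Leibler divergence) `D(μ‖ν)`, equal to
`∫ log(dμ/dν) dμ` when `μ ≪ ν` and this integral is defined, and `∞` otherwise. -/
noncomputable def relEnt {α : Type*} [MeasurableSpace α] (μ ν : Measure α) : ℝ≥0∞ :=
  if μ ≪ ν ∧ Integrable (fun x => Real.log (μ.rnDeriv ν x).toReal) μ then
    ENNReal.ofReal (∫ x, Real.log (μ.rnDeriv ν x).toReal ∂μ)
  else ∞

/-- Wirtinger derivative predicate. -/
def HasW (f : ℂ → ℂ) (a b : ℂ) (z : ℂ) : Prop :=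
  HasFDerivAt f (a • (ContinuousLinearMap.id ℝ ℂ) + b • (Complex.conjCLE : ℂ →L[ℝ] ℂ)) z

noncomputable def wz (f : ℂ → ℂ) (z : ℂ) : ℂ :=
  (1 / 2) * (fderiv ℝ f z 1 - Complex.I * fderiv ℝ f z Complex.I)

noncomputable def wzb (f : ℂ → ℂ) (z : ℂ) : ℂ :=
  (1 / 2) * (fderiv ℝ f z 1 + Complex.I * fderiv ℝ f z Complex.I)

lemma fderiv_wirt (L : ℂ →L[ℝ] ℂ) :
    L = ((1 / 2) * (L 1 - Complex.I * L Complex.I) : ℂ) • (ContinuousLinearMap.id ℝ ℂ) +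
      ((1 / 2) * (L 1 + Complex.I * L Complex.I) : ℂ) • (Complex.conjCLE : ℂ →L[ℝ] ℂ) := by
  ext v
  have hv : v = v.re • (1 : ℂ) + v.im • Complex.I := by
    apply Complex.ext <;> simp
  have h1 : L v = v.re * L 1 + v.im * L Complex.I := by
    conv_lhs => rw [hv]
    rw [map_add, map_smul, map_smul]; simp
  have e2 : (starRingEnd ℂ) v = v.re - v.im * Complex.I := by
    apply Complex.ext <;> simp
  have e1 : v = v.re + v.im * Complex.I := (Complex.re_add_im v).symm
  have h2 : ((1 / 2 * (L 1 - Complex.I * L Complex.I) : ℂ) • (ContinuousLinearMap.id ℝ ℂ) +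
      ((1 / 2) * (L 1 + Complex.I * L Complex.I) : ℂ) • (Complex.conjCLE : ℂ →L[ℝ] ℂ)) v
      = (1 / 2 * (L 1 - Complex.I * L Complex.I) : ℂ) * v +
      ((1 / 2) * (L 1 + Complex.I * L Complex.I) : ℂ) * (starRingEnd ℂ) v := by simp
  rw [h1, h2, e2]
  linear_combination ((v.im : ℂ) * L Complex.I) * Complex.I_sq
    - (1 / 2 * (L 1 - Complex.I * L Complex.I) : ℂ) * e1

lemma DifferentiableAt.hasW {f : ℂ → ℂ} {z : ℂ} (h : DifferentiableAt ℝ f z) :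
    HasW f (wz f z) (wzb f z) z := by
  unfold HasW wz wzb
  rw [← fderiv_wirt]
  exact h.hasFDerivAt

lemma HasW.fderiv_apply {f : ℂ → ℂ} {a b z : ℂ} (h : HasW f a b z) (v : ℂ) :
    fderiv ℝ f z v = a * v + b * (starRingEnd ℂ) v := by
  rw [HasFDerivAt.fderiv h]; simp

lemma HasW.wz_eq {f : ℂ → ℂ} {a b z : ℂ} (h : HasW f a b z) : wz f z = a := by
  unfold wz; rw [h.fderiv_apply, h.fderiv_apply]; simp
  linear_combination (-(1/2) * a + 1 / 2 * b) * Complex.I_sq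

lemma HasW.wzb_eq {f : ℂ → ℂ} {a b z : ℂ} (h : HasW f a b z) : wzb f z = b := by
  unfold wzb; rw [h.fderiv_apply, h.fderiv_apply]; simp
  linear_combination ((1/2) * a - 1 / 2 * b) * Complex.I_sq

lemma HasW.congr {f : ℂ → ℂ} {a b a' b' z : ℂ} (h : HasW f a b z) (ha : a = a') (hb : b = b') :
    HasW f a' b' z := by subst ha hb; exact h

lemma HasW.const (c z : ℂ) : HasW (fun _ => c) 0 0 z := by
  exact (hasFDerivAt_const (𝕜 := ℝ) c z).congr_fderiv (by ext v; simp)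

lemma HasW.id (z : ℂ) : HasW (fun z => z) 1 0 z := by
  exact (hasFDerivAt_id (𝕜 := ℝ) z).congr_fderiv (by ext v; simp)

lemma HasW.add {f g : ℂ → ℂ} {a b a' b' z : ℂ} (h : HasW f a b z) (h' : HasW g a' b' z) :
    HasW (fun z => f z + g z) (a + a') (b + b') z := by
  unfold HasW at *
  refine (HasFDerivAt.add h h').congr_fderiv ?_
  ext v; simp; ring

lemma HasW.sub {f g : ℂ → ℂ} {a b a' b' z : ℂ} (h : HasW f a b z) (h' : HasW g a' b' z) :
    HasW (fun z => f z - g z) (a - a') (b - b') z := by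
  unfold HasW at *
  refine (HasFDerivAt.sub h h').congr_fderiv ?_
  ext v; simp; ring

lemma HasW.mul {f g : ℂ → ℂ} {a b a' b' z : ℂ} (h : HasW f a b z) (h' : HasW g a' b' z) :
    HasW (fun z => f z * g z) (a * g z + f z * a') (b * g z + f z * b') z := by
  unfold HasW at *
  refine (HasFDerivAt.mul h h').congr_fderiv ?_
  ext v; simp; ring

lemma HasW.conj {f : ℂ → ℂ} {a b z : ℂ} (h : HasW f a b z) :
    HasW (fun z => (starRingEnd ℂ) (f z)) ((starRingEnd ℂ) b) ((starRingEnd ℂ) a) z := by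
  unfold HasW at *
  refine ((Complex.conjCLE : ℂ →L[ℝ] ℂ).hasFDerivAt.comp z h).congr_fderiv ?_
  ext v; simp; ring

lemma HasW.sum {ι : Type*} {s : Finset ι} {f : ι → ℂ → ℂ} {a b : ι → ℂ} {z : ℂ}
    (h : ∀ i ∈ s, HasW (f i) (a i) (b i) z) :
    HasW (fun z => ∑ i ∈ s, f i z) (∑ i ∈ s, a i) (∑ i ∈ s, b i) z := by
  induction s using Finset.induction_on with
  | empty => simpa using HasW.const 0 z
  | insert i s hi ih =>
    simp only [Finset.sum_insert hi]
    exact (h i (by simp)).add (ih fun j hj => h j (by simp [hj]))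

/-- composition with a holomorphic outer function -/
lemma HasW.scomp {f : ℂ → ℂ} {g : ℂ → ℂ} {a b z g' : ℂ} (hg : HasDerivAt g g' (f z))
    (h : HasW f a b z) : HasW (fun z => g (f z)) (g' * a) (g' * b) z := by
  unfold HasW at *
  refine ((hg.hasFDerivAt.restrictScalars ℝ).comp z h).congr_fderiv ?_
  ext v; simp; ring

/-- holomorphic functions -/
lemma HasDerivAt.hasW {g : ℂ → ℂ} {g' z : ℂ} (hg : HasDerivAt g g' z) : HasW g g' 0 z := by
  simpa using HasW.scomp (f := fun z => z) hg (HasW.id z)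

lemma integral_fderiv_zero {f : ℂ → ℂ} (hf : ContDiff ℝ 1 f) (hc : HasCompactSupport f) (v : ℂ) :
    Integrable (fun z => fderiv ℝ f z v) ∧ ∫ z, fderiv ℝ f z v = 0 := by
  have hcont : Continuous (fun z => fderiv ℝ f z v) :=
    (hf.continuous_fderiv (by norm_num)).clm_apply continuous_const
  have hcs : HasCompactSupport (fun z => fderiv ℝ f z v) := hc.fderiv_apply ℝ v
  have hi := hcont.integrable_of_hasCompactSupport hcs (μ := volume)
  refine ⟨hi, ?_⟩
  have := integral_mul_fderiv_eq_neg_fderiv_mul_of_integrable (𝕜 := ℂ) (μ := (volume : Measure ℂ))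
    (f := fun _ => (1 : ℂ)) (g := f) (v := v) (by simp) (by simpa using hi)
    (by simpa using hf.continuous.integrable_of_hasCompactSupport hc)
    (fun x _ => by fun_prop) (fun x _ => hf.differentiable (by norm_num) x)
  simpa using this

lemma integral_wirt_zero {f a b : ℂ → ℂ} (hf : ∀ z, HasW f (a z) (b z) z)
    (ha : Continuous a) (hb : Continuous b) (hc : HasCompactSupport f) :
    (Integrable a ∧ ∫ z, a z = 0) ∧ (Integrable b ∧ ∫ z, b z = 0) := by
  have hcd : ContDiff ℝ 1 f := by
    rw [contDiff_one_iff_fderiv]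
    refine ⟨fun z => (hf z).differentiableAt, ?_⟩
    have : fderiv ℝ f = fun z => (a z • (ContinuousLinearMap.id ℝ ℂ) +
        b z • (Complex.conjCLE : ℂ →L[ℝ] ℂ)) := by
      ext1 z; exact HasFDerivAt.fderiv (hf z)
    rw [this]; fun_prop
  obtain ⟨i1, h1⟩ := integral_fderiv_zero hcd hc 1
  obtain ⟨i2, h2⟩ := integral_fderiv_zero hcd hc Complex.I
  have ea : a = fun z => (1 / 2) * (fderiv ℝ f z 1 - Complex.I * fderiv ℝ f z Complex.I) := by
    ext1 z; exact (hf z).wz_eq.symm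
  have eb : b = fun z => (1 / 2) * (fderiv ℝ f z 1 + Complex.I * fderiv ℝ f z Complex.I) := by
    ext1 z; exact (hf z).wzb_eq.symm
  refine ⟨⟨?_, ?_⟩, ?_, ?_⟩
  · rw [ea]; exact (i1.sub (i2.const_mul _)).const_mul _
  · rw [ea, integral_const_mul, integral_sub i1 (i2.const_mul _), integral_const_mul, h1, h2]; simp
  · rw [eb]; exact (i1.add (i2.const_mul _)).const_mul _
  · rw [eb, integral_const_mul, integral_add i1 (i2.const_mul _), integral_const_mul, h1, h2]; simp

/-- test functions -/
def IsTest (B : ℂ → ℂ) : Prop := ContDiff ℝ (⊤ : ℕ∞) B ∧ HasCompactSupport B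

lemma contDiff_wz {B : ℂ → ℂ} (h : ContDiff ℝ (⊤ : ℕ∞) B) : ContDiff ℝ (⊤ : ℕ∞) (wz B) := by
  have h1 : ContDiff ℝ (⊤ : ℕ∞) (fderiv ℝ B) := h.fderiv_right (by simp)
  unfold wz
  exact contDiff_const.mul ((h1.clm_apply contDiff_const).sub
    (contDiff_const.mul (h1.clm_apply contDiff_const)))

lemma contDiff_wzb {B : ℂ → ℂ} (h : ContDiff ℝ (⊤ : ℕ∞) B) : ContDiff ℝ (⊤ : ℕ∞) (wzb B) := by
  have h1 : ContDiff ℝ (⊤ : ℕ∞) (fderiv ℝ B) := h.fderiv_right (by simp)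
  unfold wzb
  exact contDiff_const.mul ((h1.clm_apply contDiff_const).add
    (contDiff_const.mul (h1.clm_apply contDiff_const)))

lemma HasCompactSupport.wz {B : ℂ → ℂ} (h : HasCompactSupport B) : HasCompactSupport (wz B) := by
  refine h.mono' ?_
  intro z hz
  by_contra hcon
  have : fderiv ℝ B z = 0 := by
    by_contra h2
    exact hcon (support_fderiv_subset ℝ h2)
  apply hz
  simp [_root_.wz, this]

lemma HasCompactSupport.wzb {B : ℂ → ℂ} (h : HasCompactSupport B) : HasCompactSupport (wzb B) := by
  refine h.mono' ?_
  intro z hz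
  by_contra hcon
  have : fderiv ℝ B z = 0 := by
    by_contra h2
    exact hcon (support_fderiv_subset ℝ h2)
  apply hz
  simp [_root_.wzb, this]

lemma wz_wzb_comm {B : ℂ → ℂ} (h : ContDiff ℝ (⊤ : ℕ∞) B) (z : ℂ) :
    wzb (wz B) z = wz (wzb B) z := by
  have h1 : ContDiff ℝ (⊤ : ℕ∞) (fderiv ℝ B) := h.fderiv_right (by simp)
  have hd : DifferentiableAt ℝ (fderiv ℝ B) z := h1.differentiable (by simp) z
  have key : ∀ u v : ℂ, fderiv ℝ (fun y => fderiv ℝ B y u) z v = fderiv ℝ (fderiv ℝ B) z v u := by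
    intro u v
    rw [fderiv_clm_apply hd (differentiableAt_const _)]
    simp
  have hdu : ∀ u : ℂ, DifferentiableAt ℝ (fun y => fderiv ℝ B y u) z := fun u => by fun_prop
  have e1 : ∀ v : ℂ, fderiv ℝ (wz B) z v = (1 / 2) * (fderiv ℝ (fderiv ℝ B) z v 1
      - Complex.I * fderiv ℝ (fderiv ℝ B) z v Complex.I) := by
    intro v
    unfold wz
    rw [fderiv_const_mul (by fun_prop), fderiv_fun_sub (hdu _) (by fun_prop),
      fderiv_const_mul (hdu _)]
    simp [key]
  have e2 : ∀ v : ℂ, fderiv ℝ (wzb B) z v = (1 / 2) * (fderiv ℝ (fderiv ℝ B) z v 1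
      + Complex.I * fderiv ℝ (fderiv ℝ B) z v Complex.I) := by
    intro v
    unfold wzb
    rw [fderiv_const_mul (by fun_prop), fderiv_fun_add (hdu _) (by fun_prop),
      fderiv_const_mul (hdu _)]
    simp [key]
    ring
  have hs : IsSymmSndFDerivAt ℝ B z :=
    (h.contDiffAt).isSymmSndFDerivAt (by simp [minSmoothness_of_isRCLikeNormedField]; exact WithTop.coe_le_coe.2 (le_top : (2 : ℕ∞) ≤ ⊤))
  have hs' := hs.eq 1 Complex.I
  have a1 : wzb (wz B) z = (1 / 2) * (fderiv ℝ (wz B) z 1 + Complex.I * fderiv ℝ (wz B) z Complex.I) := rfl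
  have a2 : wz (wzb B) z = (1 / 2) * (fderiv ℝ (wzb B) z 1 - Complex.I * fderiv ℝ (wzb B) z Complex.I) := rfl
  rw [a1, a2, e1, e1, e2, e2, hs']
  ring

lemma bochner {w om : ℂ → ℝ} {P Q : ℂ → ℂ} (hw : ∀ z, 0 < w z)
    (hwD : ∀ z, HasW (fun z => (w z : ℂ)) (w z * (starRingEnd ℂ) (P z)) (w z * P z) z)
    (hP : ∀ z, HasW P (om z) (Q z) z) (hQ : Continuous Q) (hom : Continuous om)
    {B : ℂ → ℂ} (hB : IsTest B) :
    ∫ z, om z * ‖B z‖ ^ 2 * w z ≤ ∫ z, ‖wz B z‖ ^ 2 * w z := by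
  obtain ⟨hB, hBc⟩ := hB
  have hB1 := contDiff_wz hB
  have hB2 := contDiff_wzb hB
  have c11 := (contDiff_wz hB1).continuous
  have c12 := (contDiff_wzb hB1).continuous
  have c21 := (contDiff_wz hB2).continuous
  have c22 := (contDiff_wzb hB2).continuous
  have cB := hB.continuous
  have c1 := hB1.continuous
  have c2 := hB2.continuous
  have cw : Continuous (fun z => (w z : ℂ)) :=
    continuous_iff_continuousAt.2 fun z => HasFDerivAt.continuousAt (hwD z)
  have cwr : Continuous w := by
    have := Complex.continuous_re.comp cw
    simpa [Function.comp_def] using this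
  have cP : Continuous P := continuous_iff_continuousAt.2 fun z => HasFDerivAt.continuousAt (hP z)
  have dB : ∀ z, HasW B (wz B z) (wzb B z) z := fun z => (hB.differentiable (by simp) z).hasW
  have dB1 : ∀ z, HasW (wz B) (wz (wz B) z) (wzb (wz B) z) z :=
    fun z => (hB1.differentiable (by simp) z).hasW
  have dB2 : ∀ z, HasW (wzb B) (wz (wzb B) z) (wzb (wzb B) z) z :=
    fun z => (hB2.differentiable (by simp) z).hasW
  have hU := fun z => ((hwD z).mul (dB1 z)).mul (dB z).conj
  have hV := fun z => ((hwD z).mul ((dB2 z).add ((hP z).mul (dB z)))).mul (dB z).conj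
  have cconj : Continuous (starRingEnd ℂ) := Complex.continuous_conj
  have sB : HasCompactSupport (fun z => (starRingEnd ℂ) (B z)) :=
    hBc.comp_left (g := starRingEnd ℂ) (by simp)
  obtain ⟨-, iU, zU⟩ := integral_wirt_zero hU (by fun_prop) (by fun_prop) (sB.mul_left)
  obtain ⟨⟨iV, zV⟩, -⟩ := integral_wirt_zero hV (by fun_prop) (by fun_prop) (sB.mul_left)
  have key := integral_sub iU iV
  rw [zU, zV, sub_zero] at key
  have hre : ∀ z, ((wz B z : ℂ) * (starRingEnd ℂ) (wz B z)) = ((‖wz B z‖ ^ 2 : ℝ) : ℂ) := by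
    intro z; rw [Complex.mul_conj, Complex.normSq_eq_norm_sq]
  have key2 : ∫ z, (((‖wz B z‖ ^ 2 * w z) - (om z * ‖B z‖ ^ 2 * w z)
      - ‖wzb B z + P z * B z‖ ^ 2 * w z : ℝ) : ℂ) = 0 := by
    rw [← key]
    congr 1
    ext1 z
    have n1 : ((‖wz B z‖ ^ 2 : ℝ) : ℂ) = wz B z * (starRingEnd ℂ) (wz B z) := by
      rw [Complex.mul_conj, Complex.normSq_eq_norm_sq]
    have n2 : ((‖B z‖ ^ 2 : ℝ) : ℂ) = B z * (starRingEnd ℂ) (B z) := by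
      rw [Complex.mul_conj, Complex.normSq_eq_norm_sq]
    have n3 : ((‖wzb B z + P z * B z‖ ^ 2 : ℝ) : ℂ) =
        (wzb B z + P z * B z) * (starRingEnd ℂ) (wzb B z + P z * B z) := by
      rw [Complex.mul_conj, Complex.normSq_eq_norm_sq]
    rw [Complex.ofReal_sub, Complex.ofReal_sub, Complex.ofReal_mul, Complex.ofReal_mul,
      Complex.ofReal_mul, Complex.ofReal_mul, n1, n2, n3, wz_wzb_comm hB]
    simp only [map_add, map_mul]
    ring
  rw [integral_complex_ofReal] at key2
  have key3 := Complex.ofReal_eq_zero.1 key2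
  have i1 : Integrable (fun z => ‖wz B z‖ ^ 2 * w z) := by
    apply Continuous.integrable_of_hasCompactSupport (by fun_prop)
    exact (hBc.wz.comp_left (g := fun x : ℂ => ‖x‖ ^ 2) (by simp)).mul_right
  have i2 : Integrable (fun z => om z * ‖B z‖ ^ 2 * w z) := by
    apply Continuous.integrable_of_hasCompactSupport (by fun_prop)
    exact ((hBc.comp_left (g := fun x : ℂ => ‖x‖ ^ 2) (by simp)).mul_left).mul_right
  have i3 : Integrable (fun z => ‖wzb B z + P z * B z‖ ^ 2 * w z) := by
    apply Continuous.integrable_of_hasCompactSupport (by fun_prop)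
    have : HasCompactSupport (fun z => wzb B z + P z * B z) := hBc.wzb.add hBc.mul_left
    exact (this.comp_left (g := fun x : ℂ => ‖x‖ ^ 2) (by simp)).mul_right
  have i12 : Integrable (fun z => ‖wz B z‖ ^ 2 * w z - om z * ‖B z‖ ^ 2 * w z) := i1.sub i2
  rw [integral_sub i12 i3, integral_sub i1 i2] at key3
  have : 0 ≤ ∫ z, ‖wzb B z + P z * B z‖ ^ 2 * w z :=
    integral_nonneg fun z => mul_nonneg (sq_nonneg _) (hw z).le
  linarith

noncomputable def jw (z : ℂ) : ℝ := ((1 + ‖z‖ ^ 2) ^ 3)⁻¹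

lemma jw_pos (z : ℂ) : 0 < jw z := by unfold jw; positivity

lemma continuous_jw : Continuous jw := by
  unfold jw
  exact Continuous.inv₀ (by fun_prop) (fun z => by positivity)

lemma integrable_base : Integrable (fun z : ℂ => ((1 + ‖z‖ ^ 2) ^ 2)⁻¹) := by
  have := integrable_rpow_neg_one_add_norm_sq (E := ℂ) (μ := volume) (r := 4)
    (by rw [Complex.finrank_real_complex]; norm_num)
  refine this.congr (Filter.Eventually.of_forall fun z => ?_)
  simp only
  rw [show (-4 : ℝ) / 2 = -((2 : ℕ) : ℝ) by norm_num, Real.rpow_neg (by positivity),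
    Real.rpow_natCast]

lemma integrable_jw_of_le {f : ℂ → ℝ} (hf : Continuous f) {C : ℝ}
    (h : ∀ z, |f z| ≤ C * (1 + ‖z‖ ^ 2)) : Integrable (fun z => f z * jw z) := by
  refine Integrable.mono' (integrable_base.const_mul C)
    (hf.mul continuous_jw).aestronglyMeasurable (Filter.Eventually.of_forall fun z => ?_)
  rw [Real.norm_eq_abs, abs_mul, abs_of_pos (jw_pos z)]
  refine (mul_le_mul_of_nonneg_right (h z) (jw_pos z).le).trans (le_of_eq ?_)
  unfold jw
  field_simp

lemma not_integrable_tail {h : ℂ → ℝ} {c R : ℝ} (hc : 0 < c) (hR : 0 < R)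
    (hh : ∀ z, R ≤ ‖z‖ → c * (‖z‖ ^ 2)⁻¹ ≤ h z) (h0 : ∀ z, 0 ≤ h z) : ¬ Integrable h := by
  intro hi
  set f : ℝ → ℝ := Set.indicator (Set.Ici R) (fun r => c * (r ^ 2)⁻¹) with hf
  have hfm : Measurable f := by
    apply Measurable.indicator _ measurableSet_Ici
    fun_prop
  have h1 : Integrable (fun z : ℂ => f ‖z‖) := by
    refine hi.mono' (hfm.comp measurable_norm).aestronglyMeasurable
      (Filter.Eventually.of_forall fun z => ?_)
    by_cases hz : R ≤ ‖z‖
    · have : f ‖z‖ = c * (‖z‖ ^ 2)⁻¹ := by simp [hf, Set.indicator, hz]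
      rw [this, Real.norm_of_nonneg (by positivity)]; exact hh z hz
    · have : f ‖z‖ = 0 := by simp [hf, Set.indicator, hz]
      rw [this, norm_zero]; exact h0 z
  rw [integrable_fun_norm_addHaar (μ := (volume : Measure ℂ)) (f := f)] at h1
  have h2 : IntegrableOn (fun y : ℝ => c * y⁻¹) (Set.Ioi R) := by
    refine (h1.mono_set (Set.Ioi_subset_Ioi hR.le)).congr_fun ?_ measurableSet_Ioi
    intro y hy
    have hy' : R ≤ y := le_of_lt hy
    have : 0 < y := hR.trans hy
    simp [hf, Set.indicator, hy', Complex.finrank_real_complex]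
    field_simp
  have h3 : IntegrableOn (fun y : ℝ => y⁻¹) (Set.Ioi R) := by
    have := h2.const_mul c⁻¹
    refine this.congr (Filter.Eventually.of_forall fun y => ?_)
    simp; field_simp
  exact not_integrableOn_Ioi_inv h3

lemma poly_L2 {P : Polynomial ℂ} (h : Integrable (fun z => ‖P.eval z‖ ^ 2 * jw z)) :
    ∃ a b : ℂ, ∀ z, P.eval z = a + b * z := by
  set R := P.divX.divX with hR
  have hP : ∀ z, P.eval z = P.coeff 0 + P.coeff 1 * z + z ^ 2 * R.eval z := by
    intro z
    have e1 := congrArg (Polynomial.eval z) (Polynomial.divX_mul_X_add P)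
    have e2 := congrArg (Polynomial.eval z) (Polynomial.divX_mul_X_add P.divX)
    simp only [Polynomial.eval_add, Polynomial.eval_mul, Polynomial.eval_X, Polynomial.eval_C,
      Polynomial.coeff_divX, zero_add] at e1 e2
    rw [← e1, ← e2]; ring
  by_cases hR0 : R = 0
  · exact ⟨P.coeff 0, P.coeff 1, fun z => by rw [hP, hR0]; simp⟩
  exfalso
  have hlow : ∃ c > 0, ∃ r > 1, ∀ z : ℂ, r ≤ ‖z‖ → c ≤ ‖R.eval z‖ := by
    by_cases hd : 0 < R.degree
    · have := Polynomial.tendsto_norm_atTop R hd (l := Filter.comap norm Filter.atTop)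
        (z := fun z : ℂ => z) Filter.tendsto_comap
      have := this.eventually (Filter.eventually_ge_atTop 1)
      rw [Filter.eventually_comap] at this
      obtain ⟨r, hr⟩ := Filter.eventually_atTop.1 this
      exact ⟨1, one_pos, max r 2, by simp, fun z hz => hr ‖z‖ (le_trans (le_max_left _ _) hz) z rfl⟩
    · have hC := Polynomial.eq_C_of_degree_le_zero (le_of_not_gt hd)
      refine ⟨‖R.coeff 0‖, ?_, 2, by norm_num, fun z _ => ?_⟩
      · rw [gt_iff_lt, norm_pos_iff]
        intro h0; apply hR0; rw [hC, h0]; simp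
      · conv_rhs => rw [hC]
        simp
  obtain ⟨c, hc, r, hr, hlow⟩ := hlow
  have i2 : Integrable (fun z : ℂ => ‖z ^ 2 * R.eval z‖ ^ 2 * jw z) := by
    have i1 : Integrable (fun z : ℂ => ‖P.coeff 0 + P.coeff 1 * z‖ ^ 2 * jw z) := by
      refine integrable_jw_of_le (by fun_prop) (C := (‖P.coeff 0‖ + ‖P.coeff 1‖) ^ 2 * 2) fun z => ?_
      rw [abs_of_nonneg (by positivity)]
      have n1 : ‖P.coeff 0 + P.coeff 1 * z‖ ≤ (‖P.coeff 0‖ + ‖P.coeff 1‖) * (1 + ‖z‖) := by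
        refine (norm_add_le _ _).trans ?_
        rw [norm_mul]
        nlinarith [norm_nonneg (P.coeff 0), norm_nonneg (P.coeff 1), norm_nonneg z,
          mul_nonneg (norm_nonneg (P.coeff 0)) (norm_nonneg z)]
      have n2 : (1 + ‖z‖) ^ 2 ≤ 2 * (1 + ‖z‖ ^ 2) := by nlinarith [sq_nonneg (1 - ‖z‖)]
      calc _ ≤ ((‖P.coeff 0‖ + ‖P.coeff 1‖) * (1 + ‖z‖)) ^ 2 := by gcongr
        _ = (‖P.coeff 0‖ + ‖P.coeff 1‖) ^ 2 * (1 + ‖z‖) ^ 2 := by ring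
        _ ≤ (‖P.coeff 0‖ + ‖P.coeff 1‖) ^ 2 * (2 * (1 + ‖z‖ ^ 2)) := by gcongr
        _ = _ := by ring
    refine Integrable.mono' ((h.const_mul 2).add (i1.const_mul 2)) ?_
      (Filter.Eventually.of_forall fun z => ?_)
    · apply Continuous.aestronglyMeasurable
      have := continuous_jw
      have := R.continuous
      fun_prop
    · rw [Real.norm_of_nonneg (mul_nonneg (sq_nonneg _) (jw_pos z).le)]
      have e : z ^ 2 * R.eval z = P.eval z - (P.coeff 0 + P.coeff 1 * z) := by rw [hP z]; ring
      rw [e]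
      have := norm_sub_le (P.eval z) (P.coeff 0 + P.coeff 1 * z)
      have h2 : ‖P.eval z - (P.coeff 0 + P.coeff 1 * z)‖ ^ 2 ≤
          2 * ‖P.eval z‖ ^ 2 + 2 * ‖P.coeff 0 + P.coeff 1 * z‖ ^ 2 := by
        nlinarith [norm_nonneg (P.eval z - (P.coeff 0 + P.coeff 1 * z)),
          sq_nonneg (‖P.eval z‖ - ‖P.coeff 0 + P.coeff 1 * z‖)]
      have := mul_le_mul_of_nonneg_right h2 (jw_pos z).le
      simp only [Pi.add_apply]
      linarith
  refine not_integrable_tail (c := c ^ 2 / 8) (R := r) (by positivity) (by linarith) ?_ ?_ i2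
  · intro z hz
    have hz1 : 1 < ‖z‖ := by linarith
    have hl := hlow z hz
    have hj : (8 * ‖z‖ ^ 6)⁻¹ ≤ jw z := by
      unfold jw
      apply inv_anti₀ (by positivity)
      have : 1 + ‖z‖ ^ 2 ≤ 2 * ‖z‖ ^ 2 := by nlinarith
      calc (1 + ‖z‖ ^ 2) ^ 3 ≤ (2 * ‖z‖ ^ 2) ^ 3 := by gcongr
        _ = _ := by ring
    rw [norm_mul, norm_pow]
    calc c ^ 2 / 8 * (‖z‖ ^ 2)⁻¹ = (‖z‖ ^ 2 * c) ^ 2 * (8 * ‖z‖ ^ 6)⁻¹ := by field_simp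
      _ ≤ (‖z‖ ^ 2 * ‖R.eval z‖) ^ 2 * jw z := by gcongr
  · exact fun z => mul_nonneg (sq_nonneg _) (jw_pos z).le

lemma entire_poly {f : ℂ → ℂ} (hf : Differentiable ℂ f) {K : ℝ}
    (hK : ∀ z, 1 ≤ ‖z‖ → ‖f z‖ ≤ K * ‖z‖ ^ 6) :
    ∃ P : Polynomial ℂ, P.degree < 7 ∧ ∀ z, P.eval z = f z := by
  have h0 : ∀ n, 7 ≤ n → iteratedDeriv n f 0 = 0 := by
    intro n hn
    have hb : ∀ R : ℝ, 1 ≤ R → ‖iteratedDeriv n f 0‖ ≤ n.factorial * |K| * R⁻¹ := by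
      intro R hR
      have hR0 : 0 < R := by linarith
      have := Complex.norm_iteratedDeriv_le_of_forall_mem_sphere_norm_le (c := 0) n hR0
        hf.diffContOnCl (C := |K| * R ^ 6) (fun z hz => by
          have hz' : ‖z‖ = R := by simpa using hz
          have := hK z (by rw [hz']; exact hR)
          rw [hz'] at this
          exact this.trans (by gcongr; exact le_abs_self K))
      refine this.trans ?_
      rw [mul_div_assoc, mul_assoc]
      gcongr
      rw [mul_div_assoc]
      gcongr
      rw [div_le_iff₀ (by positivity)]
      have : R ^ 7 ≤ R ^ n := pow_le_pow_right₀ hR hn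
      calc R ^ 6 = R⁻¹ * R ^ 7 := by field_simp
        _ ≤ R⁻¹ * R ^ n := by gcongr
    have ht : Filter.Tendsto (fun R : ℝ => n.factorial * |K| * R⁻¹) Filter.atTop (nhds 0) := by
      simpa using tendsto_inv_atTop_zero.const_mul ((n.factorial : ℝ) * |K|)
    have := ge_of_tendsto ht (Filter.eventually_atTop.2 ⟨1, hb⟩)
    exact norm_le_zero_iff.1 this
  refine ⟨∑ n ∈ Finset.range 7, Polynomial.C ((n.factorial : ℂ)⁻¹ * iteratedDeriv n f 0)
    * Polynomial.X ^ n, ?_, fun z => ?_⟩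
  · refine lt_of_le_of_lt (Polynomial.degree_sum_le _ _) ?_
    rw [Finset.sup_lt_iff (by exact_mod_cast WithBot.bot_lt_coe 7)]
    intro n hn
    refine lt_of_le_of_lt (Polynomial.degree_C_mul_X_pow_le _ _) ?_
    exact_mod_cast Finset.mem_range.1 hn
  · have := Complex.taylorSeries_eq_of_entire' 0 z hf
    rw [← this, tsum_eq_sum (s := Finset.range 7), Polynomial.eval_finsetSum]
    · simp
    · intro n hn
      rw [h0 n (by simpa using hn)]; simp

lemma tendsto_poly_limit {P : ℕ → Polynomial ℂ} (hP : ∀ n, (P n).degree < 7) {g : ℂ → ℂ}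
    (h : ∀ᵐ z, Filter.Tendsto (fun n => (P n).eval z) Filter.atTop (nhds (g z))) :
    ∃ Q : Polynomial ℂ, ∀ᵐ z, g z = Q.eval z := by
  set A := {z | Filter.Tendsto (fun n => (P n).eval z) Filter.atTop (nhds (g z))} with hA
  have hinf : A.Infinite := by
    intro hfin
    have h1 : volume Aᶜ = 0 := h
    have h2 : volume A = 0 := hfin.measure_zero _
    have h3 : volume (Set.univ : Set ℂ) = 0 := by
      rw [← Set.union_compl_self A]; exact measure_union_null h2 h1
    simp at h3
  obtain ⟨s, hsA, hs⟩ := hinf.exists_subset_card_eq 7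
  refine ⟨Lagrange.interpolate s id g, ?_⟩
  filter_upwards [h] with z hz
  have e : ∀ n, (P n).eval z = ∑ i ∈ s, (P n).eval i * (Lagrange.basis s id i).eval z := by
    intro n
    have := Lagrange.eq_interpolate (f := P n) (s := s) (v := id) (Function.injective_id.injOn)
      (by rw [hs]; exact hP n)
    conv_lhs => rw [this, Lagrange.interpolate_apply, Polynomial.eval_finsetSum]
    simp
  have t2 : Filter.Tendsto (fun n => (P n).eval z) Filter.atTop
      (nhds (∑ i ∈ s, g i * (Lagrange.basis s id i).eval z)) := by
    simp_rw [e]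
    refine tendsto_finsetSum _ fun i hi => ?_
    exact (hsA hi : Filter.Tendsto _ _ _).mul_const _
  rw [tendsto_nhds_unique hz t2, Lagrange.interpolate_apply, Polynomial.eval_finsetSum]
  simp

lemma norm_le_weight (g : ℂ → ℂ) (z : ℂ) :
    ‖g z‖ ≤ ‖g z‖ ^ 2 * jw z + (1 + ‖z‖ ^ 2) ^ 3 := by
  have h : jw z * (1 + ‖z‖ ^ 2) ^ 3 = 1 := by unfold jw; field_simp
  have hj := jw_pos z
  set a := ‖g z‖
  set b := (1 + ‖z‖ ^ 2) ^ 3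
  have hb : 0 < b := by positivity
  have h1 : a ^ 2 * jw z = a ^ 2 / b := by rw [eq_div_iff hb.ne']; rw [mul_assoc, h, mul_one]
  rw [h1, div_add' _ _ _ hb.ne', le_div_iff₀ hb]
  nlinarith [sq_nonneg (a - b), norm_nonneg (g z), sq_nonneg a, sq_nonneg b]

lemma locInt_of_L2 {g : ℂ → ℂ} (hg : AEStronglyMeasurable g)
    (h2 : Integrable (fun z => ‖g z‖ ^ 2 * jw z)) : LocallyIntegrable g := by
  have h1 : LocallyIntegrable (fun z : ℂ => ‖g z‖ ^ 2 * jw z + (1 + ‖z‖ ^ 2) ^ 3) :=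
    h2.locallyIntegrable.add (Continuous.locallyIntegrable (by fun_prop))
  refine h1.mono hg (Filter.Eventually.of_forall fun z => ?_)
  rw [Real.norm_of_nonneg (add_nonneg (mul_nonneg (sq_nonneg _) (jw_pos z).le) (by positivity))]
  exact norm_le_weight g z

lemma mollify_entire {g : ℂ → ℂ} (hl : LocallyIntegrable g)
    (ho : ∀ B, IsTest B → ∫ z, (starRingEnd ℂ) (g z) * wz B z = 0)
    {η : ℂ → ℝ} (hη : ContDiff ℝ (⊤ : ℕ∞) η) (hc : HasCompactSupport η) :
    Differentiable ℂ (convolution η g (ContinuousLinearMap.lsmul ℝ ℝ) volume) := by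
  have hη1 : ContDiff ℝ 1 η := hη.of_le (by exact_mod_cast le_top)
  intro x
  rw [differentiableAt_complex_iff_differentiableAt_real]
  have hd := hc.hasFDerivAt_convolution_right (ContinuousLinearMap.lsmul ℝ ℝ : ℝ →L[ℝ] ℂ →L[ℝ] ℂ).flip hl hη1 x
  rw [convolution_flip] at hd
  refine ⟨hd.differentiableAt, ?_⟩
  rw [hd.fderiv]
  rw [convolution_precompR_apply _ hl (hc.fderiv ℝ) (hη1.continuous_fderiv (by norm_num)),
    convolution_precompR_apply _ hl (hc.fderiv ℝ) (hη1.continuous_fderiv (by norm_num))]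
  simp only [convolution_def, ContinuousLinearMap.flip_apply, ContinuousLinearMap.lsmul_apply]
  -- test function
  set B : ℂ → ℂ := fun t => (η (x - t) : ℂ) with hB
  have hBt : IsTest B := by
    constructor
    · exact Complex.ofRealCLM.contDiff.comp (hη.comp (contDiff_const.sub contDiff_id))
    · have h1 : HasCompactSupport (fun t => η (x - t)) :=
        hc.comp_homeomorph (Homeomorph.subLeft x)
      exact h1.comp_left (g := fun r : ℝ => (r : ℂ)) (by simp)
  have key := ho B hBt
  have hfd : ∀ t v, fderiv ℝ B t v = -((fderiv ℝ η (x - t) v : ℝ) : ℂ) := by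
    intro t v
    have h1 : HasFDerivAt η (fderiv ℝ η (x - t)) (x - t) :=
      (hη1.differentiable (by norm_num) _).hasFDerivAt
    have h2 : HasFDerivAt (fun t : ℂ => x - t) (-ContinuousLinearMap.id ℝ ℂ) t := by
      simpa using (hasFDerivAt_id (𝕜 := ℝ) t).const_sub x
    have h3 := Complex.ofRealCLM.hasFDerivAt.comp t (h1.comp t h2)
    have h4 : HasFDerivAt B _ t := h3
    rw [h4.fderiv]
    simp
  have hItg : ∀ v : ℂ, Integrable (fun t => (fderiv ℝ η (x - t)) v • g t) := by
    intro v
    have hcv : HasCompactSupport (fun y => fderiv ℝ η y v) := hc.fderiv_apply ℝ v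
    have hcont : Continuous (fun y => fderiv ℝ η y v) :=
      (hη1.continuous_fderiv (by norm_num)).clm_apply continuous_const
    exact (hcv.convolutionExists_right (ContinuousLinearMap.lsmul ℝ ℝ : ℝ →L[ℝ] ℂ →L[ℝ] ℂ).flip
      hl hcont x)
  have key2 : ∫ t, ((fderiv ℝ η (x - t)) 1 • g t + Complex.I * ((fderiv ℝ η (x - t)) Complex.I • g t)) = 0 := by
    have h1 : ∫ z, (starRingEnd ℂ) ((starRingEnd ℂ) (g z) * wz B z) = 0 := by
      rw [integral_conj, key, map_zero]
    have h2 : ∀ z, (starRingEnd ℂ) ((starRingEnd ℂ) (g z) * wz B z) =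
      (-(1 / 2) : ℂ) * ((fderiv ℝ η (x - z)) 1 • g z + Complex.I * ((fderiv ℝ η (x - z)) Complex.I • g z)) := by
      intro z
      simp only [wz, hfd, map_mul, map_sub, Complex.conj_conj, map_neg, Complex.conj_ofReal,
        Complex.conj_I, map_div₀, map_one, Complex.real_smul, map_ofNat]
      ring
    simp_rw [h2] at h1
    rw [integral_const_mul] at h1
    simpa using h1
  rw [integral_add (hItg 1) ((hItg Complex.I).const_mul _), integral_const_mul] at key2
  have e : ∫ t, (fderiv ℝ η (x - t)) 1 • g t = -(Complex.I * ∫ t, (fderiv ℝ η (x - t)) Complex.I • g t) :=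
    eq_neg_of_add_eq_zero_left key2
  rw [e, smul_eq_mul, mul_neg, ← mul_assoc, Complex.I_mul_I]; simp

lemma mollify_growth {g : ℂ → ℂ} (hg : AEStronglyMeasurable g)
    (h2 : Integrable (fun z => ‖g z‖ ^ 2 * jw z))
    {η : ℂ → ℝ} (hη : Continuous η) (h0 : ∀ z, 0 ≤ η z) (hs : ∀ z, 1 < ‖z‖ → η z = 0)
    (hc : HasCompactSupport η) (h1 : ∫ z, η z = 1) :
    ∃ K, ∀ z, 1 ≤ ‖z‖ → ‖convolution η g (ContinuousLinearMap.lsmul ℝ ℝ) volume z‖ ≤ K * ‖z‖ ^ 6 := by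
  obtain ⟨M, hM⟩ := hη.bounded_above_of_compact_support hc
  have hM0 : 0 ≤ M := (norm_nonneg _).trans (hM 0)
  set N := ∫ z, ‖g z‖ ^ 2 * jw z with hN
  have hN0 : 0 ≤ N := integral_nonneg fun z => mul_nonneg (sq_nonneg _) (jw_pos z).le
  refine ⟨M * N + 125, fun x hx => ?_⟩
  rw [convolution_def]
  have hiη : Integrable η := hη.integrable_of_hasCompactSupport hc
  have hi1 : Integrable (fun t => ‖g (x - t)‖ ^ 2 * jw (x - t)) :=
    (h2.comp_sub_left x)
  calc ‖∫ t, (ContinuousLinearMap.lsmul ℝ ℝ) (η t) (g (x - t))‖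
      ≤ ∫ t, (M * (‖g (x - t)‖ ^ 2 * jw (x - t)) + 125 * ‖x‖ ^ 6 * η t) := by
        refine norm_integral_le_of_norm_le ((hi1.const_mul M).add (hiη.const_mul _)) ?_
        refine Filter.Eventually.of_forall fun t => ?_
        simp only [ContinuousLinearMap.lsmul_apply, norm_smul, Real.norm_of_nonneg (h0 t)]
        have hj := mul_nonneg (sq_nonneg ‖g (x - t)‖) (jw_pos (x - t)).le
        have hMt := (Real.norm_of_nonneg (h0 t)) ▸ hM t
        by_cases ht : 1 < ‖t‖
        · rw [hs t ht]; simp only [zero_mul, mul_zero, add_zero]; positivity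
        · push Not at ht
          have hxt : ‖x - t‖ ≤ 2 * ‖x‖ := (norm_sub_le _ _).trans (by linarith)
          have hb : (1 + ‖x - t‖ ^ 2) ^ 3 ≤ 125 * ‖x‖ ^ 6 := by
            have : 1 + ‖x - t‖ ^ 2 ≤ 5 * ‖x‖ ^ 2 := by nlinarith [norm_nonneg (x - t)]
            calc _ ≤ (5 * ‖x‖ ^ 2) ^ 3 := by gcongr
              _ = _ := by ring
          calc η t * ‖g (x - t)‖ ≤ η t * (‖g (x - t)‖ ^ 2 * jw (x - t) + (1 + ‖x - t‖ ^ 2) ^ 3) := by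
                exact mul_le_mul_of_nonneg_left (norm_le_weight g (x - t)) (h0 t)
            _ = η t * (‖g (x - t)‖ ^ 2 * jw (x - t)) + (1 + ‖x - t‖ ^ 2) ^ 3 * η t := by ring
            _ ≤ _ := add_le_add (mul_le_mul_of_nonneg_right hMt hj) (mul_le_mul_of_nonneg_right hb (h0 t))
    _ = M * N + 125 * ‖x‖ ^ 6 := by
        rw [integral_add (hi1.const_mul M) (hiη.const_mul _), integral_const_mul, integral_const_mul,
          h1, integral_sub_left_eq_self (fun t => ‖g t‖ ^ 2 * jw t)]; simp [hN]
    _ ≤ (M * N + 125) * ‖x‖ ^ 6 := by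
        have : 1 ≤ ‖x‖ ^ 6 := one_le_pow₀ hx
        nlinarith [mul_nonneg hM0 hN0]

theorem weyl_liouville {g : ℂ → ℂ} (hg : AEStronglyMeasurable g)
    (h2 : Integrable (fun z => ‖g z‖ ^ 2 * jw z))
    (ho : ∀ B, IsTest B → ∫ z, (starRingEnd ℂ) (g z) * wz B z = 0) :
    ∃ a b : ℂ, ∀ᵐ z, g z = a + b * z := by
  have hl := locInt_of_L2 hg h2
  let φ : ℕ → ContDiffBump (0 : ℂ) := fun n =>
    { rIn := 1 / (2 * ((n : ℝ) + 1)), rOut := 1 / ((n : ℝ) + 1), rIn_pos := by positivity,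
      rIn_lt_rOut := by
        apply one_div_lt_one_div_of_lt (by positivity)
        have : (0 : ℝ) ≤ n := n.cast_nonneg
        linarith }
  have hlim := ContDiffBump.ae_convolution_tendsto_right_of_locallyIntegrable (φ := φ)
    (l := Filter.atTop) (K := 2) (μ := (volume : Measure ℂ)) (g := g)
    (tendsto_one_div_add_atTop_nhds_zero_nat)
    (Filter.Eventually.of_forall fun n => by
      show 1 / ((n : ℝ) + 1) ≤ 2 * (1 / (2 * ((n : ℝ) + 1)))
      apply le_of_eq; field_simp) hl
  have hpoly : ∀ n, ∃ P : Polynomial ℂ, P.degree < 7 ∧ ∀ z, P.eval z =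
      convolution ((φ n).normed volume) g (ContinuousLinearMap.lsmul ℝ ℝ) volume z := by
    intro n
    have hcs : HasCompactSupport ((φ n).normed volume) := (φ n).hasCompactSupport_normed
    obtain ⟨K, hK⟩ := mollify_growth hg h2 (φ n).continuous_normed (φ n).nonneg_normed
      (fun z hz => by
        by_contra hne
        have hmem : z ∈ Function.support ((φ n).normed volume) := hne
        rw [(φ n).support_normed_eq] at hmem
        have : ‖z‖ < (φ n).rOut := by simpa using hmem
        have : ‖z‖ < 1 / ((n : ℝ) + 1) := this
        have h3 : 1 / ((n : ℝ) + 1) ≤ 1 := by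
          rw [div_le_one (by positivity)]
          have : (0 : ℝ) ≤ n := n.cast_nonneg
          linarith
        linarith) hcs (φ n).integral_normed
    exact entire_poly (mollify_entire hl ho (φ n).contDiff_normed hcs) hK
  choose P hP1 hP2 using hpoly
  obtain ⟨Q, hQ⟩ := tendsto_poly_limit hP1 (g := g) (by
    filter_upwards [hlim] with z hz
    simp_rw [hP2]; exact hz)
  obtain ⟨a, b, hab⟩ := poly_L2 (P := Q) (h2.congr (by
    filter_upwards [hQ] with z hz; rw [hz]))
  exact ⟨a, b, by filter_upwards [hQ] with z hz; rw [hz, hab]⟩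

lemma hilbert_abs {H : Type*} [NormedAddCommGroup H] [InnerProductSpace ℂ H] [CompleteSpace H]
    (V : Submodule ℂ H) (h : H) (M : ℝ) (hM : ∀ v ∈ V, ‖inner ℂ v h‖ ≤ M * ‖v‖)
    (horth : ∀ u ∈ Vᗮ, inner ℂ u h = 0) : ‖h‖ ^ 2 ≤ M * ‖h‖ := by
  have h1 : h ∈ V.topologicalClosure := by
    rw [← Submodule.orthogonal_orthogonal_eq_closure, Submodule.mem_orthogonal]
    exact horth
  have hcl : IsClosed {v : H | ‖inner ℂ v h‖ ≤ M * ‖v‖} :=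
    isClosed_le (by fun_prop) (by fun_prop)
  have h2 : h ∈ {v : H | ‖inner ℂ v h‖ ≤ M * ‖v‖} := by
    have : (V : Set H) ⊆ {v : H | ‖inner ℂ v h‖ ≤ M * ‖v‖} := hM
    exact (hcl.closure_subset_iff.2 this) h1
  have h3 : ‖inner ℂ h h‖ ≤ M * ‖h‖ := h2
  rwa [inner_self_eq_norm_sq_to_K, norm_pow, RCLike.norm_ofReal, abs_norm] at h3

noncomputable def wm (E : ℂ → ℝ) : Measure ℂ := volume.withDensity (fun z => ENNReal.ofReal (E z))

section
variable {E : ℂ → ℝ} (hE : Continuous E) (hE0 : ∀ z, 0 < E z)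

lemma ae_wm {hE : Continuous E} {hE0 : ∀ z, 0 < E z} {p : ℂ → Prop} :
    (∀ᵐ z ∂(wm E), p z) ↔ ∀ᵐ z, p z := by
  unfold wm
  constructor
  · intro h
    have hac : (volume : Measure ℂ) ≪ volume.withDensity (fun z => ENNReal.ofReal (E z)) :=
      withDensity_absolutelyContinuous' (hE.measurable.ennreal_ofReal.aemeasurable)
        (Filter.Eventually.of_forall fun z => by simpa using hE0 z)
    exact hac.ae_le h
  · intro h
    exact (withDensity_absolutelyContinuous _ _).ae_le h

lemma integral_wm (hE : Continuous E) (hE0 : ∀ z, 0 < E z) (f : ℂ → ℂ) :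
    ∫ z, f z ∂(wm E) = ∫ z, (E z : ℂ) * f z := by
  unfold wm
  rw [integral_withDensity_eq_integral_toReal_smul hE.measurable.ennreal_ofReal (by simp)]
  congr 1; ext1 z
  rw [ENNReal.toReal_ofReal (hE0 z).le]; simp

lemma integral_wm_real (hE : Continuous E) (hE0 : ∀ z, 0 < E z) (f : ℂ → ℝ) :
    ∫ z, f z ∂(wm E) = ∫ z, E z * f z := by
  unfold wm
  rw [integral_withDensity_eq_integral_toReal_smul hE.measurable.ennreal_ofReal (by simp)]
  congr 1; ext1 z
  rw [ENNReal.toReal_ofReal (hE0 z).le]; simp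

lemma memLp_wm (hE : Continuous E) (hE0 : ∀ z, 0 < E z) {f : ℂ → ℂ} (hf : AEStronglyMeasurable f) :
    MemLp f 2 (wm E) ↔ Integrable (fun z => ‖f z‖ ^ 2 * E z) := by
  have hf' : AEStronglyMeasurable f (wm E) := hf.mono_ac (withDensity_absolutelyContinuous _ _)
  rw [memLp_two_iff_integrable_sq_norm hf']
  unfold wm
  rw [integrable_withDensity_iff hE.measurable.ennreal_ofReal (by simp)]
  constructor
  · intro h; refine h.congr (Filter.Eventually.of_forall fun z => ?_)
    simp [ENNReal.toReal_ofReal (hE0 z).le]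
  · intro h; refine h.congr (Filter.Eventually.of_forall fun z => ?_)
    simp [ENNReal.toReal_ofReal (hE0 z).le]

lemma wz_add {B B' : ℂ → ℂ} (h : ContDiff ℝ (⊤ : ℕ∞) B) (h' : ContDiff ℝ (⊤ : ℕ∞) B') (z : ℂ) :
    wz (fun z => B z + B' z) z = wz B z + wz B' z :=
  (((h.differentiable (by simp) z).hasW).add ((h'.differentiable (by simp) z).hasW)).wz_eq

lemma wz_smul {B : ℂ → ℂ} (h : ContDiff ℝ (⊤ : ℕ∞) B) (c z : ℂ) :
    wz (fun z => c * B z) z = c * wz B z := by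
  have := ((HasW.const c z).mul ((h.differentiable (by simp) z).hasW)).wz_eq
  simpa using this

end

theorem hormander {w om G : ℂ → ℝ} {P Q h h1 h2 : ℂ → ℂ} (hw : ∀ z, 0 < w z)
    (hwD : ∀ z, HasW (fun z => (w z : ℂ)) (w z * (starRingEnd ℂ) (P z)) (w z * P z) z)
    (hP : ∀ z, HasW P (om z) (Q z) z) (hQ : Continuous Q) (hom : Continuous om)
    (hom0 : ∀ z, 0 ≤ om z)
    {c C : ℝ} (hc : 0 < c) (hlow : ∀ z, c * jw z ≤ (w z)⁻¹) (hup : ∀ z, (w z)⁻¹ ≤ C * jw z)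
    (hh : ∀ z, HasW h (h1 z) (h2 z) z) (hh1 : Continuous h1) (hh2 : Continuous h2)
    (hL2 : Integrable (fun z => ‖h z‖ ^ 2 * (w z)⁻¹))
    (ho0 : ∫ z, h z * ((w z)⁻¹ : ℝ) = 0) (ho1 : ∫ z, (starRingEnd ℂ) z * h z * ((w z)⁻¹ : ℝ) = 0)
    (hG : Continuous G) (hG0 : ∀ z, 0 ≤ G z)
    (hle : ∀ z, ‖h2 z‖ ^ 2 ≤ G z * om z) (hGi : Integrable (fun z => G z * (w z)⁻¹)) :
    ∫ z, ‖h z‖ ^ 2 * (w z)⁻¹ ≤ ∫ z, G z * (w z)⁻¹ := by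
  have cwc : Continuous (fun z => (w z : ℂ)) :=
    continuous_iff_continuousAt.2 fun z => HasFDerivAt.continuousAt (hwD z)
  have cw : Continuous w := by
    have := Complex.continuous_re.comp cwc
    simpa [Function.comp_def] using this
  have ch : Continuous h :=
    continuous_iff_continuousAt.2 fun z => HasFDerivAt.continuousAt (hh z)
  set E : ℂ → ℝ := fun z => (w z)⁻¹ with hEdef
  have hE : Continuous E := cw.inv₀ fun z => (hw z).ne'
  have hE0 : ∀ z, 0 < E z := fun z => inv_pos.2 (hw z)
  have hEw : ∀ z, E z * w z = 1 := fun z => inv_mul_cancel₀ (hw z).ne'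
  have cconj : Continuous (starRingEnd ℂ) := Complex.continuous_conj
  have hhL : MemLp h 2 (wm E) := (memLp_wm hE hE0 ch.aestronglyMeasurable).2 hL2
  set hL : Lp ℂ 2 (wm E) := hhL.toLp h with hhLdef
  have hLae : ∀ᵐ z ∂(wm E), hL z = h z := hhL.coeFn_toLp
  -- integrability of affine functions times h
  have haff : ∀ a b : ℂ, Integrable (fun z : ℂ => ‖a + b * z‖ ^ 2 * E z) := by
    intro a b
    refine Integrable.mono' ((integrable_jw_of_le (f := fun z => ‖a + b * z‖ ^ 2) (by fun_prop)
      (C := (‖a‖ + ‖b‖) ^ 2 * 2) fun z => ?_).const_mul C) (by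
        apply Continuous.aestronglyMeasurable; fun_prop)
      (Filter.Eventually.of_forall fun z => ?_)
    · rw [abs_of_nonneg (by positivity)]
      have n1 : ‖a + b * z‖ ≤ (‖a‖ + ‖b‖) * (1 + ‖z‖) := by
        refine (norm_add_le _ _).trans ?_
        rw [norm_mul]
        nlinarith [norm_nonneg a, norm_nonneg b, norm_nonneg z,
          mul_nonneg (norm_nonneg a) (norm_nonneg z)]
      have n2 : (1 + ‖z‖) ^ 2 ≤ 2 * (1 + ‖z‖ ^ 2) := by nlinarith [sq_nonneg (1 - ‖z‖)]
      calc _ ≤ ((‖a‖ + ‖b‖) * (1 + ‖z‖)) ^ 2 := by gcongr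
        _ = (‖a‖ + ‖b‖) ^ 2 * (1 + ‖z‖) ^ 2 := by ring
        _ ≤ (‖a‖ + ‖b‖) ^ 2 * (2 * (1 + ‖z‖ ^ 2)) := by gcongr
        _ = _ := by ring
    · rw [Real.norm_of_nonneg (mul_nonneg (sq_nonneg _) (hE0 z).le)]
      calc _ ≤ ‖a + b * z‖ ^ 2 * (C * jw z) := by gcongr; exact hup z
        _ = _ := by ring
  set M : ℝ := Real.sqrt (∫ z, G z * E z) with hM
  -- the submodule
  have hBtest : ∀ B, IsTest B → MemLp (fun z => (w z : ℂ) * wz B z) 2 (wm E) := by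
    intro B hB
    have c1 := (contDiff_wz hB.1).continuous
    rw [memLp_wm hE hE0 (by apply Continuous.aestronglyMeasurable; fun_prop)]
    apply Continuous.integrable_of_hasCompactSupport (by fun_prop)
    exact ((hB.2.wz.mul_left).comp_left (g := fun x : ℂ => ‖x‖ ^ 2) (by simp)).mul_right
  let V : Submodule ℂ (Lp ℂ 2 (wm E)) :=
    { carrier := {u | ∃ B, IsTest B ∧ u =ᵐ[wm E] fun z => (w z : ℂ) * wz B z}
      add_mem' := by
        rintro u v ⟨B, hB, hu⟩ ⟨B', hB', hv⟩
        refine ⟨fun z => B z + B' z, ⟨hB.1.add hB'.1, hB.2.add hB'.2⟩, ?_⟩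
        filter_upwards [hu, hv, Lp.coeFn_add u v] with z h1 h2 h3
        rw [h3, Pi.add_apply, h1, h2, wz_add hB.1 hB'.1]; ring
      zero_mem' := by
        refine ⟨fun _ => 0, ⟨contDiff_const, HasCompactSupport.zero⟩, ?_⟩
        filter_upwards [Lp.coeFn_zero ℂ 2 (wm E)] with z hz
        rw [hz, (HasW.const 0 z).wz_eq]; simp
      smul_mem' := by
        rintro c u ⟨B, hB, hu⟩
        refine ⟨fun z => c * B z, ⟨contDiff_const.mul hB.1, hB.2.mul_left⟩, ?_⟩
        filter_upwards [hu, Lp.coeFn_smul c u] with z h1 h3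
        rw [h3, Pi.smul_apply, h1, wz_smul hB.1, smul_eq_mul]; ring }
  have hnormsq : ∀ (u : Lp ℂ 2 (wm E)) (f : ℂ → ℂ), (u =ᵐ[wm E] f) →
      ‖u‖ ^ 2 = ∫ z, ‖f z‖ ^ 2 * E z := by
    intro u f huf
    have e1 : ((‖u‖ ^ 2 : ℝ) : ℂ) = inner ℂ u u := by
      rw [inner_self_eq_norm_sq_to_K]; norm_cast
    rw [L2.inner_def] at e1
    have e2 : ∫ z, inner ℂ (u z) (u z) ∂(wm E) = ∫ z, ((‖f z‖ ^ 2 : ℝ) : ℂ) ∂(wm E) := by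
      apply integral_congr_ae
      filter_upwards [huf] with z hz
      rw [hz, inner_self_eq_norm_sq_to_K]; norm_cast
    rw [e2, integral_complex_ofReal, integral_wm_real hE hE0] at e1
    have e3 := Complex.ofReal_injective e1
    rw [e3]; congr 1; ext1 z; ring
  have key := hilbert_abs V hL M ?_ ?_
  · have hn := hnormsq hL h hLae
    by_cases hz : ‖hL‖ = 0
    · rw [hz] at hn
      rw [← hn]
      simp only [ne_eq, OfNat.ofNat_ne_zero, not_false_eq_true, zero_pow]
      exact integral_nonneg fun z => mul_nonneg (hG0 z) (hE0 z).le
    · have hpos : 0 < ‖hL‖ := lt_of_le_of_ne (norm_nonneg _) (Ne.symm hz)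
      have : ‖hL‖ ≤ M := by nlinarith
      rw [← hn]
      calc ‖hL‖ ^ 2 ≤ M ^ 2 := by gcongr
        _ = _ := Real.sq_sqrt (integral_nonneg fun z => mul_nonneg (hG0 z) (hE0 z).le)
  · rintro u ⟨B, hB, hu⟩
    have c1 := (contDiff_wz hB.1).continuous
    have c2 := (contDiff_wzb hB.1).continuous
    have cB := hB.1.continuous
    have e1 : inner ℂ u hL = ∫ z, (starRingEnd ℂ) (wz B z) * h z := by
      rw [L2.inner_def]
      have : ∫ z, inner ℂ (u z) (hL z) ∂(wm E) =
          ∫ z, (starRingEnd ℂ) ((w z : ℂ) * wz B z) * h z ∂(wm E) := by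
        apply integral_congr_ae
        filter_upwards [hu, hLae] with z h1 h2
        rw [h1, h2, RCLike.inner_apply]; ring
      rw [this, integral_wm hE hE0]
      congr 1; ext1 z
      have := hEw z
      rw [map_mul, Complex.conj_ofReal]
      have : (E z : ℂ) * (w z : ℂ) = 1 := by exact_mod_cast this
      linear_combination ((starRingEnd ℂ) (wz B z) * h z) * this
    have hD := fun z => (hh z).mul (((hB.1.differentiable (by simp) z).hasW).conj)
    have sB : HasCompactSupport (fun z => (starRingEnd ℂ) (B z)) :=
      hB.2.comp_left (g := starRingEnd ℂ) (by simp)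
    obtain ⟨-, -, hz0⟩ := integral_wirt_zero hD (by fun_prop) (by fun_prop) sB.mul_left
    have i1 : Integrable (fun z => h2 z * (starRingEnd ℂ) (B z)) := by
      apply Continuous.integrable_of_hasCompactSupport (by fun_prop); exact sB.mul_left
    have i2 : Integrable (fun z => h z * (starRingEnd ℂ) (wz B z)) := by
      apply Continuous.integrable_of_hasCompactSupport (by fun_prop)
      exact (hB.2.wz.comp_left (g := starRingEnd ℂ) (by simp)).mul_left
    rw [integral_add i1 i2] at hz0
    have e2 : inner ℂ u hL = - ∫ z, h2 z * (starRingEnd ℂ) (B z) := by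
      rw [e1, eq_neg_iff_add_eq_zero, add_comm, ← hz0]
      congr 2; ext1 z; ring
    rw [e2, norm_neg]
    have hn : ‖u‖ ^ 2 = ∫ z, ‖wz B z‖ ^ 2 * w z := by
      rw [hnormsq u _ hu]
      congr 1; ext1 z
      rw [norm_mul, mul_pow, Complex.norm_real, Real.norm_of_nonneg (hw z).le]
      linear_combination (‖wz B z‖ ^ 2 * w z) * hEw z
    have hb := bochner hw hwD hP hQ hom hB
    -- Cauchy-Schwarz
    have f1 : MemLp (fun z => Real.sqrt (G z * E z)) 2 := by
      rw [memLp_two_iff_integrable_sq (by apply Continuous.aestronglyMeasurable; fun_prop)]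
      refine hGi.congr (Filter.Eventually.of_forall fun z => ?_)
      simp only; rw [Real.sq_sqrt (mul_nonneg (hG0 z) (hE0 z).le)]
    have f2 : MemLp (fun z => Real.sqrt (om z * ‖B z‖ ^ 2 * w z)) 2 := by
      rw [memLp_two_iff_integrable_sq (by apply Continuous.aestronglyMeasurable; fun_prop)]
      have : Integrable (fun z => om z * ‖B z‖ ^ 2 * w z) := by
        apply Continuous.integrable_of_hasCompactSupport (by fun_prop)
        exact ((hB.2.comp_left (g := fun x : ℂ => ‖x‖ ^ 2) (by simp)).mul_left).mul_right
      refine this.congr (Filter.Eventually.of_forall fun z => ?_)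
      simp only; rw [Real.sq_sqrt (mul_nonneg (mul_nonneg (hom0 z) (sq_nonneg _)) (hw z).le)]
    have cs := integral_mul_le_Lp_mul_Lq_of_nonneg (μ := (volume : Measure ℂ)) Real.HolderConjugate.two_two
      (f := fun z => Real.sqrt (G z * E z)) (g := fun z => Real.sqrt (om z * ‖B z‖ ^ 2 * w z))
      (Filter.Eventually.of_forall fun z => Real.sqrt_nonneg _)
      (Filter.Eventually.of_forall fun z => Real.sqrt_nonneg _)
      (by simpa using f1) (by simpa using f2)
    have g1 : ∀ z, Real.sqrt (G z * E z) ^ (2 : ℝ) = G z * E z := by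
      intro z; rw [Real.rpow_two, Real.sq_sqrt (mul_nonneg (hG0 z) (hE0 z).le)]
    have g2 : ∀ z, Real.sqrt (om z * ‖B z‖ ^ 2 * w z) ^ (2 : ℝ) = om z * ‖B z‖ ^ 2 * w z := by
      intro z
      rw [Real.rpow_two, Real.sq_sqrt (mul_nonneg (mul_nonneg (hom0 z) (sq_nonneg _)) (hw z).le)]
    simp_rw [g1, g2, ← Real.sqrt_eq_rpow] at cs
    calc ‖∫ z, h2 z * (starRingEnd ℂ) (B z)‖ ≤
        ∫ z, Real.sqrt (G z * E z) * Real.sqrt (om z * ‖B z‖ ^ 2 * w z) := by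
          refine norm_integral_le_of_norm_le (MemLp.integrable_mul f1 f2) (Filter.Eventually.of_forall fun z => ?_)
          rw [norm_mul, RCLike.norm_conj, ← Real.sqrt_mul (mul_nonneg (hG0 z) (hE0 z).le)]
          apply Real.le_sqrt_of_sq_le
          rw [mul_pow]
          calc _ ≤ (G z * om z) * ‖B z‖ ^ 2 := by gcongr; exact hle z
            _ = _ := by linear_combination (-(G z * om z) * ‖B z‖ ^ 2) * hEw z
      _ ≤ M * Real.sqrt (∫ z, om z * ‖B z‖ ^ 2 * w z) := cs
      _ ≤ M * ‖u‖ := by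
          gcongr
          rw [← Real.sqrt_sq (norm_nonneg u), hn]
          exact Real.sqrt_le_sqrt hb
  · intro u hu
    rw [Submodule.mem_orthogonal] at hu
    have humem := Lp.memLp u
    have hum : AEStronglyMeasurable u (volume : Measure ℂ) := by
      refine (Lp.aestronglyMeasurable u).mono_ac ?_
      exact withDensity_absolutelyContinuous' (hE.measurable.ennreal_ofReal.aemeasurable)
        (Filter.Eventually.of_forall fun z => by simpa using hE0 z)
    have huL := (memLp_wm hE hE0 hum).1 humem
    have huj : Integrable (fun z => ‖u z‖ ^ 2 * jw z) := by
      refine Integrable.mono' (huL.const_mul c⁻¹) ?_ (Filter.Eventually.of_forall fun z => ?_)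
      · exact (hum.norm.pow 2).mul continuous_jw.aestronglyMeasurable
      · rw [Real.norm_of_nonneg (mul_nonneg (sq_nonneg _) (jw_pos z).le)]
        have := hlow z
        calc ‖u z‖ ^ 2 * jw z = c⁻¹ * (‖u z‖ ^ 2 * (c * jw z)) := by field_simp
          _ ≤ _ := by gcongr
    obtain ⟨a, b, hab⟩ := weyl_liouville hum huj (fun B hB => by
      have := hu ((hBtest B hB).toLp _) ⟨B, hB, (hBtest B hB).coeFn_toLp⟩
      rw [L2.inner_def] at this
      have e2 : ∫ z, inner ℂ (((hBtest B hB).toLp _ : Lp ℂ 2 (wm E)) z) (u z) ∂(wm E) =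
          ∫ z, (starRingEnd ℂ) ((w z : ℂ) * wz B z) * u z ∂(wm E) := by
        apply integral_congr_ae
        filter_upwards [(hBtest B hB).coeFn_toLp] with z h1
        rw [h1, RCLike.inner_apply]; ring
      rw [e2, integral_wm hE hE0] at this
      have e3 : ∫ z, (starRingEnd ℂ) ((starRingEnd ℂ) (u z) * wz B z) = 0 := by
        rw [← this]
        congr 1; ext1 z
        rw [map_mul, map_mul, Complex.conj_ofReal, Complex.conj_conj]
        have : (E z : ℂ) * (w z : ℂ) = 1 := by exact_mod_cast hEw z
        linear_combination (-(starRingEnd ℂ) (wz B z) * u z) * this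
      rw [integral_conj] at e3
      simpa using e3)
    rw [L2.inner_def]
    have hab' : ∀ᵐ z ∂(wm E), u z = a + b * z := (ae_wm (hE := hE) (hE0 := hE0)).2 hab
    have e2 : ∫ z, inner ℂ (u z) (hL z) ∂(wm E) =
          ∫ z, (starRingEnd ℂ) (a + b * z) * h z ∂(wm E) := by
      apply integral_congr_ae
      filter_upwards [hab', hLae] with z h1 h2
      rw [h1, h2, RCLike.inner_apply]; ring
    rw [e2, integral_wm hE hE0]
    have hItg : ∀ a b : ℂ, Integrable (fun z : ℂ => (starRingEnd ℂ) (a + b * z) * h z * (E z : ℂ)) := by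
      intro a b
      refine Integrable.mono' ((haff a b).add hL2) (by
        apply Continuous.aestronglyMeasurable; fun_prop) (Filter.Eventually.of_forall fun z => ?_)
      rw [norm_mul, norm_mul, RCLike.norm_conj, Complex.norm_real, Real.norm_of_nonneg (hE0 z).le]
      simp only [Pi.add_apply]
      rw [← add_mul]
      refine mul_le_mul_of_nonneg_right ?_ (hE0 z).le
      nlinarith [sq_nonneg (‖a + b * z‖ - ‖h z‖), sq_nonneg ‖a + b * z‖, sq_nonneg ‖h z‖]
    have i0 : Integrable (fun z => h z * (E z : ℂ)) := by simpa using hItg 1 0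
    have i1 : Integrable (fun z => (starRingEnd ℂ) z * h z * (E z : ℂ)) := by simpa using hItg 0 1
    have e4 : ∀ z, (E z : ℂ) * ((starRingEnd ℂ) (a + b * z) * h z) =
        (starRingEnd ℂ) a * (h z * (E z : ℂ)) +
        (starRingEnd ℂ) b * ((starRingEnd ℂ) z * h z * (E z : ℂ)) := by
      intro z; rw [map_add, map_mul]; ring
    simp_rw [e4]
    rw [integral_add (i0.const_mul _) (i1.const_mul _), integral_const_mul, integral_const_mul]
    have o0 : ∫ z, h z * (E z : ℂ) = 0 := ho0
    have o1 : ∫ z, (starRingEnd ℂ) z * h z * (E z : ℂ) = 0 := ho1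
    rw [o0, o1]; simp

lemma HasW.real_comp {f : ℂ → ℝ} {a b z : ℂ} (h : HasW (fun z => (f z : ℂ)) a b z) {g : ℝ → ℝ}
    {g' : ℝ} (hg : HasDerivAt g g' (f z)) :
    HasW (fun z => ((g (f z) : ℝ) : ℂ)) (g' * a) (g' * b) z := by
  unfold HasW at *
  set L := a • (ContinuousLinearMap.id ℝ ℂ) + b • (Complex.conjCLE : ℂ →L[ℝ] ℂ) with hL
  have h1 : HasFDerivAt f (Complex.reCLM.comp L) z := by
    have := Complex.reCLM.hasFDerivAt.comp z h
    simpa [Function.comp_def] using this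
  have h2 : HasFDerivAt (fun z => (f z : ℂ)) (Complex.ofRealCLM.comp (Complex.reCLM.comp L)) z :=
    Complex.ofRealCLM.hasFDerivAt.comp z h1
  have huniq : Complex.ofRealCLM.comp (Complex.reCLM.comp L) = L := h2.unique h
  have h3 := hg.comp_hasFDerivAt z h1
  have h4 : HasFDerivAt (fun z => ((g (f z) : ℝ) : ℂ))
      (Complex.ofRealCLM.comp (g' • Complex.reCLM.comp L)) z :=
    Complex.ofRealCLM.hasFDerivAt.comp z h3
  refine h4.congr_fderiv ?_
  rw [ContinuousLinearMap.comp_smul, huniq, hL]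
  ext v; simp; ring

lemma gram_ineq {H : Type*} [NormedAddCommGroup H] [InnerProductSpace ℂ H] (x y u : H) (hx : x ≠ 0) :
    ‖inner ℂ y u * (‖x‖ ^ 2 : ℝ) - inner ℂ y x * inner ℂ x u‖ ^ 2 ≤
      (‖y‖ ^ 2 * ‖x‖ ^ 2 - ‖inner ℂ x y‖ ^ 2) * (‖u‖ ^ 2 * ‖x‖ ^ 2 - ‖inner ℂ x u‖ ^ 2) := by
  obtain ⟨N, hN⟩ : ∃ N : ℝ, N = ‖x‖ ^ 2 := ⟨_, rfl⟩
  rw [← hN]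
  have hN0 : 0 < N := by have := norm_pos_iff.2 hx; rw [hN]; positivity
  have hxx : inner ℂ x x = (N : ℂ) := by rw [inner_self_eq_norm_sq_to_K, hN]; norm_cast
  set y' := (N : ℂ) • y - (inner ℂ x y) • x with hy'
  set u' := (N : ℂ) • u - (inner ℂ x u) • x with hu'
  have e1 : ∀ a b : H, inner ℂ ((N : ℂ) • a - (inner ℂ x a) • x) ((N : ℂ) • b - (inner ℂ x b) • x) =
      (N : ℂ) * (inner ℂ a b * N - inner ℂ a x * inner ℂ x b) := by
    intro a b
    simp only [inner_sub_left, inner_sub_right, inner_smul_left, inner_smul_right, hxx,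
      Complex.conj_ofReal]
    rw [inner_conj_symm]
    ring
  have cs := norm_inner_le_norm (𝕜 := ℂ) y' u'
  have e2 : ∀ a : H, ‖(N : ℂ) • a - (inner ℂ x a) • x‖ ^ 2 = N * (‖a‖ ^ 2 * N - ‖inner ℂ x a‖ ^ 2) := by
    intro a
    have h1 := e1 a a
    rw [inner_self_eq_norm_sq_to_K, inner_self_eq_norm_sq_to_K] at h1
    have h2 : inner ℂ a x * inner ℂ x a = ((‖inner ℂ x a‖ ^ 2 : ℝ) : ℂ) := by
      rw [← inner_conj_symm a x, mul_comm, Complex.mul_conj, Complex.normSq_eq_norm_sq]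
    rw [h2] at h1
    apply Complex.ofReal_injective
    rw [Complex.ofReal_pow, Complex.ofReal_mul, Complex.ofReal_sub, Complex.ofReal_mul,
      Complex.ofReal_pow]
    exact h1
  have h3 : ‖inner ℂ y' u'‖ ^ 2 ≤ ‖y'‖ ^ 2 * ‖u'‖ ^ 2 := by
    rw [← mul_pow]; gcongr
  rw [e2 y, e2 u, e1 y u, norm_mul, mul_pow, Complex.norm_real, Real.norm_of_nonneg hN0.le] at h3
  have : N ^ 2 * ‖inner ℂ y u * (N : ℂ) - inner ℂ y x * inner ℂ x u‖ ^ 2 ≤ N ^ 2 *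
    ((‖y‖ ^ 2 * N - ‖inner ℂ x y‖ ^ 2) * (‖u‖ ^ 2 * N - ‖inner ℂ x u‖ ^ 2)) := by
    linarith
  exact le_of_mul_le_mul_left this (by positivity)

section
variable {ι : Type*} [Fintype ι]

/-- weighted sum -/
noncomputable def pS (p : ι → Polynomial ℂ) (om : ι → ℝ) (z : ℂ) : ℝ :=
  ∑ i, om i * ‖(p i).eval z‖ ^ 2

noncomputable def pI (p r : ι → Polynomial ℂ) (om : ι → ℝ) (z : ℂ) : ℂ :=
  ∑ i, (om i : ℂ) * ((p i).eval z * (starRingEnd ℂ) ((r i).eval z))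

noncomputable def dp (p : ι → Polynomial ℂ) : ι → Polynomial ℂ := fun i => (p i).derivative

lemma pS_eq (p : ι → Polynomial ℂ) (om : ι → ℝ) (z : ℂ) : (pS p om z : ℂ) = pI p p om z := by
  unfold pS pI
  push_cast
  refine Finset.sum_congr rfl fun i _ => ?_
  rw [Complex.mul_conj, Complex.normSq_eq_norm_sq]; push_cast; ring

lemma pI_conj (p r : ι → Polynomial ℂ) (om : ι → ℝ) (z : ℂ) :
    (starRingEnd ℂ) (pI p r om z) = pI r p om z := by
  unfold pI
  rw [map_sum]
  refine Finset.sum_congr rfl fun i _ => ?_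
  rw [map_mul, map_mul, Complex.conj_ofReal, Complex.conj_conj]; ring

lemma pI_hasW (p r : ι → Polynomial ℂ) (om : ι → ℝ) (z : ℂ) :
    HasW (pI p r om) (pI (dp p) r om z) (pI p (dp r) om z) z := by
  unfold pI
  refine (HasW.sum (s := Finset.univ) fun i _ => (HasW.const (om i : ℂ) z).mul
    (((p i).hasDerivAt z).hasW.mul (((r i).hasDerivAt z).hasW.conj))).congr ?_ ?_
  · refine Finset.sum_congr rfl fun i _ => ?_
    simp [dp]
  · refine Finset.sum_congr rfl fun i _ => ?_
    simp [dp]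

lemma continuous_pI (p r : ι → Polynomial ℂ) (om : ι → ℝ) : Continuous (pI p r om) :=
  continuous_iff_continuousAt.2 fun z => HasFDerivAt.continuousAt (pI_hasW p r om z)

lemma continuous_pS (p : ι → Polynomial ℂ) (om : ι → ℝ) : Continuous (pS p om) := by
  unfold pS; fun_prop

lemma pS_hasW (p : ι → Polynomial ℂ) (om : ι → ℝ) (z : ℂ) :
    HasW (fun z => (pS p om z : ℂ)) (pI (dp p) p om z) (pI p (dp p) om z) z := by
  have : (fun z => (pS p om z : ℂ)) = pI p p om := funext (pS_eq p om)
  rw [this]; exact pI_hasW p p om z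

/-- the Gram inequality for the sums -/
lemma pS_gram (p : ι → Polynomial ℂ) (om lam : ι → ℝ) (hom : ∀ i, 0 < om i) (z : ℂ)
    (hS : 0 < pS p om z) :
    ‖pI p (dp p) (fun i => lam i * om i) z * (pS p om z : ℂ) -
      (pS p (fun i => lam i * om i) z : ℂ) * pI p (dp p) om z‖ ^ 2 ≤
    (pS p (fun i => lam i ^ 2 * om i) z * pS p om z - pS p (fun i => lam i * om i) z ^ 2) *
    (pS (dp p) om z * pS p om z - ‖pI p (dp p) om z‖ ^ 2) := by
  let x : EuclideanSpace ℂ ι := WithLp.toLp 2 fun i => (Real.sqrt (om i) : ℂ) * (p i).eval z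
  let y : EuclideanSpace ℂ ι := WithLp.toLp 2 fun i => (lam i * Real.sqrt (om i) : ℂ) * (p i).eval z
  let u : EuclideanSpace ℂ ι := WithLp.toLp 2 fun i => (Real.sqrt (om i) : ℂ) * (dp p i).eval z
  have hsq : ∀ i, (Real.sqrt (om i) : ℂ) * (Real.sqrt (om i) : ℂ) = (om i : ℂ) := fun i => by
    rw [← Complex.ofReal_mul, Real.mul_self_sqrt (hom i).le]
  have hsq' : ∀ i, Real.sqrt (om i) ^ 2 = om i := fun i => Real.sq_sqrt (hom i).le
  have nx : ‖x‖ ^ 2 = pS p om z := by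
    rw [EuclideanSpace.norm_sq_eq]
    refine Finset.sum_congr rfl fun i _ => ?_
    simp [x, mul_pow, hsq']
  have ny : ‖y‖ ^ 2 = pS p (fun i => lam i ^ 2 * om i) z := by
    rw [EuclideanSpace.norm_sq_eq]
    refine Finset.sum_congr rfl fun i _ => ?_
    simp [y, mul_pow, hsq']
  have nu : ‖u‖ ^ 2 = pS (dp p) om z := by
    rw [EuclideanSpace.norm_sq_eq]
    refine Finset.sum_congr rfl fun i _ => ?_
    simp [u, mul_pow, hsq']
  have ixy : inner ℂ x y = (pS p (fun i => lam i * om i) z : ℂ) := by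
    rw [pS_eq, PiLp.inner_apply]
    refine Finset.sum_congr rfl fun i _ => ?_
    rw [RCLike.inner_apply]
    simp only [x, y, map_mul, Complex.conj_ofReal]
    push_cast
    rw [← hsq i]; ring
  have iyu : inner ℂ u y = pI p (dp p) (fun i => lam i * om i) z := by
    rw [PiLp.inner_apply]
    refine Finset.sum_congr rfl fun i _ => ?_
    rw [RCLike.inner_apply]
    simp only [u, y, map_mul, Complex.conj_ofReal]
    push_cast
    rw [← hsq i]; ring
  have ixu : inner ℂ u x = pI p (dp p) om z := by
    rw [PiLp.inner_apply]
    refine Finset.sum_congr rfl fun i _ => ?_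
    rw [RCLike.inner_apply]
    simp only [u, x, map_mul, Complex.conj_ofReal]
    rw [← hsq i]; ring
  have hx : x ≠ 0 := by
    intro h0; rw [h0] at nx; simp at nx; linarith
  have := gram_ineq x y u hx
  rw [nx, ny, nu, ← inner_conj_symm y u, ← inner_conj_symm y x, ← inner_conj_symm x u, ixy, iyu,
    ixu, RCLike.norm_conj] at this
  rw [← RCLike.norm_conj]
  simp only [map_sub, map_mul, Complex.conj_ofReal] at this ⊢
  refine this.trans (le_of_eq ?_)
  rw [Complex.norm_real, Real.norm_eq_abs, sq_abs]
end

/-- continuous functions of linear growth -/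
def G1 (f : ℂ → ℂ) : Prop := Continuous f ∧ ∃ K : ℝ, ∀ z, ‖f z‖ ^ 2 ≤ K * (1 + ‖z‖ ^ 2)

lemma G1.const (c : ℂ) : G1 (fun _ => c) :=
  ⟨continuous_const, ‖c‖ ^ 2, fun z => by nlinarith [sq_nonneg ‖c‖, mul_nonneg (sq_nonneg ‖c‖) (sq_nonneg ‖z‖)]⟩

lemma G1.id : G1 (fun z => z) :=
  ⟨continuous_id, 1, fun z => by linarith⟩

lemma G1.add {f g : ℂ → ℂ} (hf : G1 f) (hg : G1 g) : G1 (fun z => f z + g z) := by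
  obtain ⟨hf1, K, hK⟩ := hf
  obtain ⟨hg1, L, hL⟩ := hg
  refine ⟨hf1.add hg1, 2 * K + 2 * L, fun z => ?_⟩
  have h1 := norm_add_le (f z) (g z)
  have h2 : ‖f z + g z‖ ^ 2 ≤ (‖f z‖ + ‖g z‖) ^ 2 := by gcongr
  nlinarith [hK z, hL z, sq_nonneg (‖f z‖ - ‖g z‖)]

lemma G1.bmul {b f : ℂ → ℂ} {B : ℝ} (hb : Continuous b) (hB : ∀ z, ‖b z‖ ≤ B) (hf : G1 f) :
    G1 (fun z => b z * f z) := by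
  obtain ⟨hf1, K, hK⟩ := hf
  refine ⟨hb.mul hf1, B ^ 2 * K, fun z => ?_⟩
  rw [norm_mul, mul_pow, mul_assoc]
  have : ‖b z‖ ^ 2 ≤ B ^ 2 := by have := hB z; gcongr
  exact mul_le_mul this (hK z) (by positivity) (by positivity)

lemma G1.cmul {f : ℂ → ℂ} (c : ℂ) (hf : G1 f) : G1 (fun z => c * f z) :=
  G1.bmul continuous_const (B := ‖c‖) (fun _ => le_rfl) hf

lemma G1.sub {f g : ℂ → ℂ} (hf : G1 f) (hg : G1 g) : G1 (fun z => f z - g z) := by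
  have := hf.add (hg.cmul (-1))
  refine (iff_of_eq ?_).mp this
  congr 1; ext z; ring

lemma G1.conj {f : ℂ → ℂ} (hf : G1 f) : G1 (fun z => (starRingEnd ℂ) (f z)) := by
  obtain ⟨hf1, K, hK⟩ := hf
  refine ⟨Complex.continuous_conj.comp hf1, K, fun z => ?_⟩
  rw [RCLike.norm_conj]; exact hK z

section
variable {E : ℂ → ℝ} {C0 : ℝ}

lemma G1.int (hE : Continuous E) (hE0 : ∀ z, 0 < E z) (hE1 : ∀ z, E z ≤ C0 * jw z)
    {f g : ℂ → ℂ} (hf : G1 f) (hg : G1 g) :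
    Integrable (fun z => f z * g z * (E z : ℂ)) := by
  obtain ⟨hf1, K, hK⟩ := hf
  obtain ⟨hg1, L, hL⟩ := hg
  have hi := integrable_jw_of_le (f := fun z => (‖f z‖ ^ 2 + ‖g z‖ ^ 2)) (by fun_prop) (C := K + L)
    (fun z => by
      rw [abs_of_nonneg (by positivity)]; nlinarith [hK z, hL z])
  refine (hi.const_mul C0).mono' (by fun_prop) (Filter.Eventually.of_forall fun z => ?_)
  rw [norm_mul, norm_mul, Complex.norm_real, Real.norm_of_nonneg (hE0 z).le]
  have h1 : ‖f z‖ * ‖g z‖ ≤ ‖f z‖ ^ 2 + ‖g z‖ ^ 2 := by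
    nlinarith [sq_nonneg (‖f z‖ - ‖g z‖), sq_nonneg ‖f z‖, sq_nonneg ‖g z‖]
  calc _ ≤ (‖f z‖ ^ 2 + ‖g z‖ ^ 2) * (C0 * jw z) :=
        mul_le_mul h1 (hE1 z) (hE0 z).le (by positivity)
    _ = _ := by ring

lemma G1.int1 (hE : Continuous E) (hE0 : ∀ z, 0 < E z) (hE1 : ∀ z, E z ≤ C0 * jw z)
    {f : ℂ → ℂ} (hf : G1 f) : Integrable (fun z => f z * (E z : ℂ)) := by
  simpa using G1.int hE hE0 hE1 hf (G1.const 1)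

lemma G1.intsq (hE : Continuous E) (hE0 : ∀ z, 0 < E z) (hE1 : ∀ z, E z ≤ C0 * jw z)
    {f : ℂ → ℂ} (hf : G1 f) : Integrable (fun z => ‖f z‖ ^ 2 * E z) := by
  have := (G1.int hE hE0 hE1 hf hf.conj).re
  refine this.congr (Filter.Eventually.of_forall fun z => ?_)
  simp only [Complex.mul_conj, Complex.normSq_eq_norm_sq]
  rw [← Complex.ofReal_mul]; exact Complex.ofReal_re _

lemma ofReal_intsq (E : ℂ → ℝ) (f : ℂ → ℂ) :
    ((∫ z, ‖f z‖ ^ 2 * E z : ℝ) : ℂ) = ∫ z, f z * (starRingEnd ℂ) (f z) * (E z : ℂ) := by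
  rw [← integral_complex_ofReal]
  congr 1; ext z
  rw [Complex.mul_conj, Complex.normSq_eq_norm_sq]; push_cast; ring

lemma integral_sub3 {f g h : ℂ → ℂ} (hf : Integrable f) (hg : Integrable g) (hh : Integrable h) :
    ∫ z, (f z - g z - h z) = (∫ z, f z) - (∫ z, g z) - ∫ z, h z := by
  have h1 : Integrable (fun z => f z - g z) := hf.sub hg
  rw [integral_sub h1 hh, integral_sub hf hg]

/-- orthogonality and Pythagoras for the projection to affine functions -/
lemma proj_aff (hE : Continuous E) (hE0 : ∀ z, 0 < E z) (hE1 : ∀ z, E z ≤ C0 * jw z)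
    {u : ℂ → ℂ} (hu : G1 u) {c : ℂ} (hc : ∫ z, (z - c) * (E z : ℂ) = 0) {A C : ℝ} (hA : A = ∫ z, E z)
    (hC : C = ∫ z, ‖z - c‖ ^ 2 * E z) (hA0 : 0 < A) (hC0 : 0 < C) (al be : ℂ)
    (hal : al = (∫ z, u z * (E z : ℂ)) / A)
    (hbe : be = (∫ z, u z * (starRingEnd ℂ) (z - c) * (E z : ℂ)) / C) :
    (∫ z, (u z - al - be * (z - c)) * (E z : ℂ) = 0) ∧
    (∫ z, (starRingEnd ℂ) z * (u z - al - be * (z - c)) * (E z : ℂ) = 0) ∧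
    (∫ z, ‖u z‖ ^ 2 * E z) = (∫ z, ‖u z - al - be * (z - c)‖ ^ 2 * E z) +
      ‖∫ z, u z * (E z : ℂ)‖ ^ 2 / A + ‖∫ z, u z * (starRingEnd ℂ) (z - c) * (E z : ℂ)‖ ^ 2 / C := by
  have hzc : G1 (fun z => z - c) := G1.id.sub (G1.const c)
  set I0 := ∫ z, u z * (E z : ℂ) with hI0
  set I1 := ∫ z, u z * (starRingEnd ℂ) (z - c) * (E z : ℂ) with hI1
  have hA' : (∫ z, (E z : ℂ)) = A := by rw [hA]; exact integral_complex_ofReal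
  have hC' : (∫ z, (z - c) * (starRingEnd ℂ) (z - c) * (E z : ℂ)) = C := by
    rw [hC]; exact (ofReal_intsq E _).symm
  have hAc : (A : ℂ) ≠ 0 := by exact_mod_cast hA0.ne'
  have hCc : (C : ℂ) ≠ 0 := by exact_mod_cast hC0.ne'
  have i0 := G1.int1 hE hE0 hE1 hu
  have i1 := G1.int hE hE0 hE1 hu hzc.conj
  have i2 : Integrable (fun z => (E z : ℂ)) := by simpa using G1.int1 hE hE0 hE1 (G1.const 1)
  have i3 := G1.int1 hE hE0 hE1 hzc
  have i3' := G1.int1 hE hE0 hE1 hzc.conj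
  have i4 := G1.int hE hE0 hE1 hzc hzc.conj
  have hcb : ∫ z, (starRingEnd ℂ) (z - c) * (E z : ℂ) = 0 := by
    have := congrArg (starRingEnd ℂ) hc
    rw [← integral_conj, map_zero] at this
    rw [← this]; congr 1; ext z; simp
  have hh : G1 (fun z => u z - al - be * (z - c)) := (hu.sub (G1.const al)).sub (hzc.cmul be)
  have o0 : ∫ z, (u z - al - be * (z - c)) * (E z : ℂ) = 0 := by
    have : (fun z => (u z - al - be * (z - c)) * (E z : ℂ)) =
        fun z => (u z * (E z : ℂ) - al * (E z : ℂ)) - be * ((z - c) * (E z : ℂ)) := by ext z; ring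
    rw [this, integral_sub3 i0 (i2.const_mul al) (i3.const_mul be),
      integral_const_mul, integral_const_mul, hc, hA', hal, ← hI0]
    field_simp; ring
  have o1' : ∫ z, (u z - al - be * (z - c)) * (starRingEnd ℂ) (z - c) * (E z : ℂ) = 0 := by
    have : (fun z => (u z - al - be * (z - c)) * (starRingEnd ℂ) (z - c) * (E z : ℂ)) =
        fun z => (u z * (starRingEnd ℂ) (z - c) * (E z : ℂ) - al * ((starRingEnd ℂ) (z - c) * (E z : ℂ))) -
          be * ((z - c) * (starRingEnd ℂ) (z - c) * (E z : ℂ)) := by ext z; ring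
    rw [this, integral_sub3 i1 (i3'.const_mul al) (i4.const_mul be),
      integral_const_mul, integral_const_mul, hcb, hC', hbe, ← hI1]
    field_simp; ring
  refine ⟨o0, ?_, ?_⟩
  · have : (fun z => (starRingEnd ℂ) z * (u z - al - be * (z - c)) * (E z : ℂ)) =
        fun z => (u z - al - be * (z - c)) * (starRingEnd ℂ) (z - c) * (E z : ℂ) +
          (starRingEnd ℂ) c * ((u z - al - be * (z - c)) * (E z : ℂ)) := by
      ext z; rw [map_sub]; ring
    rw [this, integral_add (G1.int hE hE0 hE1 hh hzc.conj) ((G1.int1 hE hE0 hE1 hh).const_mul _),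
      integral_const_mul, o0, o1']
    simp
  · apply Complex.ofReal_injective
    rw [Complex.ofReal_add, Complex.ofReal_add, ofReal_intsq, ofReal_intsq]
    have e1 : ∫ z, (u z - al - be * (z - c)) * (starRingEnd ℂ) (u z - al - be * (z - c)) * (E z : ℂ) =
        ∫ z, (u z - al - be * (z - c)) * (starRingEnd ℂ) (u z) * (E z : ℂ) := by
      have : (fun z => (u z - al - be * (z - c)) * (starRingEnd ℂ) (u z - al - be * (z - c)) * (E z : ℂ)) =
        fun z => ((u z - al - be * (z - c)) * (starRingEnd ℂ) (u z) * (E z : ℂ) -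
          (starRingEnd ℂ) al * ((u z - al - be * (z - c)) * (E z : ℂ))) -
          (starRingEnd ℂ) be * ((u z - al - be * (z - c)) * (starRingEnd ℂ) (z - c) * (E z : ℂ)) := by
        ext z; simp only [map_sub, map_mul]; ring
      have j1 := G1.int hE hE0 hE1 hh hu.conj
      have j2 := (G1.int1 hE hE0 hE1 hh).const_mul ((starRingEnd ℂ) al)
      have j3 := (G1.int hE hE0 hE1 hh hzc.conj).const_mul ((starRingEnd ℂ) be)
      rw [this, integral_sub3 j1 j2 j3, integral_const_mul,
        integral_const_mul, o0, o1']
      simp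
    have k0 : ∫ z, (starRingEnd ℂ) (u z) * (E z : ℂ) = (starRingEnd ℂ) I0 := by
      rw [hI0, ← integral_conj]; congr 1; ext z; simp
    have k1 : ∫ z, (z - c) * (starRingEnd ℂ) (u z) * (E z : ℂ) = (starRingEnd ℂ) I1 := by
      rw [hI1, ← integral_conj]; congr 1; ext z
      simp only [map_mul, map_sub, Complex.conj_conj, Complex.conj_ofReal]; ring
    have e2 : ∫ z, (u z - al - be * (z - c)) * (starRingEnd ℂ) (u z) * (E z : ℂ) =
        (∫ z, u z * (starRingEnd ℂ) (u z) * (E z : ℂ)) - al * (starRingEnd ℂ) I0 - be * (starRingEnd ℂ) I1 := by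
      have : (fun z => (u z - al - be * (z - c)) * (starRingEnd ℂ) (u z) * (E z : ℂ)) =
        fun z => (u z * (starRingEnd ℂ) (u z) * (E z : ℂ) - al * ((starRingEnd ℂ) (u z) * (E z : ℂ))) -
          be * ((z - c) * (starRingEnd ℂ) (u z) * (E z : ℂ)) := by ext z; ring
      have j1 := G1.int hE hE0 hE1 hu hu.conj
      have j2 := (G1.int1 hE hE0 hE1 hu.conj).const_mul al
      have j3 := (G1.int hE hE0 hE1 hzc hu.conj).const_mul be
      rw [this, integral_sub3 j1 j2 j3, integral_const_mul,
        integral_const_mul, k0, k1]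
    rw [e1, e2, hal, hbe]
    have n0 : ((‖I0‖ ^ 2 / A : ℝ) : ℂ) = I0 * (starRingEnd ℂ) I0 / A := by
      rw [Complex.mul_conj, Complex.normSq_eq_norm_sq]; push_cast; ring
    have n1 : ((‖I1‖ ^ 2 / C : ℝ) : ℂ) = I1 * (starRingEnd ℂ) I1 / C := by
      rw [Complex.mul_conj, Complex.normSq_eq_norm_sq]; push_cast; ring
    rw [n0, n1]; ring
end

section
variable {ι : Type*} [Fintype ι] (p : ι → Polynomial ℂ) (om lam : ι → ℝ) (q : ℝ)

noncomputable def aF (z : ℂ) : ℝ := q * (pS p (fun i => lam i * om i) z / pS p om z)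

noncomputable def vF (z : ℂ) : ℝ :=
  q * (pS p (fun i => lam i ^ 2 * om i) z / pS p om z - (pS p (fun i => lam i * om i) z / pS p om z) ^ 2)

noncomputable def eF (z : ℂ) : ℝ := (pS p om z) ^ (-q)

variable {p om lam q}

lemma continuous_aF (hS : ∀ z, 0 < pS p om z) : Continuous (aF p om lam q) := by
  unfold aF
  exact continuous_const.mul ((continuous_pS _ _).div (continuous_pS _ _) fun z => (hS z).ne')

lemma continuous_vF (hS : ∀ z, 0 < pS p om z) : Continuous (vF p om lam q) := by
  unfold vF
  exact continuous_const.mul (((continuous_pS _ _).div (continuous_pS _ _) fun z => (hS z).ne').sub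
    (((continuous_pS _ _).div (continuous_pS _ _) fun z => (hS z).ne').pow 2))

lemma continuous_eF (hS : ∀ z, 0 < pS p om z) : Continuous (eF p om q) := by
  unfold eF
  exact (continuous_pS p om).rpow_const fun z => Or.inl (hS z).ne'

lemma eF_pos (hS : ∀ z, 0 < pS p om z) (z : ℂ) : 0 < eF p om q z := Real.rpow_pos_of_pos (hS z) _

lemma abs_aF_le (hom : ∀ i, 0 < om i) (hS : ∀ z, 0 < pS p om z) (hq : 0 < q) {Λ : ℝ}
    (hΛ : ∀ i, |lam i| ≤ Λ) (z : ℂ) : |aF p om lam q z| ≤ q * Λ := by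
  unfold aF
  rw [abs_mul, abs_of_pos hq, abs_div, abs_of_pos (hS z)]
  gcongr
  rw [div_le_iff₀ (hS z)]
  unfold pS
  refine (Finset.abs_sum_le_sum_abs _ _).trans ?_
  rw [Finset.mul_sum]
  refine Finset.sum_le_sum fun i _ => ?_
  rw [abs_mul, abs_mul, abs_of_pos (hom i), abs_of_nonneg (sq_nonneg ‖_‖), mul_assoc]
  exact mul_le_mul_of_nonneg_right (hΛ i) (by have := hom i; positivity)

lemma vF_nonneg (hom : ∀ i, 0 < om i) (hS : ∀ z, 0 < pS p om z) (hq : 0 < q) (z : ℂ) :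
    0 ≤ vF p om lam q z := by
  unfold vF
  have h : pS p (fun i => lam i * om i) z ^ 2 ≤ pS p (fun i => lam i ^ 2 * om i) z * pS p om z := by
    unfold pS
    apply Finset.sum_sq_le_sum_mul_sum_of_sq_eq_mul
    · intro i _; have := hom i; positivity
    · intro i _; have := hom i; positivity
    · intro i _; ring
  apply mul_nonneg hq.le
  rw [div_pow, sub_nonneg, div_le_div_iff₀ (pow_pos (hS z) 2) (hS z)]
  nlinarith [hS z]

lemma vF_le (hom : ∀ i, 0 < om i) (hS : ∀ z, 0 < pS p om z) (hq : 0 < q) {Λ : ℝ}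
    (hΛ : ∀ i, |lam i| ≤ Λ) (z : ℂ) : vF p om lam q z ≤ q * Λ ^ 2 := by
  unfold vF
  have h : pS p (fun i => lam i ^ 2 * om i) z / pS p om z ≤ Λ ^ 2 := by
    rw [div_le_iff₀ (hS z)]
    unfold pS
    rw [Finset.mul_sum]
    refine Finset.sum_le_sum fun i _ => ?_
    rw [mul_assoc]
    refine mul_le_mul_of_nonneg_right ?_ (by have := hom i; positivity)
    rw [← sq_abs]; have := hΛ i; gcongr
  apply mul_le_mul_of_nonneg_left _ hq.le
  nlinarith [sq_nonneg (pS p (fun i => lam i * om i) z / pS p om z)]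

theorem horm_ineq (hom : ∀ i, 0 < om i) (hS : ∀ z, 0 < pS p om z) (hq : 0 < q) {c0 C0 : ℝ}
    (hc0 : 0 < c0) (hlow : ∀ z, c0 * jw z ≤ eF p om q z) (hup : ∀ z, eF p om q z ≤ C0 * jw z)
    {c : ℂ} (hc : ∫ z, (z - c) * (eF p om q z : ℂ) = 0) {A C : ℝ} (hA : A = ∫ z, eF p om q z)
    (hC : C = ∫ z, ‖z - c‖ ^ 2 * eF p om q z) (hA0 : 0 < A) (hC0 : 0 < C) (e0 e1 : ℂ) :
    (∫ z, (aF p om lam q z ^ 2 - vF p om lam q z) * ‖e0 + e1 * z‖ ^ 2 * eF p om q z) ≤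
      ‖∫ z, (aF p om lam q z * (e0 + e1 * z)) * (eF p om q z : ℂ)‖ ^ 2 / A +
      ‖∫ z, (aF p om lam q z * (e0 + e1 * z)) * (starRingEnd ℂ) (z - c) * (eF p om q z : ℂ)‖ ^ 2 / C := by
  set S := pS p om with hSdef
  set E := eF p om q with hEdef
  set a := aF p om lam q with ha
  set V := vF p om lam q with hV
  obtain ⟨Λ, hΛ⟩ : ∃ Λ, ∀ i, |lam i| ≤ Λ := by
    obtain ⟨Λ, h⟩ := (Set.finite_range fun i => |lam i|).bddAbove
    exact ⟨Λ, fun i => h ⟨i, rfl⟩⟩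
  have hE : Continuous E := continuous_eF hS
  have hE0 : ∀ z, 0 < E z := eF_pos hS
  have hac : Continuous a := continuous_aF hS
  have hVc : Continuous V := continuous_vF hS
  have haB : ∀ z, ‖(a z : ℂ)‖ ≤ q * Λ := fun z => by
    rw [Complex.norm_real]; exact abs_aF_le hom hS hq hΛ z
  have hV0 : ∀ z, 0 ≤ V z := vF_nonneg hom hS hq
  have hVB : ∀ z, V z ≤ q * Λ ^ 2 := vF_le hom hS hq hΛ
  have hSne : ∀ z, (S z : ℂ) ≠ 0 := fun z => by exact_mod_cast (hS z).ne'
  have he : G1 (fun z => e0 + e1 * z) := (G1.const e0).add (G1.id.cmul e1)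
  have hu : G1 (fun z => (a z : ℂ) * (e0 + e1 * z)) :=
    G1.bmul (Complex.continuous_ofReal.comp hac) haB he
  obtain ⟨o0, o1, py⟩ := proj_aff hE hE0 hup hu hc hA hC hA0 hC0 _ _ rfl rfl
  set al := (∫ z, (a z : ℂ) * (e0 + e1 * z) * (E z : ℂ)) / A with hal
  set be := (∫ z, (a z : ℂ) * (e0 + e1 * z) * (starRingEnd ℂ) (z - c) * (E z : ℂ)) / C with hbe
  set S1 := pS p (fun i => lam i * om i) with hS1
  set D := pI p (dp p) om with hD
  set D1 := pI p (dp p) (fun i => lam i * om i) with hD1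
  have hh : G1 (fun z => (a z : ℂ) * (e0 + e1 * z) - al - be * (z - c)) :=
    (hu.sub (G1.const al)).sub ((G1.id.sub (G1.const c)).cmul be)
  -- derivative of q / S
  have hinv : ∀ z, HasW (fun z => ((q * (S z)⁻¹ : ℝ) : ℂ)) (((-(q / S z ^ 2) : ℝ) : ℂ) * pI (dp p) p om z)
      (((-(q / S z ^ 2) : ℝ) : ℂ) * D z) z := fun z => by
    refine (pS_hasW p om z).real_comp (g := fun x => q * x⁻¹) ?_
    have := (hasDerivAt_inv (hS z).ne').const_mul q
    refine this.congr_deriv ?_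
    rw [hSdef]; field_simp
  have hPW : ∀ z, HasW (fun z => D z * ((q * (S z)⁻¹ : ℝ) : ℂ))
      (((q * (pS (dp p) om z * S z - ‖D z‖ ^ 2) / S z ^ 2 : ℝ)) : ℂ)
      (pI p (dp (dp p)) om z * ((q * (S z)⁻¹ : ℝ) : ℂ) + D z * (((-(q / S z ^ 2) : ℝ) : ℂ) * D z)) z := fun z => by
    refine ((pI_hasW p (dp p) om z).mul (hinv z)).congr ?_ ?_
    · rw [← pI_conj p (dp p), ← pS_eq]
      have h2 : ((‖D z‖ ^ 2 : ℝ) : ℂ) = D z * (starRingEnd ℂ) (D z) := by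
        rw [Complex.mul_conj, Complex.normSq_eq_norm_sq]
      have := hSne z
      rw [Complex.ofReal_div, Complex.ofReal_mul q (_ - _), Complex.ofReal_sub, h2]
      push_cast
      simp only [← hD]
      field_simp
      try ring
    · rfl
  have haW : ∀ z, HasW (fun z => (a z : ℂ))
      (pI (dp p) p (fun i => lam i * om i) z * ((q * (S z)⁻¹ : ℝ) : ℂ) +
        (S1 z : ℂ) * (((-(q / S z ^ 2) : ℝ) : ℂ) * pI (dp p) p om z))
      (D1 z * ((q * (S z)⁻¹ : ℝ) : ℂ) + (S1 z : ℂ) * (((-(q / S z ^ 2) : ℝ) : ℂ) * D z)) z := fun z => by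
    have h1 := (pS_hasW p (fun i => lam i * om i) z).mul (hinv z)
    have h2 : (fun z => (a z : ℂ)) = fun z => (pS p (fun i => lam i * om i) z : ℂ) * ((q * (S z)⁻¹ : ℝ) : ℂ) := by
      ext w; rw [← Complex.ofReal_mul]; congr 1
      simp only [ha, aF, hSdef]; ring
    rw [h2]; exact h1
  have hinvE : ∀ z, ((S z) ^ q)⁻¹ = E z := fun z => (Real.rpow_neg (hS z).le q).symm
  have hcS : Continuous S := continuous_pS p om
  have hcS1 : Continuous S1 := continuous_pS _ _
  have hcD : Continuous D := continuous_pI _ _ _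
  have hcD1 : Continuous D1 := continuous_pI _ _ _
  have hci : Continuous (fun z => ((q * (S z)⁻¹ : ℝ) : ℂ)) :=
    Complex.continuous_ofReal.comp (continuous_const.mul (hcS.inv₀ fun z => (hS z).ne'))
  have hci2 : Continuous (fun z => ((-(q / S z ^ 2) : ℝ) : ℂ)) :=
    Complex.continuous_ofReal.comp (continuous_const.div (hcS.pow 2) fun z => (pow_pos (hS z) 2).ne').neg
  have key := hormander (w := fun z => (S z) ^ q)
    (om := fun z => q * (pS (dp p) om z * S z - ‖D z‖ ^ 2) / S z ^ 2)
    (G := fun z => V z * ‖e0 + e1 * z‖ ^ 2)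
    (P := fun z => D z * ((q * (S z)⁻¹ : ℝ) : ℂ))
    (Q := fun z => pI p (dp (dp p)) om z * ((q * (S z)⁻¹ : ℝ) : ℂ) + D z * (((-(q / S z ^ 2) : ℝ) : ℂ) * D z))
    (h := fun z => (a z : ℂ) * (e0 + e1 * z) - al - be * (z - c))
    (h1 := fun z => (pI (dp p) p (fun i => lam i * om i) z * ((q * (S z)⁻¹ : ℝ) : ℂ) +
        (S1 z : ℂ) * (((-(q / S z ^ 2) : ℝ) : ℂ) * pI (dp p) p om z)) * (e0 + e1 * z) + (a z : ℂ) * e1 - be)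
    (h2 := fun z => (D1 z * ((q * (S z)⁻¹ : ℝ) : ℂ) + (S1 z : ℂ) * (((-(q / S z ^ 2) : ℝ) : ℂ) * D z)) *
        (e0 + e1 * z))
    (fun z => Real.rpow_pos_of_pos (hS z) q)
    (fun z => by
      have hd : HasDerivAt (fun x : ℝ => x ^ q) (q * (S z) ^ (q - 1)) (S z) :=
        Real.hasDerivAt_rpow_const (Or.inl (hS z).ne')
      refine ((pS_hasW p om z).real_comp hd).congr ?_ ?_
      · rw [map_mul, Complex.conj_ofReal, hD, pI_conj, Real.rpow_sub_one (hS z).ne']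
        push_cast; ring
      · rw [Real.rpow_sub_one (hS z).ne']
        push_cast; ring)
    hPW
    (((continuous_pI _ _ _).mul hci).add (hcD.mul (hci2.mul hcD)))
    ((continuous_const.mul (((continuous_pS _ _).mul hcS).sub (hcD.norm.pow 2))).div (hcS.pow 2)
      fun z => (pow_pos (hS z) 2).ne')
    (fun z => by
      have h1 : ‖D z‖ ≤ ∑ i, om i * (‖(p i).eval z‖ * ‖(dp p i).eval z‖) := by
        refine (norm_sum_le _ _).trans (le_of_eq (Finset.sum_congr rfl fun i _ => ?_))
        rw [norm_mul, norm_mul, RCLike.norm_conj, Complex.norm_real, Real.norm_of_nonneg (hom i).le]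
      have h2 : (∑ i, om i * (‖(p i).eval z‖ * ‖(dp p i).eval z‖)) ^ 2 ≤ pS (dp p) om z * S z := by
        rw [hSdef]; unfold pS
        apply Finset.sum_sq_le_sum_mul_sum_of_sq_eq_mul
        · intro i _; have := hom i; positivity
        · intro i _; have := hom i; positivity
        · intro i _; ring
      have h3 : ‖D z‖ ^ 2 ≤ pS (dp p) om z * S z := le_trans (by gcongr) h2
      exact div_nonneg (mul_nonneg hq.le (by linarith)) (sq_nonneg _))
    hc0 (fun z => by rw [hinvE]; exact hlow z) (fun z => by rw [hinvE]; exact hup z)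
    (fun z => by
      refine ((((haW z).mul ((HasW.const e0 z).add ((HasW.const e1 z).mul (HasW.id z)))).sub
        (HasW.const al z)).sub ((HasW.const be z).mul ((HasW.id z).sub (HasW.const c z)))).congr ?_ ?_
      · simp
      · simp)
    (((((continuous_pI _ _ _).mul hci).add ((Complex.continuous_ofReal.comp hcS1).mul
      (hci2.mul (continuous_pI _ _ _)))).mul (by fun_prop)).add ((Complex.continuous_ofReal.comp hac).mul
        continuous_const) |>.sub continuous_const)
    (((hcD1.mul hci).add ((Complex.continuous_ofReal.comp hcS1).mul
      (hci2.mul hcD))).mul (by fun_prop))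
    (by simp only [hinvE]; exact G1.intsq hE hE0 hup hh)
    (by simp only [hinvE]; exact o0)
    (by simp only [hinvE]; exact o1)
    (by fun_prop) (fun z => mul_nonneg (hV0 z) (sq_nonneg _))
    (fun z => by
      have hg := pS_gram p om lam hom z (hS z)
      rw [norm_mul, mul_pow]
      have e1' : D1 z * ((q * (S z)⁻¹ : ℝ) : ℂ) + (S1 z : ℂ) * (((-(q / S z ^ 2) : ℝ) : ℂ) * D z) =
          ((q / S z ^ 2 : ℝ) : ℂ) * (D1 z * (S z : ℂ) - (S1 z : ℂ) * D z) := by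
        have := hSne z
        push_cast; field_simp; try ring
      rw [e1', norm_mul, mul_pow, Complex.norm_real, Real.norm_eq_abs, sq_abs]
      have e2 : V z = q / S z ^ 2 * (pS p (fun i => lam i ^ 2 * om i) z * S z - S1 z ^ 2) := by
        have := (hS z).ne'
        simp only [hV, vF, ← hSdef, ← hS1]; field_simp
      rw [e2]
      have h5 : 0 ≤ (q / S z ^ 2) ^ 2 * ‖e0 + e1 * z‖ ^ 2 := by positivity
      have := mul_le_mul_of_nonneg_left hg h5
      refine le_trans (le_of_eq ?_) (this.trans (le_of_eq ?_)) <;> ring)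
    (by
      simp only [hinvE]
      refine ((G1.intsq hE hE0 hup he).const_mul (q * Λ ^ 2)).mono' (by fun_prop)
        (Filter.Eventually.of_forall fun z => ?_)
      rw [Real.norm_of_nonneg (by have := hV0 z; have := (hE0 z).le; positivity), mul_assoc]
      exact mul_le_mul_of_nonneg_right (hVB z) (by have := (hE0 z).le; positivity))
  simp only [hinvE] at key
  have i1 : Integrable (fun z => ‖(a z : ℂ) * (e0 + e1 * z)‖ ^ 2 * E z) := G1.intsq hE hE0 hup hu
  have i2 : Integrable (fun z => V z * ‖e0 + e1 * z‖ ^ 2 * E z) := by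
    refine ((G1.intsq hE hE0 hup he).const_mul (q * Λ ^ 2)).mono' (by fun_prop)
      (Filter.Eventually.of_forall fun z => ?_)
    rw [Real.norm_of_nonneg (by have := hV0 z; have := (hE0 z).le; positivity), mul_assoc]
    exact mul_le_mul_of_nonneg_right (hVB z) (by have := (hE0 z).le; positivity)
  have : (fun z => (a z ^ 2 - V z) * ‖e0 + e1 * z‖ ^ 2 * E z) =
      fun z => ‖(a z : ℂ) * (e0 + e1 * z)‖ ^ 2 * E z - V z * ‖e0 + e1 * z‖ ^ 2 * E z := by
    ext z
    rw [norm_mul, mul_pow, Complex.norm_real, Real.norm_eq_abs, sq_abs]; ring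
  rw [this, integral_sub i1 i2, py]
  linarith
end

lemma logconcave_step {d d1 d2 : ℝ → ℝ} (h1 : ∀ t, HasDerivAt d (d1 t) t)
    (h2 : ∀ t, HasDerivAt d1 (d2 t) t) (hd : ∀ t, 0 < d t) (h : ∀ t, d t * d2 t ≤ d1 t ^ 2) :
    Real.log (d 1) ≤ Real.log (d 0) + d1 0 / d 0 := by
  have hg : ∀ t, HasDerivAt (fun t => Real.log (d t)) (d1 t / d t) t := fun t => (h1 t).log (hd t).ne'
  have hg2 : ∀ t, HasDerivAt (fun t => d1 t / d t) ((d2 t * d t - d1 t * d1 t) / d t ^ 2) t := fun t =>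
    (h2 t).div (h1 t) (hd t).ne'
  have hanti : Antitone (fun t => d1 t / d t) := by
    apply antitone_of_deriv_nonpos (fun t => (hg2 t).differentiableAt)
    intro t
    rw [(hg2 t).deriv]
    exact div_nonpos_of_nonpos_of_nonneg (by nlinarith [h t]) (sq_nonneg _)
  obtain ⟨ξ, hξ, he⟩ := exists_hasDerivAt_eq_slope (fun t => Real.log (d t)) (fun t => d1 t / d t)
    zero_lt_one (fun t _ => (hg t).continuousAt.continuousWithinAt) (fun t _ => hg t)
  have := hanti hξ.1.le
  simp only at this
  rw [he] at this
  simp at this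
  linarith

lemma det_alg {A A1 A2 B B1 B2 X1 X2 Y1 Y2 x y : ℝ} (hA : 0 < A)
    (hC : 0 < B - (x ^ 2 + y ^ 2) * A)
    (h1 : A2 ≤ A1 ^ 2 / A + ((X1 - x * A1) ^ 2 + (Y1 - y * A1) ^ 2) / (B - (x ^ 2 + y ^ 2) * A))
    (h2 : B2 - 2 * (x * X2 + y * Y2) + (x ^ 2 + y ^ 2) * A2 ≤
      ((X1 - x * A1) ^ 2 + (Y1 - y * A1) ^ 2) / A +
      (B1 - 2 * (x * X1 + y * Y1) + (x ^ 2 + y ^ 2) * A1) ^ 2 / (B - (x ^ 2 + y ^ 2) * A)) :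
    (A * B - (x * A) ^ 2 - (y * A) ^ 2) * (A2 * B + 2 * A1 * B1 + A * B2 -
      2 * (X1 ^ 2 + (x * A) * X2) - 2 * (Y1 ^ 2 + (y * A) * Y2)) ≤
      (A1 * B + A * B1 - 2 * (x * A) * X1 - 2 * (y * A) * Y1) ^ 2 := by
  obtain ⟨C, hCe⟩ : ∃ C, C = B - (x ^ 2 + y ^ 2) * A := ⟨_, rfl⟩
  obtain ⟨C1, hC1⟩ : ∃ C1, C1 = B1 - 2 * (x * X1 + y * Y1) + (x ^ 2 + y ^ 2) * A1 := ⟨_, rfl⟩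
  obtain ⟨C2, hC2⟩ : ∃ C2, C2 = B2 - 2 * (x * X2 + y * Y2) + (x ^ 2 + y ^ 2) * A2 := ⟨_, rfl⟩
  obtain ⟨U, hU⟩ : ∃ U, U = X1 - x * A1 := ⟨_, rfl⟩
  obtain ⟨W, hW⟩ : ∃ W, W = Y1 - y * A1 := ⟨_, rfl⟩
  rw [← hCe] at hC h1 h2
  rw [← hU, ← hW] at h1 h2
  rw [← hC1, ← hC2] at h2
  have hB : B = C + (x ^ 2 + y ^ 2) * A := by linarith
  have hX1 : X1 = U + x * A1 := by linarith
  have hY1 : Y1 = W + y * A1 := by linarith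
  have hB1 : B1 = C1 + 2 * (x * X1 + y * Y1) - (x ^ 2 + y ^ 2) * A1 := by linarith
  have hB2 : B2 = C2 + 2 * (x * X2 + y * Y2) - (x ^ 2 + y ^ 2) * A2 := by linarith
  have e1 : A2 * (A * C) ≤ A1 ^ 2 * C + (U ^ 2 + W ^ 2) * A := by
    have := mul_le_mul_of_nonneg_right h1 (mul_pos hA hC).le
    refine this.trans (le_of_eq ?_); field_simp
  have e2 : C2 * (A * C) ≤ (U ^ 2 + W ^ 2) * C + C1 ^ 2 * A := by
    have := mul_le_mul_of_nonneg_right h2 (mul_pos hA hC).le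
    refine this.trans (le_of_eq ?_); field_simp
  rw [hB2, hB1, hX1, hY1, hB]
  have e3 := mul_le_mul_of_nonneg_left e1 hC.le
  have e4 := mul_le_mul_of_nonneg_left e2 hA.le
  nlinarith [e3, e4]

section
variable {ι : Type*} [Fintype ι] (p : ι → Polynomial ℂ) (lam : ι → ℝ) (q : ℝ)

/-- exponential weights -/
noncomputable def omt (t : ℝ) : ι → ℝ := fun i => Real.exp (t * lam i)

variable {p lam q}

lemma omt_pos (t : ℝ) (i : ι) : 0 < omt lam t i := Real.exp_pos _

lemma omt_zero : omt lam 0 = fun _ => 1 := by ext i; simp [omt]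

lemma pS_omt_bounds {Λ : ℝ} (hΛ : ∀ i, |lam i| ≤ Λ) (t : ℝ) (z : ℂ) :
    Real.exp (-(|t| * Λ)) * pS p (fun _ => 1) z ≤ pS p (omt lam t) z ∧
    pS p (omt lam t) z ≤ Real.exp (|t| * Λ) * pS p (fun _ => 1) z := by
  have hb : ∀ i, |t * lam i| ≤ |t| * Λ := fun i => by
    rw [abs_mul]; have := hΛ i; gcongr
  unfold pS
  rw [Finset.mul_sum, Finset.mul_sum]
  constructor
  · refine Finset.sum_le_sum fun i _ => ?_
    rw [one_mul]
    refine mul_le_mul_of_nonneg_right (Real.exp_le_exp.2 ?_) (by positivity)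
    linarith [neg_abs_le (t * lam i), hb i]
  · refine Finset.sum_le_sum fun i _ => ?_
    rw [one_mul]
    refine mul_le_mul_of_nonneg_right (Real.exp_le_exp.2 ?_) (by positivity)
    linarith [le_abs_self (t * lam i), hb i]

lemma pS_omt_pos (hS : ∀ z, 0 < pS p (fun _ => 1) z) (t : ℝ) (z : ℂ) : 0 < pS p (omt lam t) z := by
  obtain ⟨Λ, h⟩ := (Set.finite_range fun i => |lam i|).bddAbove
  exact lt_of_lt_of_le (mul_pos (Real.exp_pos _) (hS z))
    (pS_omt_bounds (fun i => h ⟨i, rfl⟩ : ∀ i, |lam i| ≤ Λ) t z).1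

lemma eF_bounds (hS : ∀ z, 0 < pS p (fun _ => 1) z) (hq : 0 < q)
    (hjw : ∀ z, eF p (fun _ => 1) q z = jw z) {Λ : ℝ} (hΛ : ∀ i, |lam i| ≤ Λ) (t : ℝ) (z : ℂ) :
    Real.exp (-(|t| * Λ * q)) * jw z ≤ eF p (omt lam t) q z ∧
    eF p (omt lam t) q z ≤ Real.exp (|t| * Λ * q) * jw z := by
  obtain ⟨h1, h2⟩ := pS_omt_bounds (p := p) hΛ t z
  rw [← hjw z]
  unfold eF
  have e : ∀ s : ℝ, Real.exp s ^ (-q) = Real.exp (-(s * q)) := fun s => by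
    rw [← Real.exp_mul]; ring_nf
  have hS' := pS_omt_pos (lam := lam) hS t z
  constructor
  · have := Real.rpow_le_rpow_of_nonpos hS' h2 (neg_nonpos.2 hq.le)
    rwa [Real.mul_rpow (Real.exp_pos _).le (hS z).le, e] at this
  · have := Real.rpow_le_rpow_of_nonpos (mul_pos (Real.exp_pos _) (hS z)) h1 (neg_nonpos.2 hq.le)
    rwa [Real.mul_rpow (Real.exp_pos _).le (hS z).le, e, neg_mul, neg_neg] at this

lemma pS_omt_deriv (c : ι → ℝ) (t : ℝ) (z : ℂ) :
    HasDerivAt (fun t => pS p (fun i => c i * omt lam t i) z)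
      (pS p (fun i => c i * lam i * omt lam t i) z) t := by
  unfold pS
  refine HasDerivAt.fun_sum fun i _ => ?_
  unfold omt
  have h : HasDerivAt (fun t => Real.exp (t * lam i)) (Real.exp (t * lam i) * lam i) t := by
    have := ((hasDerivAt_id t).mul_const (lam i)).exp
    simpa using this
  refine ((h.const_mul (c i)).mul_const _).congr_deriv ?_
  ring

lemma eF_deriv (hS : ∀ z, 0 < pS p (fun _ => 1) z) (t : ℝ) (z : ℂ) :
    HasDerivAt (fun t => eF p (omt lam t) q z)
      (-(aF p (omt lam t) lam q z) * eF p (omt lam t) q z) t := by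
  have h0 := pS_omt_deriv (p := p) (lam := lam) (fun _ => 1) t z
  simp only [one_mul] at h0
  have hS' := pS_omt_pos (lam := lam) hS t z
  have := h0.rpow_const (p := -q) (Or.inl hS'.ne')
  refine this.congr_deriv ?_
  unfold aF eF
  rw [Real.rpow_sub_one hS'.ne']; ring

lemma aF_deriv (hS : ∀ z, 0 < pS p (fun _ => 1) z) (t : ℝ) (z : ℂ) :
    HasDerivAt (fun t => aF p (omt lam t) lam q z) (vF p (omt lam t) lam q z) t := by
  have h0 := pS_omt_deriv (p := p) (lam := lam) (fun _ => 1) t z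
  simp only [one_mul] at h0
  have h1 := pS_omt_deriv (p := p) (lam := lam) lam t z
  have hS' := pS_omt_pos (lam := lam) hS t z
  refine ((h1.div h0 hS'.ne').const_mul q).congr_deriv ?_
  unfold vF
  simp only [pow_two]
  field_simp

lemma eF_deriv2 (hS : ∀ z, 0 < pS p (fun _ => 1) z) (t : ℝ) (z : ℂ) :
    HasDerivAt (fun t => -(aF p (omt lam t) lam q z) * eF p (omt lam t) q z)
      ((aF p (omt lam t) lam q z ^ 2 - vF p (omt lam t) lam q z) * eF p (omt lam t) q z) t := by
  refine ((aF_deriv hS t z).neg.mul (eF_deriv hS t z)).congr_deriv ?_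
  simp; ring

/-- differentiation under the integral -/
lemma deriv_int (hS : ∀ z, 0 < pS p (fun _ => 1) z) (hq : 0 < q)
    (hjw : ∀ z, eF p (fun _ => 1) q z = jw z) {f : ℂ → ℝ} (hf : Continuous f) {K : ℝ}
    (hK : ∀ z, |f z| ≤ K * (1 + ‖z‖ ^ 2)) (t : ℝ) :
    Integrable (fun z => f z * eF p (omt lam t) q z) ∧
    Integrable (fun z => f z * (aF p (omt lam t) lam q z * eF p (omt lam t) q z)) ∧
    Integrable (fun z => f z * ((aF p (omt lam t) lam q z ^ 2 - vF p (omt lam t) lam q z) *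
      eF p (omt lam t) q z)) ∧
    HasDerivAt (fun t => ∫ z, f z * eF p (omt lam t) q z)
      (-∫ z, f z * (aF p (omt lam t) lam q z * eF p (omt lam t) q z)) t ∧
    HasDerivAt (fun t => -∫ z, f z * (aF p (omt lam t) lam q z * eF p (omt lam t) q z))
      (∫ z, f z * ((aF p (omt lam t) lam q z ^ 2 - vF p (omt lam t) lam q z) * eF p (omt lam t) q z)) t := by
  obtain ⟨Λ, hΛ⟩ : ∃ Λ, ∀ i, |lam i| ≤ Λ := by
    obtain ⟨Λ, h⟩ := (Set.finite_range fun i => |lam i|).bddAbove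
    exact ⟨Λ, fun i => h ⟨i, rfl⟩⟩
  have hΛ0 : ∀ i, |lam i| ≤ |Λ| := fun i => (hΛ i).trans (le_abs_self _)
  have hpos := fun t => pS_omt_pos (lam := lam) hS t
  have cE : ∀ s, Continuous (eF p (omt lam s) q) := fun s => continuous_eF (hpos s)
  have ca : ∀ s, Continuous (aF p (omt lam s) lam q) := fun s => continuous_aF (hpos s)
  have cv : ∀ s, Continuous (vF p (omt lam s) lam q) := fun s => continuous_vF (hpos s)
  have hi := integrable_jw_of_le (f := fun z => |f z|) hf.abs (C := K) (by simpa using hK)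
  have hE : ∀ s ∈ Metric.ball t 1, ∀ z, |eF p (omt lam s) q z| ≤ Real.exp ((|t| + 1) * |Λ| * q) * jw z := by
    intro s hs z
    rw [abs_of_pos (eF_pos (hpos s) z)]
    refine (eF_bounds hS hq hjw hΛ0 s z).2.trans ?_
    have h1 : |s| ≤ |t| + 1 := by
      rw [Metric.mem_ball, Real.dist_eq] at hs
      have := abs_sub_abs_le_abs_sub s t; linarith
    have := (jw_pos z).le
    gcongr
  have ha : ∀ s z, |aF p (omt lam s) lam q z| ≤ q * |Λ| := fun s z =>
    abs_aF_le (omt_pos s) (hpos s) hq hΛ0 z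
  have hv : ∀ s z, |vF p (omt lam s) lam q z| ≤ q * |Λ| ^ 2 := fun s z => by
    rw [abs_of_nonneg (vF_nonneg (omt_pos s) (hpos s) hq z)]
    exact vF_le (omt_pos s) (hpos s) hq hΛ0 z
  have gen : ∀ (b : ℂ → ℝ) (B : ℝ), (∀ z, |b z| ≤ B) → ∀ s ∈ Metric.ball t 1, ∀ z,
      ‖f z * (b z * eF p (omt lam s) q z)‖ ≤ (B * Real.exp ((|t| + 1) * |Λ| * q)) * (|f z| * jw z) := by
    intro b B hb s hs z
    rw [Real.norm_eq_abs, abs_mul, abs_mul]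
    have h1 := hE s hs z
    have h2 := hb z
    calc |f z| * (|b z| * |eF p (omt lam s) q z|) ≤
        |f z| * (B * (Real.exp ((|t| + 1) * |Λ| * q) * jw z)) := by
          refine mul_le_mul_of_nonneg_left (mul_le_mul h2 h1 (abs_nonneg _) ((abs_nonneg _).trans h2))
            (abs_nonneg _)
      _ = _ := by ring
  have ht : t ∈ Metric.ball t 1 := Metric.mem_ball_self one_pos
  have i0 : Integrable (fun z => f z * eF p (omt lam t) q z) := by
    refine (hi.const_mul (1 * Real.exp ((|t| + 1) * |Λ| * q))).mono' (by fun_prop)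
      (Filter.Eventually.of_forall fun z => ?_)
    have := gen (fun _ => 1) 1 (by simp) t ht z
    simpa using this
  have D1 := hasDerivAt_integral_of_dominated_loc_of_deriv_le (μ := volume)
    (F := fun t z => f z * eF p (omt lam t) q z)
    (F' := fun t z => f z * (-(aF p (omt lam t) lam q z) * eF p (omt lam t) q z))
    (bound := fun z => ((q * |Λ|) * Real.exp ((|t| + 1) * |Λ| * q)) * (|f z| * jw z))
    (Metric.ball_mem_nhds t one_pos)
    (Filter.Eventually.of_forall fun s => (hf.mul (cE s)).aestronglyMeasurable) i0
    ((hf.mul ((ca t).neg.mul (cE t))).aestronglyMeasurable)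
    (Filter.Eventually.of_forall fun z s hs => gen _ _ (fun z => (abs_neg _).trans_le (ha s z)) s hs z)
    (hi.const_mul _)
    (Filter.Eventually.of_forall fun z s hs => (eF_deriv hS s z).const_mul (f z))
  have hab : ∀ s z, |aF p (omt lam s) lam q z ^ 2 - vF p (omt lam s) lam q z| ≤
      (q * |Λ|) ^ 2 + q * |Λ| ^ 2 := fun s z => by
    refine (abs_sub _ _).trans ?_
    have h1 := ha s z
    rw [abs_pow]
    have := hv s z
    gcongr
  have D2 := hasDerivAt_integral_of_dominated_loc_of_deriv_le (μ := volume)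
    (F := fun t z => f z * (-(aF p (omt lam t) lam q z) * eF p (omt lam t) q z))
    (F' := fun t z => f z * ((aF p (omt lam t) lam q z ^ 2 - vF p (omt lam t) lam q z) *
      eF p (omt lam t) q z))
    (bound := fun z => (((q * |Λ|) ^ 2 + q * |Λ| ^ 2) * Real.exp ((|t| + 1) * |Λ| * q)) * (|f z| * jw z))
    (Metric.ball_mem_nhds t one_pos)
    (Filter.Eventually.of_forall fun s => (hf.mul ((ca s).neg.mul (cE s))).aestronglyMeasurable)
    D1.1
    ((hf.mul ((((ca t).pow 2).sub (cv t)).mul (cE t))).aestronglyMeasurable)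
    (Filter.Eventually.of_forall fun z s hs => gen _ _ (hab s) s hs z)
    (hi.const_mul _)
    (Filter.Eventually.of_forall fun z s hs => (eF_deriv2 hS s z).const_mul (f z))
  have en : ∀ s, -∫ z, f z * (aF p (omt lam s) lam q z * eF p (omt lam s) q z) =
      ∫ z, f z * (-(aF p (omt lam s) lam q z) * eF p (omt lam s) q z) := fun s => by
    rw [← integral_neg]; congr 1; ext z; ring
  refine ⟨i0, ?_, D2.1, ?_, ?_⟩
  · refine D1.1.neg.congr (Filter.Eventually.of_forall fun z => ?_)
    simp
  · rw [en]; exact D1.2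
  · simp_rw [en]; exact D2.2
end

section
variable {ι : Type*} [Fintype ι] {p : ι → Polynomial ℂ} {lam : ι → ℝ} {q : ℝ}

lemma cint_eq {f : ℂ → ℂ} (hf : Integrable f) :
    ∫ z, f z = ((∫ z, (f z).re : ℝ) : ℂ) + ((∫ z, (f z).im : ℝ) : ℂ) * Complex.I :=
  (integral_re_add_im hf).symm

/-- The determinant of the moment matrix. -/
noncomputable def dF (E : ℂ → ℝ) : ℝ :=
  (∫ z, 1 * E z) * (∫ z, ‖z‖ ^ 2 * E z) - (∫ z : ℂ, z.re * E z) ^ 2 - (∫ z : ℂ, z.im * E z) ^ 2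

lemma shift_sq {φ : ℂ → ℝ} (h1 : Integrable (fun z => 1 * φ z)) (hN : Integrable (fun z => ‖z‖ ^ 2 * φ z))
    (hr : Integrable (fun z : ℂ => z.re * φ z)) (hi : Integrable (fun z : ℂ => z.im * φ z)) (x y : ℝ) :
    ∫ z, ‖z - (x + y * Complex.I)‖ ^ 2 * φ z = (∫ z, ‖z‖ ^ 2 * φ z) -
      2 * (x * (∫ z : ℂ, z.re * φ z) + y * ∫ z : ℂ, z.im * φ z) + (x ^ 2 + y ^ 2) * ∫ z, 1 * φ z := by
  have : (fun z => ‖z - (x + y * Complex.I)‖ ^ 2 * φ z) = fun z : ℂ => (‖z‖ ^ 2 * φ z -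
      2 * (x * (z.re * φ z) + y * (z.im * φ z))) + (x ^ 2 + y ^ 2) * (1 * φ z) := by
    ext z
    rw [Complex.sq_norm, Complex.sq_norm, Complex.normSq_apply, Complex.normSq_apply]
    simp; ring
  have j1 : Integrable (fun z : ℂ => x * (z.re * φ z) + y * (z.im * φ z)) :=
    (hr.const_mul x).add (hi.const_mul y)
  have j2 : Integrable (fun z : ℂ => ‖z‖ ^ 2 * φ z - 2 * (x * (z.re * φ z) + y * (z.im * φ z))) :=
    hN.sub (j1.const_mul 2)
  rw [this, integral_add j2 (h1.const_mul _), integral_sub hN (j1.const_mul 2), integral_const_mul,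
    integral_add (hr.const_mul x) (hi.const_mul y), integral_const_mul, integral_const_mul,
    integral_const_mul]

lemma shift_lin {φ : ℂ → ℝ} (h1 : Integrable (fun z => 1 * φ z))
    (hr : Integrable (fun z : ℂ => z.re * φ z)) (hi : Integrable (fun z : ℂ => z.im * φ z)) (x y : ℝ) :
    ∫ z, (z - (x + y * Complex.I)) * (φ z : ℂ) =
      (((∫ z : ℂ, z.re * φ z) - x * ∫ z, 1 * φ z : ℝ) : ℂ) +
      (((∫ z : ℂ, z.im * φ z) - y * ∫ z, 1 * φ z : ℝ) : ℂ) * Complex.I := by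
  have e : (fun z => (z - (x + y * Complex.I)) * (φ z : ℂ)) = fun z : ℂ =>
      ((z.re * φ z - x * (1 * φ z) : ℝ) : ℂ) + ((z.im * φ z - y * (1 * φ z) : ℝ) : ℂ) * Complex.I := by
    ext z; apply Complex.ext <;> simp <;> ring
  have j1 : Integrable (fun z : ℂ => z.re * φ z - x * (1 * φ z)) := hr.sub (h1.const_mul x)
  have j2 : Integrable (fun z : ℂ => z.im * φ z - y * (1 * φ z)) := hi.sub (h1.const_mul y)
  rw [e, integral_add j1.ofReal (j2.ofReal.mul_const _), integral_mul_const, integral_complex_ofReal,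
    integral_complex_ofReal, integral_sub hr (h1.const_mul x), integral_sub hi (h1.const_mul y),
    integral_const_mul x, integral_const_mul y]

lemma norm_sq_re_im (u w : ℝ) : ‖(u : ℂ) + (w : ℂ) * Complex.I‖ ^ 2 = u ^ 2 + w ^ 2 := by
  rw [Complex.sq_norm, Complex.normSq_add_mul_I]

lemma horm_real {om : ι → ℝ} (hom : ∀ i, 0 < om i) (hS : ∀ z, 0 < pS p om z) (hq : 0 < q)
    {c0 C0 : ℝ} (hc0 : 0 < c0) (hlow : ∀ z, c0 * jw z ≤ eF p om q z)
    (hup : ∀ z, eF p om q z ≤ C0 * jw z) {E a V : ℂ → ℝ} (hE : E = eF p om q) (ha : a = aF p om lam q)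
    (hV : V = vF p om lam q)
    (i1 : Integrable (fun z => 1 * E z)) (iN : Integrable (fun z => ‖z‖ ^ 2 * E z))
    (ir : Integrable (fun z : ℂ => z.re * E z)) (ii : Integrable (fun z : ℂ => z.im * E z))
    (j1 : Integrable (fun z => 1 * (a z * E z))) (jN : Integrable (fun z => ‖z‖ ^ 2 * (a z * E z)))
    (jr : Integrable (fun z : ℂ => z.re * (a z * E z))) (ji : Integrable (fun z : ℂ => z.im * (a z * E z)))
    (k1 : Integrable (fun z => 1 * ((a z ^ 2 - V z) * E z)))
    (kN : Integrable (fun z => ‖z‖ ^ 2 * ((a z ^ 2 - V z) * E z)))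
    (kr : Integrable (fun z : ℂ => z.re * ((a z ^ 2 - V z) * E z)))
    (ki : Integrable (fun z : ℂ => z.im * ((a z ^ 2 - V z) * E z))) :
    ∃ x y : ℝ, (∫ z : ℂ, z.re * E z) = x * (∫ z, 1 * E z) ∧
      (∫ z : ℂ, z.im * E z) = y * (∫ z, 1 * E z) ∧ 0 < (∫ z, 1 * E z) ∧
      0 < (∫ z, ‖z‖ ^ 2 * E z) - (x ^ 2 + y ^ 2) * ∫ z, 1 * E z ∧
      (∫ z, 1 * ((a z ^ 2 - V z) * E z)) ≤ (-∫ z, 1 * (a z * E z)) ^ 2 / (∫ z, 1 * E z) +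
        ((-(∫ z : ℂ, z.re * (a z * E z)) - x * (-∫ z, 1 * (a z * E z))) ^ 2 +
        (-(∫ z : ℂ, z.im * (a z * E z)) - y * (-∫ z, 1 * (a z * E z))) ^ 2) /
        ((∫ z, ‖z‖ ^ 2 * E z) - (x ^ 2 + y ^ 2) * ∫ z, 1 * E z) ∧
      (∫ z, ‖z‖ ^ 2 * ((a z ^ 2 - V z) * E z)) - 2 * (x * (∫ z : ℂ, z.re * ((a z ^ 2 - V z) * E z)) +
        y * (∫ z : ℂ, z.im * ((a z ^ 2 - V z) * E z))) + (x ^ 2 + y ^ 2) * (∫ z, 1 * ((a z ^ 2 - V z) * E z))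
        ≤ ((-(∫ z : ℂ, z.re * (a z * E z)) - x * (-∫ z, 1 * (a z * E z))) ^ 2 +
        (-(∫ z : ℂ, z.im * (a z * E z)) - y * (-∫ z, 1 * (a z * E z))) ^ 2) / (∫ z, 1 * E z) +
        ((-∫ z, ‖z‖ ^ 2 * (a z * E z)) - 2 * (x * (-∫ z : ℂ, z.re * (a z * E z)) +
        y * (-∫ z : ℂ, z.im * (a z * E z))) + (x ^ 2 + y ^ 2) * (-∫ z, 1 * (a z * E z))) ^ 2 /
        ((∫ z, ‖z‖ ^ 2 * E z) - (x ^ 2 + y ^ 2) * ∫ z, 1 * E z) := by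
  have cE : Continuous E := hE ▸ continuous_eF hS
  have E0 : ∀ z, 0 < E z := fun z => hE ▸ eF_pos hS z
  have hA0 : 0 < ∫ z, 1 * E z := by
    refine integral_pos_of_integrable_nonneg_nonzero (x := 0) (by fun_prop) i1 (fun z => ?_) ?_
    · simpa using (E0 z).le
    · simpa using (E0 0).ne'
  set A := ∫ z, 1 * E z with hA
  set x := (∫ z : ℂ, z.re * E z) / A with hx
  set y := (∫ z : ℂ, z.im * E z) / A with hy
  have hX : (∫ z : ℂ, z.re * E z) = x * A := by rw [hx]; field_simp
  have hY : (∫ z : ℂ, z.im * E z) = y * A := by rw [hy]; field_simp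
  have hsq := shift_sq i1 iN ir ii x y
  have hlin := shift_lin i1 ir ii x y
  rw [← hA, hX, hY] at hsq hlin
  set c : ℂ := x + y * Complex.I with hc
  have hC : (∫ z, ‖z - c‖ ^ 2 * E z) = (∫ z, ‖z‖ ^ 2 * E z) - (x ^ 2 + y ^ 2) * A := by
    rw [hsq]; ring
  have hC0 : 0 < ∫ z, ‖z - c‖ ^ 2 * E z := by
    refine integral_pos_of_integrable_nonneg_nonzero (x := c + 1) (by fun_prop) ?_ (fun z => ?_) ?_
    · have hup' : ∀ z, E z ≤ C0 * jw z := fun z => hE ▸ hup z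
      exact G1.intsq cE E0 hup' (G1.id.sub (G1.const c))
    · have := (E0 z).le; positivity
    · simpa using (E0 _).ne'
  have h0 : ∫ z, (z - c) * (E z : ℂ) = 0 := by rw [hlin]; simp
  refine ⟨x, y, hX, hY, hA0, hC ▸ hC0, ?_, ?_⟩
  · have key := horm_ineq (lam := lam) hom hS hq hc0 hlow hup (c := c) (by rw [← hE]; exact h0)
      (A := A) (by rw [hA, hE]; simp) rfl hA0 (by rw [← hE]; exact hC0) 1 0
    rw [← hE, ← ha, ← hV, hC] at key
    have e1 : ∫ z, (a z ^ 2 - V z) * ‖(1 : ℂ) + 0 * z‖ ^ 2 * E z = ∫ z, 1 * ((a z ^ 2 - V z) * E z) := by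
      congr 1; ext z; simp
    have e2 : ∫ z, ((a z : ℂ) * (1 + 0 * z)) * (E z : ℂ) = ((∫ z, 1 * (a z * E z) : ℝ) : ℂ) := by
      rw [← integral_complex_ofReal]; congr 1; ext z; push_cast; ring
    have e3 : ∫ z, ((a z : ℂ) * (1 + 0 * z)) * (starRingEnd ℂ) (z - c) * (E z : ℂ) =
        (starRingEnd ℂ) (∫ z, (z - c) * ((a z * E z : ℝ) : ℂ)) := by
      rw [← integral_conj]; congr 1; ext z
      simp only [map_mul, map_sub, Complex.conj_ofReal]; push_cast; ring
    rw [e1, e2, e3, RCLike.norm_conj, shift_lin j1 jr ji, norm_sq_re_im, Complex.norm_real,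
      Real.norm_eq_abs, sq_abs] at key
    refine key.trans (le_of_eq ?_)
    ring
  · have key := horm_ineq (lam := lam) hom hS hq hc0 hlow hup (c := c) (by rw [← hE]; exact h0)
      (A := A) (by rw [hA, hE]; simp) rfl hA0 (by rw [← hE]; exact hC0) (-c) 1
    rw [← hE, ← ha, ← hV, hC] at key
    have e1 : ∫ z, (a z ^ 2 - V z) * ‖-c + 1 * z‖ ^ 2 * E z = ∫ z, ‖z - c‖ ^ 2 * ((a z ^ 2 - V z) * E z) := by
      congr 1; ext z; rw [show -c + 1 * z = z - c by ring]; ring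
    have e2 : ∫ z, ((a z : ℂ) * (-c + 1 * z)) * (E z : ℂ) = ∫ z, (z - c) * ((a z * E z : ℝ) : ℂ) := by
      congr 1; ext z; push_cast; ring
    have e3 : ∫ z, ((a z : ℂ) * (-c + 1 * z)) * (starRingEnd ℂ) (z - c) * (E z : ℂ) =
        ((∫ z, ‖z - c‖ ^ 2 * (a z * E z) : ℝ) : ℂ) := by
      rw [ofReal_intsq (fun z => a z * E z)]; congr 1; ext z
      push_cast; ring
    rw [e1, e2, e3, shift_lin j1 jr ji, norm_sq_re_im, Complex.norm_real,
      Real.norm_eq_abs, sq_abs, shift_sq k1 kN kr ki, shift_sq j1 jN jr ji] at key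
    refine key.trans (le_of_eq ?_)
    ring

theorem logdet_ineq (hS : ∀ z, 0 < pS p (fun _ => 1) z) (hq : 0 < q)
    (hjw : ∀ z, eF p (fun _ => 1) q z = jw z) :
    0 < dF (eF p (omt lam 1) q) ∧ 0 < dF jw ∧
    Real.log (dF (eF p (omt lam 1) q)) ≤ Real.log (dF jw) +
      -((∫ z, 1 * (aF p (fun _ => 1) lam q z * jw z)) * (∫ z, ‖z‖ ^ 2 * jw z) +
      (∫ z, 1 * jw z) * (∫ z, ‖z‖ ^ 2 * (aF p (fun _ => 1) lam q z * jw z)) -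
        2 * (∫ z : ℂ, z.re * jw z) * (∫ z : ℂ, z.re * (aF p (fun _ => 1) lam q z * jw z)) -
        2 * (∫ z : ℂ, z.im * jw z) * (∫ z : ℂ, z.im * (aF p (fun _ => 1) lam q z * jw z))) / dF jw := by
  have g1 : ∀ z : ℂ, |(1 : ℝ)| ≤ 1 * (1 + ‖z‖ ^ 2) := fun z => by
    rw [abs_one]; nlinarith [sq_nonneg ‖z‖]
  have gN : ∀ z : ℂ, |‖z‖ ^ 2| ≤ 1 * (1 + ‖z‖ ^ 2) := fun z => by
    rw [abs_of_nonneg (sq_nonneg _)]; linarith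
  have gre : ∀ z : ℂ, |z.re| ≤ 1 * (1 + ‖z‖ ^ 2) := fun z => by
    have := Complex.abs_re_le_norm z; nlinarith [sq_nonneg (‖z‖ - 1)]
  have gim : ∀ z : ℂ, |z.im| ≤ 1 * (1 + ‖z‖ ^ 2) := fun z => by
    have := Complex.abs_im_le_norm z; nlinarith [sq_nonneg (‖z‖ - 1)]
  have cN : Continuous (fun z : ℂ => ‖z‖ ^ 2) := by fun_prop
  have d1 := fun t => deriv_int (lam := lam) hS hq hjw (f := fun _ => 1) continuous_const g1 t
  have dN := fun t => deriv_int (lam := lam) hS hq hjw (f := fun z => ‖z‖ ^ 2) cN gN t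
  have dre := fun t => deriv_int (lam := lam) hS hq hjw (f := fun z => z.re) Complex.continuous_re gre t
  have dim := fun t => deriv_int (lam := lam) hS hq hjw (f := fun z => z.im) Complex.continuous_im gim t
  obtain ⟨Λ, hΛ⟩ : ∃ Λ, ∀ i, |lam i| ≤ Λ := by
    obtain ⟨Λ, h⟩ := (Set.finite_range fun i => |lam i|).bddAbove
    exact ⟨Λ, fun i => h ⟨i, rfl⟩⟩
  have hmain : ∀ t, _ := fun t => horm_real (lam := lam) (omt_pos t) (pS_omt_pos hS t) hq (Real.exp_pos _)
    (fun z => (eF_bounds hS hq hjw hΛ t z).1) (fun z => (eF_bounds hS hq hjw hΛ t z).2) rfl rfl rfl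
    (d1 t).1 (dN t).1 (dre t).1 (dim t).1 (d1 t).2.1 (dN t).2.1 (dre t).2.1 (dim t).2.1
    (d1 t).2.2.1 (dN t).2.2.1 (dre t).2.2.1 (dim t).2.2.1
  have hpos : ∀ t, 0 < dF (eF p (omt lam t) q) := fun t => by
    obtain ⟨x, y, hX, hY, hA, hC, -⟩ := hmain t
    unfold dF
    rw [hX, hY]
    have := mul_pos hA hC
    refine this.trans_eq ?_
    ring
  have hD1 : ∀ t, HasDerivAt (fun t => dF (eF p (omt lam t) q)) _ t := fun t =>
    (((d1 t).2.2.2.1.mul (dN t).2.2.2.1).sub ((dre t).2.2.2.1.pow 2)).sub ((dim t).2.2.2.1.pow 2)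
  have hD2 := fun t =>
    ((((d1 t).2.2.2.2.mul (dN t).2.2.2.1).add ((d1 t).2.2.2.1.mul (dN t).2.2.2.2)).sub
      (((dre t).2.2.2.1.const_mul 2).mul ((dre t).2.2.2.2))).sub
      (((dim t).2.2.2.1.const_mul 2).mul ((dim t).2.2.2.2))
  have key := logconcave_step (d := fun t => dF (eF p (omt lam t) q)) (d1 := _) (d2 := _)
    (fun t => (hD1 t).congr_deriv (by simp only [Nat.cast_ofNat]; rw [Nat.add_one_sub_one 1, pow_one, pow_one]; rfl)) hD2 hpos ?_
  · refine ⟨hpos 1, ?_, ?_⟩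
    · have := hpos 0
      rw [omt_zero, show eF p (fun _ => 1) q = jw from funext hjw] at this
      exact this
    · simp only [omt_zero, show eF p (fun _ => 1) q = jw from funext hjw] at key
      refine key.trans (le_of_eq ?_)
      congr 2
      simp only [Pi.mul_apply, Pi.add_apply, Pi.sub_apply, omt_zero, show eF p (fun _ => 1) q = jw from funext hjw]
      ring
  · intro t
    obtain ⟨x, y, hX, hY, hA, hC, h1, h2⟩ := hmain t
    have := det_alg hA hC h1 h2
    unfold dF
    rw [← hX, ← hY] at this
    refine le_trans (le_of_eq ?_) (this.trans (le_of_eq ?_))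
    · ring
    · simp only [Pi.mul_apply, Pi.add_apply, Pi.sub_apply]
end

lemma radial_ftc {g F : ℝ → ℝ} {m : ℝ} (hi : Integrable (fun z : ℂ => g ‖z‖))
    (hF : ∀ y, 0 ≤ y → HasDerivAt F (2 * (y * g y)) y)
    (hm : Filter.Tendsto F Filter.atTop (nhds m)) : ∫ z : ℂ, g ‖z‖ = Real.pi * (m - F 0) := by
  have h1 := hi
  rw [integrable_fun_norm_addHaar (μ := (volume : Measure ℂ)) (f := g)] at h1
  have h2 := integral_fun_norm_addHaar (volume : Measure ℂ) g
  simp only [Complex.finrank_real_complex] at h1 h2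
  have h3 : ∫ y in Set.Ioi (0 : ℝ), 2 * (y * g y) = m - F 0 := by
    refine integral_Ioi_of_hasDerivAt_of_tendsto' (fun y hy => hF y hy) ?_ hm
    refine (IntegrableOn.congr_fun h1 (fun y _ => ?_) measurableSet_Ioi).const_mul 2
    simp
  rw [h2, ← h3, integral_const_mul]
  have : (volume : Measure ℂ).real (Metric.ball 0 1) = Real.pi := by
    rw [Measure.real, Complex.volume_ball]; simp
  rw [this]; simp; ring

noncomputable def Ik (k a : ℕ) : ℝ := ∫ z : ℂ, (‖z‖ ^ 2) ^ a * ((1 + ‖z‖ ^ 2) ^ (k + 2))⁻¹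

lemma Ik_int {k a : ℕ} (h : a ≤ k) :
    Integrable (fun z : ℂ => (‖z‖ ^ 2) ^ a * ((1 + ‖z‖ ^ 2) ^ (k + 2))⁻¹) := by
  refine integrable_base.mono' ?_ (Filter.Eventually.of_forall fun z => ?_)
  · refine Continuous.aestronglyMeasurable (Continuous.mul (by fun_prop) (Continuous.inv₀ (by fun_prop) ?_))
    intro z; positivity
  · rw [Real.norm_of_nonneg (by positivity)]
    have hs : 0 ≤ ‖z‖ ^ 2 := sq_nonneg _
    have h1 : (‖z‖ ^ 2) ^ a ≤ (1 + ‖z‖ ^ 2) ^ k :=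
      (pow_le_pow_left₀ hs (by linarith) a).trans (pow_le_pow_right₀ (by linarith) h)
    rw [← div_eq_mul_inv, div_le_iff₀ (by positivity), pow_add]
    field_simp
    exact h1

lemma Ik_zero (k : ℕ) : Ik k 0 = Real.pi / (k + 1) := by
  have := radial_ftc (g := fun r => (r ^ 2) ^ 0 * ((1 + r ^ 2) ^ (k + 2))⁻¹)
    (F := fun r => -((1 : ℝ) / (k + 1)) * ((1 + r ^ 2) ^ (k + 1))⁻¹) (m := 0) (Ik_int (Nat.zero_le k))
    (fun y _ => by
      have h0 : (0 : ℝ) < 1 + y ^ 2 := by positivity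
      have h1 : HasDerivAt (fun r : ℝ => (1 + r ^ 2)) (2 * y) y := by
        simpa using (hasDerivAt_pow 2 y).const_add 1
      have h2 := ((h1.pow (k + 1)).inv (pow_pos h0 _).ne').const_mul (-((1 : ℝ) / (k + 1)))
      refine h2.congr_deriv ?_
      have : (k : ℝ) + 1 ≠ 0 := by positivity
      simp
      field_simp
      try ring)
    (by
      have h1 : Filter.Tendsto (fun r : ℝ => ((1 + r ^ 2) ^ (k + 1))⁻¹) Filter.atTop (nhds 0) := by
        apply Filter.Tendsto.inv_tendsto_atTop
        refine (Filter.tendsto_pow_atTop (Nat.succ_ne_zero k)).comp ?_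
        exact Filter.tendsto_atTop_add_const_left _ _ (Filter.tendsto_pow_atTop two_ne_zero)
      simpa using h1.const_mul (-((1 : ℝ) / (k + 1))))
  unfold Ik
  rw [this]; simp; ring

lemma Ik_succ {k a : ℕ} (h : a < k) : ((k : ℝ) - a) * Ik k (a + 1) = (a + 1) * Ik k a := by
  have i1 := (Ik_int h.le).const_mul ((a : ℝ) + 1)
  have i2 := (Ik_int (Nat.succ_le_of_lt h)).const_mul ((k : ℝ) - a)
  have := radial_ftc (g := fun r => ((a : ℝ) + 1) * ((r ^ 2) ^ a * ((1 + r ^ 2) ^ (k + 2))⁻¹) -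
      ((k : ℝ) - a) * ((r ^ 2) ^ (a + 1) * ((1 + r ^ 2) ^ (k + 2))⁻¹))
    (F := fun r => (r ^ 2) ^ (a + 1) * ((1 + r ^ 2) ^ (k + 1))⁻¹) (m := 0) (i1.sub i2)
    (fun y _ => by
      have h0 : (0 : ℝ) < 1 + y ^ 2 := by positivity
      have h1 : HasDerivAt (fun r : ℝ => (1 + r ^ 2)) (2 * y) y := by
        simpa using (hasDerivAt_pow 2 y).const_add 1
      have h3 : HasDerivAt (fun r : ℝ => r ^ 2) (2 * y) y := by
        simpa using (hasDerivAt_pow 2 y)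
      have h2 := (h3.pow (a + 1)).mul ((h1.pow (k + 1)).inv (pow_pos h0 _).ne')
      refine h2.congr_deriv ?_
      simp
      field_simp
      try ring)
    (by
      have h1 : Filter.Tendsto (fun r : ℝ => (1 + r ^ 2)⁻¹) Filter.atTop (nhds 0) := by
        apply Filter.Tendsto.inv_tendsto_atTop
        exact Filter.tendsto_atTop_add_const_left _ _ (Filter.tendsto_pow_atTop two_ne_zero)
      refine squeeze_zero (fun r => by positivity) (fun r => ?_) h1
      have hs : 0 ≤ r ^ 2 := sq_nonneg _
      have h1 : (r ^ 2) ^ (a + 1) ≤ (1 + r ^ 2) ^ k :=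
        (pow_le_pow_left₀ hs (by linarith) _).trans (pow_le_pow_right₀ (by linarith) h)
      rw [← div_eq_mul_inv, div_le_iff₀ (by positivity), pow_succ (1 + r ^ 2)]
      field_simp
      exact h1)
  rw [integral_sub i1 i2, integral_const_mul, integral_const_mul] at this
  simp at this
  unfold Ik
  simp only [pow_succ] at this ⊢
  linarith

lemma Ik_eq {k a : ℕ} (h : a ≤ k) : Ik k a = Real.pi / ((k + 1) * k.choose a) := by
  induction a with
  | zero => rw [Ik_zero]; simp
  | succ a ih =>
    have h1 := Ik_succ h
    rw [ih (by omega)] at h1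
    have h2 := Nat.choose_succ_right_eq k a
    have h3 : (k.choose (a + 1) : ℝ) * (a + 1) = k.choose a * (k - a) := by
      have := congrArg (Nat.cast (R := ℝ)) h2
      push_cast [Nat.cast_sub (show a ≤ k by omega)] at this
      exact this
    have hka : (0 : ℝ) < k - a := by
      have : (a : ℝ) < k := by exact_mod_cast h
      linarith
    have c1 : (0 : ℝ) < k.choose (a + 1) := by exact_mod_cast Nat.choose_pos h
    have c2 : (0 : ℝ) < k.choose a := by exact_mod_cast Nat.choose_pos (show a ≤ k by omega)
    rw [eq_div_iff (by positivity)]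
    have h4 : ((k : ℝ) - a) * (Ik k (a + 1) * ((k + 1) * k.choose (a + 1))) = (k - a) * Real.pi := by
      rw [← mul_assoc, h1]
      calc _ = Real.pi / ((k + 1) * k.choose a) * (k + 1) * (k.choose (a + 1) * (a + 1)) := by ring
        _ = _ := by rw [h3]; field_simp
    exact mul_left_cancel₀ hka.ne' h4

lemma Gk_int {k a b : ℕ} (ha : a ≤ k) (hb : b ≤ k) :
    Integrable (fun z : ℂ => z ^ a * (starRingEnd ℂ) z ^ b * (((1 + ‖z‖ ^ 2) ^ (k + 2))⁻¹ : ℝ)) := by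
  have i := (Ik_int ha).add (Ik_int hb)
  refine i.mono' ?_ (Filter.Eventually.of_forall fun z => ?_)
  · refine Continuous.aestronglyMeasurable (Continuous.mul (by fun_prop) (Complex.continuous_ofReal.comp (Continuous.inv₀ (by fun_prop) ?_)))
    intro z; positivity
  · rw [norm_mul, norm_mul, norm_pow, norm_pow, RCLike.norm_conj, Complex.norm_real,
      Real.norm_of_nonneg (by positivity)]
    simp only [Pi.add_apply]
    rw [← add_mul]
    refine mul_le_mul_of_nonneg_right ?_ (by positivity)
    rw [← pow_mul, ← pow_mul, mul_comm 2 a, mul_comm 2 b, pow_mul, pow_mul]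
    nlinarith [sq_nonneg (‖z‖ ^ a - ‖z‖ ^ b), sq_nonneg (‖z‖ ^ a), sq_nonneg (‖z‖ ^ b)]

lemma Gk_eq {k a b : ℕ} (ha : a ≤ k) :
    ∫ z : ℂ, z ^ a * (starRingEnd ℂ) z ^ b * (((1 + ‖z‖ ^ 2) ^ (k + 2))⁻¹ : ℝ) =
      if a = b then ((Real.pi / ((k + 1) * k.choose a) : ℝ) : ℂ) else 0 := by
  split_ifs with hab
  · subst hab
    rw [← Ik_eq ha, Ik, ← integral_complex_ofReal]
    congr 1; ext z
    rw [← mul_pow, Complex.mul_conj, Complex.normSq_eq_norm_sq]; push_cast; ring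
  · set f : ℂ → ℂ := fun z : ℂ => z ^ a * (starRingEnd ℂ) z ^ b * (((1 + ‖z‖ ^ 2) ^ (k + 2))⁻¹ : ℝ) with hf
    have hd : ((a : ℝ) - b) ≠ 0 := sub_ne_zero.2 (by exact_mod_cast hab)
    set w : Circle := Circle.exp (Real.pi / (a - b)) with hw
    have h1 : ∫ z, f (rotation w z) = ∫ z, f z :=
      (LinearIsometryEquiv.measurePreserving (rotation w)).integral_comp
        (rotation w).toHomeomorph.measurableEmbedding f
    have h2 : ∀ z, f (rotation w z) = - f z := by
      intro z
      have e1 : (w : ℂ) ^ a * (starRingEnd ℂ) (w : ℂ) ^ b = -1 := by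
        rw [hw, Circle.coe_exp, ← Complex.exp_conj, ← Complex.exp_nat_mul, ← Complex.exp_nat_mul,
          ← Complex.exp_add]
        have hd' : ((a : ℂ) - b) ≠ 0 := by exact_mod_cast hd
        rw [← Complex.exp_pi_mul_I]
        congr 1
        simp only [map_mul, Complex.conj_ofReal, Complex.conj_I]
        push_cast
        field_simp
        try ring
      simp only [hf, rotation_apply, map_mul, norm_mul, Circle.norm_coe, one_mul, mul_pow]
      linear_combination (z ^ a * (starRingEnd ℂ) z ^ b * (((1 + ‖z‖ ^ 2) ^ (k + 2))⁻¹ : ℝ)) * e1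
    simp only [h2, integral_neg] at h1
    have : (2 : ℂ) * ∫ z, f z = 0 := by linear_combination -h1
    simpa using this

lemma mom_one : ∫ z : ℂ, 1 * jw z = Real.pi / 2 := by
  have := Ik_eq (k := 1) (a := 0) (by norm_num)
  unfold Ik at this
  simp only [pow_zero] at this
  rw [show (fun z : ℂ => 1 * jw z) = fun z => 1 * ((1 + ‖z‖ ^ 2) ^ (1 + 2))⁻¹ from by
    ext z; simp [jw]]
  rw [this]; norm_num

lemma mom_N : ∫ z : ℂ, ‖z‖ ^ 2 * jw z = Real.pi / 2 := by
  have := Ik_eq (k := 1) (a := 1) (by norm_num)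
  unfold Ik at this
  simp only [pow_one] at this
  rw [show (fun z : ℂ => ‖z‖ ^ 2 * jw z) = fun z => ‖z‖ ^ 2 * ((1 + ‖z‖ ^ 2) ^ (1 + 2))⁻¹ from by
    ext z; simp [jw]]
  rw [this]; norm_num

lemma mom_re_im : (∫ z : ℂ, z.re * jw z) = 0 ∧ (∫ z : ℂ, z.im * jw z) = 0 := by
  have hi := Gk_int (k := 1) (a := 1) (b := 0) le_rfl (by norm_num)
  have h := Gk_eq (k := 1) (a := 1) (b := 0) le_rfl
  simp only [pow_one, pow_zero, mul_one, one_ne_zero, if_false] at h hi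
  have hr := integral_re (𝕜 := ℂ) hi
  have hm := integral_im (𝕜 := ℂ) hi
  rw [h] at hr hm
  simp only [RCLike.re_eq_complex_re, RCLike.im_eq_complex_im, Complex.re_mul_ofReal,
    Complex.im_mul_ofReal, Complex.zero_re, Complex.zero_im] at hr hm
  exact ⟨hr, hm⟩

lemma dF_jw : dF jw = (Real.pi / 2) ^ 2 := by
  unfold dF; rw [mom_one, mom_N, mom_re_im.1, mom_re_im.2]; ring

theorem star1 {ι : Type*} [Fintype ι] (p : ι → Polynomial ℂ) (lam : ι → ℝ) {k : ℕ} (hk : 1 ≤ k)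
    (hp1 : ∀ z, pS p (fun _ => 1) z = (1 + ‖z‖ ^ 2) ^ k)
    (hItg : ∀ i, Integrable (fun z : ℂ => ‖(p i).eval z‖ ^ 2 * ((1 + ‖z‖ ^ 2) ^ (k + 2))⁻¹))
    (hval : ∀ i, ∫ z : ℂ, ‖(p i).eval z‖ ^ 2 * ((1 + ‖z‖ ^ 2) ^ (k + 2))⁻¹ = Real.pi / (k + 1)) :
    0 < dF (eF p (omt lam 1) (3 / k)) ∧
    Real.log (dF (eF p (omt lam 1) (3 / k))) ≤ Real.log ((Real.pi / 2) ^ 2) -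
      6 / (k * (k + 1)) * ∑ i, lam i ∧
    ∃ C, ∀ z, Real.exp (-C) * jw z ≤ eF p (omt lam 1) (3 / k) z ∧
      eF p (omt lam 1) (3 / k) z ≤ Real.exp C * jw z := by
  have hk0 : (0 : ℝ) < k := by exact_mod_cast hk
  have hq : (0 : ℝ) < 3 / k := by positivity
  have hS : ∀ z, 0 < pS p (fun _ => 1) z := fun z => by rw [hp1]; positivity
  have hjw : ∀ z, eF p (fun _ => 1) (3 / (k : ℝ)) z = jw z := by
    intro z
    have h0 : (0 : ℝ) < 1 + ‖z‖ ^ 2 := by positivity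
    unfold eF jw
    rw [hp1, Real.rpow_neg (by positivity), ← Real.rpow_natCast, ← Real.rpow_mul h0.le,
      mul_div_cancel₀ _ hk0.ne']
    norm_cast
  obtain ⟨h1, -, h3⟩ := logdet_ineq (lam := lam) hS hq hjw
  refine ⟨h1, h3.trans ?_, ?_⟩
  swap
  · obtain ⟨Λ, h⟩ := (Set.finite_range fun i => |lam i|).bddAbove
    exact ⟨|1| * Λ * (3 / k), fun z => eF_bounds hS hq hjw (fun i => h ⟨i, rfl⟩) 1 z⟩
  rw [mom_one, mom_N, mom_re_im.1, mom_re_im.2, dF_jw]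
  obtain ⟨Λ, hΛ⟩ : ∃ Λ, ∀ i, |lam i| ≤ Λ := by
    obtain ⟨Λ, h⟩ := (Set.finite_range fun i => |lam i|).bddAbove
    exact ⟨Λ, fun i => h ⟨i, rfl⟩⟩
  have hab := abs_aF_le (lam := lam) (om := fun _ : ι => (1 : ℝ)) (fun _ => one_pos) hS hq hΛ
  have hca := continuous_aF (lam := lam) (q := 3 / (k : ℝ)) hS
  have i1 : Integrable (fun z => 1 * (aF p (fun _ => 1) lam (3 / k) z * jw z)) := by
    have := integrable_jw_of_le hca (C := 3 / k * Λ) (fun z => (hab z).trans (by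
      have h0 := (abs_nonneg _).trans (hab z)
      nlinarith [mul_nonneg h0 (sq_nonneg ‖z‖)]))
    simpa using this
  have i2 : Integrable (fun z : ℂ => ‖z‖ ^ 2 * (aF p (fun _ => 1) lam (3 / k) z * jw z)) := by
    have := integrable_jw_of_le (f := fun z => ‖z‖ ^ 2 * aF p (fun _ => 1) lam (3 / k) z)
      ((continuous_norm.pow 2).mul hca) (C := 3 / k * Λ) (fun z => by
      have h0 := (abs_nonneg _).trans (hab z)
      rw [abs_mul, abs_of_nonneg (sq_nonneg ‖z‖)]
      have := mul_le_mul_of_nonneg_left (hab z) (sq_nonneg ‖z‖)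
      linarith)
    simpa [mul_assoc] using this
  have e : (∫ z, 1 * (aF p (fun _ => 1) lam (3 / k) z * jw z)) +
      (∫ z : ℂ, ‖z‖ ^ 2 * (aF p (fun _ => 1) lam (3 / k) z * jw z)) =
      3 / k * ((∑ i, lam i) * (Real.pi / (k + 1))) := by
    rw [← integral_add i1 i2, Finset.sum_mul, ← Finset.sum_congr rfl (fun i _ => by rw [← hval i]),
      Finset.sum_congr rfl (fun i _ => (integral_const_mul (lam i) _).symm),
      ← integral_finsetSum _ (fun i _ => (hItg i).const_mul _), ← integral_const_mul]
    congr 1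
    ext z
    have h0 : (0 : ℝ) < 1 + ‖z‖ ^ 2 := by positivity
    unfold aF jw
    rw [hp1]
    unfold pS
    rw [show ∑ i, lam i * (‖(p i).eval z‖ ^ 2 * ((1 + ‖z‖ ^ 2) ^ (k + 2))⁻¹) =
      (∑ i, lam i * 1 * ‖(p i).eval z‖ ^ 2) * ((1 + ‖z‖ ^ 2) ^ (k + 2))⁻¹ by
        rw [Finset.sum_mul]; exact Finset.sum_congr rfl fun i _ => by ring]
    field_simp
    ring
  have hpi := Real.pi_pos
  have e2 : ∀ A B : ℝ, -(A * (Real.pi / 2) + Real.pi / 2 * B - 2 * 0 * (∫ z : ℂ, z.re * (aF p (fun _ => 1) lam (3 / k) z * jw z)) -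
      2 * 0 * (∫ z : ℂ, z.im * (aF p (fun _ => 1) lam (3 / k) z * jw z))) / (Real.pi / 2) ^ 2 =
      - (A + B) * (2 / Real.pi) := by
    intro A B; field_simp; ring
  rw [e2, e]
  refine le_of_eq ?_
  field_simp
  ring

lemma poly_int {k : ℕ} (c : Fin (k + 1) → ℂ) :
    Integrable (fun z : ℂ => ‖∑ a, c a * z ^ (a : ℕ)‖ ^ 2 * ((1 + ‖z‖ ^ 2) ^ (k + 2))⁻¹) ∧
    ∫ z : ℂ, ‖∑ a, c a * z ^ (a : ℕ)‖ ^ 2 * ((1 + ‖z‖ ^ 2) ^ (k + 2))⁻¹ =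
      ∑ a, ‖c a‖ ^ 2 * (Real.pi / ((k + 1) * k.choose a)) := by
  have key : ∀ z : ℂ, ((‖∑ a, c a * z ^ (a : ℕ)‖ ^ 2 * ((1 + ‖z‖ ^ 2) ^ (k + 2))⁻¹ : ℝ) : ℂ) =
      ∑ a, ∑ b, (c a * (starRingEnd ℂ) (c b)) * (z ^ (a : ℕ) * (starRingEnd ℂ z) ^ (b : ℕ) *
        (((1 + ‖z‖ ^ 2) ^ (k + 2))⁻¹ : ℝ)) := by
    intro z
    rw [Complex.ofReal_mul, Complex.ofReal_pow, ← Complex.mul_conj', map_sum, Finset.sum_mul_sum,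
      Finset.sum_mul]
    refine Finset.sum_congr rfl fun a _ => ?_
    rw [Finset.sum_mul]
    refine Finset.sum_congr rfl fun b _ => ?_
    rw [map_mul, map_pow]; ring
  have hle : ∀ a : Fin (k + 1), (a : ℕ) ≤ k := fun a => Nat.lt_succ_iff.1 a.2
  have hi : ∀ a b : Fin (k + 1), Integrable (fun z : ℂ => (c a * (starRingEnd ℂ) (c b)) *
      (z ^ (a : ℕ) * (starRingEnd ℂ z) ^ (b : ℕ) * (((1 + ‖z‖ ^ 2) ^ (k + 2))⁻¹ : ℝ))) := fun a b =>
    (Gk_int (hle a) (hle b)).const_mul _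
  have hI : Integrable (fun z : ℂ =>
      ((‖∑ a, c a * z ^ (a : ℕ)‖ ^ 2 * ((1 + ‖z‖ ^ 2) ^ (k + 2))⁻¹ : ℝ) : ℂ)) := by
    simp_rw [key]
    exact integrable_finsetSum _ fun a _ => integrable_finsetSum _ fun b _ => hi a b
  refine ⟨(hI.re).congr (Filter.Eventually.of_forall fun z => Complex.ofReal_re _), ?_⟩
  apply Complex.ofReal_injective
  rw [← integral_complex_ofReal]
  simp_rw [key]
  rw [integral_finsetSum _ fun a _ => integrable_finsetSum _ fun b _ => hi a b, Complex.ofReal_sum]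
  refine Finset.sum_congr rfl fun a _ => ?_
  rw [integral_finsetSum _ fun b _ => hi a b]
  simp_rw [integral_const_mul, Gk_eq (hle a)]
  rw [Finset.sum_eq_single a]
  · rw [if_pos rfl, Complex.mul_conj', Complex.ofReal_mul, Complex.ofReal_pow]
  · intro b _ hb
    rw [if_neg (fun h => hb (Fin.ext h.symm)), mul_zero]
  · simp

open Matrix ComplexOrder in
lemma unit_sum {n : Type*} [Fintype n] [DecidableEq n] (A : Matrix n n ℂ) (v : n → ℂ) :
    ((∑ j, ‖(A *ᵥ v) j‖ ^ 2 : ℝ) : ℂ) = star v ⬝ᵥ ((Aᴴ * A) *ᵥ v) := by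
  rw [← Matrix.mulVec_mulVec, Matrix.dotProduct_mulVec, Matrix.vecMul_conjTranspose, star_star,
    dotProduct]
  push_cast
  refine Finset.sum_congr rfl fun j _ => ?_
  rw [Pi.star_apply, RCLike.star_def, Complex.conj_mul']

open Matrix ComplexOrder in
theorem star2 {k : ℕ} (hk : 1 ≤ k) (s : Fin (k + 1) → Polynomial ℂ) (hs : ∀ j, (s j).natDegree ≤ k)
    (hdet : (Matrix.of fun j a : Fin (k + 1) => (s j).coeff (a : ℕ)).det ≠ 0) :
    0 < dF (fun z => (∑ j, ‖(s j).eval z‖ ^ 2) ^ (-(3 / (k : ℝ)))) ∧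
    Real.log (dF (fun z => (∑ j, ‖(s j).eval z‖ ^ 2) ^ (-(3 / (k : ℝ))))) ≤
      Real.log ((Real.pi / 2) ^ 2) - 6 / (k * (k + 1)) *
        Real.log (‖(Matrix.of fun j a : Fin (k + 1) => (s j).coeff (a : ℕ)).det‖ ^ 2 /
          ∏ a : Fin (k + 1), (k.choose a : ℝ)) ∧
    ∃ C, ∀ z, Real.exp (-C) * jw z ≤ (∑ j, ‖(s j).eval z‖ ^ 2) ^ (-(3 / (k : ℝ))) ∧
      (∑ j, ‖(s j).eval z‖ ^ 2) ^ (-(3 / (k : ℝ))) ≤ Real.exp C * jw z := by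
  set M : Matrix (Fin (k + 1)) (Fin (k + 1)) ℂ := Matrix.of fun j a => (s j).coeff (a : ℕ) with hM
  have hle : ∀ a : Fin (k + 1), (a : ℕ) ≤ k := fun a => Nat.lt_succ_iff.1 a.2
  set D : Fin (k + 1) → ℝ := fun a => √(k.choose a) with hD
  have hch : ∀ a : Fin (k + 1), (0 : ℝ) < k.choose a := fun a => by
    exact_mod_cast Nat.choose_pos (hle a)
  have hD0 : ∀ a, 0 < D a := fun a => Real.sqrt_pos.2 (hch a)
  have hD2 : ∀ a, D a ^ 2 = k.choose a := fun a => Real.sq_sqrt (hch a).le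
  set Cm := M * Matrix.diagonal (fun a => ((D a)⁻¹ : ℂ)) with hCm
  have hdC : Cm.det ≠ 0 := by
    rw [hCm, Matrix.det_mul, Matrix.det_diagonal]
    refine mul_ne_zero hdet (Finset.prod_ne_zero_iff.2 fun a _ => inv_ne_zero ?_)
    exact_mod_cast (hD0 a).ne'
  have hCu : IsUnit Cm := (Matrix.isUnit_iff_isUnit_det _).2 (isUnit_iff_ne_zero.2 hdC)
  have hPD : (Cmᴴ * Cm).PosDef := Matrix.PosDef.conjTranspose_mul_self Cm
    (Matrix.mulVec_injective_iff_isUnit.2 hCu)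
  have hH := hPD.1
  set U : Matrix (Fin (k + 1)) (Fin (k + 1)) ℂ := hH.eigenvectorUnitary.1 with hU
  set ev := hH.eigenvalues with hev
  have hev0 : ∀ i, 0 < ev i := fun i => hPD.eigenvalues_pos i
  have hUU : U * Uᴴ = 1 := by
    have := hH.eigenvectorUnitary.2
    exact (Matrix.mem_unitaryGroup_iff).1 this
  have hUU' : Uᴴ * U = 1 := by
    have := hH.eigenvectorUnitary.2
    exact (Matrix.mem_unitaryGroup_iff').1 this
  have hspec : Cmᴴ * Cm = U * Matrix.diagonal (fun i => (ev i : ℂ)) * Uᴴ := by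
    have := hH.spectral_theorem
    rw [Unitary.conjStarAlgAut_apply] at this
    exact this
  set m : ℂ → Fin (k + 1) → ℂ := fun z a => D a * z ^ (a : ℕ) with hm
  set p : Fin (k + 1) → Polynomial ℂ := fun i =>
    ∑ a : Fin (k + 1), Polynomial.C ((starRingEnd ℂ) (U a i) * D a) * Polynomial.X ^ (a : ℕ) with hp
  have hpe : ∀ i z, (p i).eval z = ∑ a : Fin (k + 1), ((starRingEnd ℂ) (U a i) * D a) * z ^ (a : ℕ) := by
    intro i z
    simp only [hp, Polynomial.eval_finsetSum, Polynomial.eval_mul, Polynomial.eval_C,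
      Polynomial.eval_pow, Polynomial.eval_X]
  have hpm : ∀ i z, (p i).eval z = (Uᴴ *ᵥ m z) i := by
    intro i z
    rw [hpe]
    simp only [Matrix.mulVec, dotProduct, hm, Matrix.conjTranspose_apply, RCLike.star_def]
    exact Finset.sum_congr rfl fun a _ => by ring
  have hse : ∀ j z, (s j).eval z = (Cm *ᵥ m z) j := by
    intro j z
    rw [Polynomial.eval_eq_sum_range' (Nat.lt_succ_of_le (hs j)),
      ← Fin.sum_univ_eq_sum_range (fun a => (s j).coeff a * z ^ a)]
    simp only [Matrix.mulVec, dotProduct, hm, hCm, Matrix.mul_diagonal, hM, Matrix.of_apply]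
    refine Finset.sum_congr rfl fun a _ => ?_
    have : (D a : ℂ) ≠ 0 := by exact_mod_cast (hD0 a).ne'
    field_simp
  have hp1 : ∀ z, pS p (fun _ => 1) z = (1 + ‖z‖ ^ 2) ^ k := by
    intro z
    unfold pS
    apply Complex.ofReal_injective
    have h1 := unit_sum Uᴴ (m z)
    rw [Matrix.conjTranspose_conjTranspose, hUU, Matrix.one_mulVec] at h1
    simp_rw [one_mul, hpm]
    rw [h1, add_comm (1 : ℝ) (‖z‖ ^ 2), add_pow, dotProduct,
      ← Fin.sum_univ_eq_sum_range (fun a => (‖z‖ ^ 2) ^ a * 1 ^ (k - a) * (k.choose a : ℝ))]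
    push_cast
    refine Finset.sum_congr rfl fun a _ => ?_
    rw [Pi.star_apply, RCLike.star_def, Complex.conj_mul']
    simp only [hm]
    rw [norm_mul, Complex.norm_real, Real.norm_of_nonneg (hD0 a).le, norm_pow, Complex.ofReal_mul,
      mul_pow]
    have := congrArg (fun x : ℝ => (x : ℂ)) (hD2 a)
    simp only [Complex.ofReal_pow, Complex.ofReal_natCast] at this
    rw [this]; push_cast; ring
  have hpS : ∀ z, ∑ j, ‖(s j).eval z‖ ^ 2 = pS p ev z := by
    intro z
    apply Complex.ofReal_injective
    simp_rw [hse]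
    rw [unit_sum, hspec]
    unfold pS
    rw [← Matrix.mulVec_mulVec, ← Matrix.mulVec_mulVec, Matrix.dotProduct_mulVec, ← star_star U,
      ← Matrix.star_eq_conjTranspose, star_star, show star (m z) ᵥ* U = star (Uᴴ *ᵥ m z) by
        rw [Matrix.star_mulVec, Matrix.conjTranspose_conjTranspose]]
    rw [dotProduct]
    push_cast
    refine Finset.sum_congr rfl fun i _ => ?_
    rw [Pi.star_apply, RCLike.star_def, Matrix.mulVec_diagonal, ← hpm, ← Complex.conj_mul']
    rw [Matrix.star_eq_conjTranspose, ← hpm]; ring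
  have hpi := fun i => poly_int (fun a => (starRingEnd ℂ) (U a i) * D a)
  have hItg : ∀ i, Integrable (fun z : ℂ => ‖(p i).eval z‖ ^ 2 * ((1 + ‖z‖ ^ 2) ^ (k + 2))⁻¹) := by
    intro i; simp_rw [hpe]; exact (hpi i).1
  have hval : ∀ i, ∫ z : ℂ, ‖(p i).eval z‖ ^ 2 * ((1 + ‖z‖ ^ 2) ^ (k + 2))⁻¹ = Real.pi / (k + 1) := by
    intro i; simp_rw [hpe]; rw [(hpi i).2]
    have h1 : ∑ a, ‖U a i‖ ^ 2 = 1 := by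
      have := congrFun (congrFun hUU' i) i
      rw [Matrix.mul_apply, Matrix.one_apply_eq] at this
      simp_rw [Matrix.conjTranspose_apply, RCLike.star_def, Complex.conj_mul'] at this
      exact_mod_cast this
    rw [← one_mul (Real.pi / (k + 1)), ← h1, Finset.sum_mul]
    refine Finset.sum_congr rfl fun a _ => ?_
    rw [norm_mul, RCLike.norm_conj, Complex.norm_real, Real.norm_of_nonneg (hD0 a).le, mul_pow, hD2]
    have := hch a
    field_simp
  have hom : omt (fun i => Real.log (ev i)) 1 = ev := by
    ext i; simp only [omt, one_mul]; exact Real.exp_log (hev0 i)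
  have hmain := star1 p (fun i => Real.log (ev i)) hk hp1 hItg hval
  rw [hom] at hmain
  have heF : eF p ev (3 / (k : ℝ)) = fun z => (∑ j, ‖(s j).eval z‖ ^ 2) ^ (-(3 / (k : ℝ))) := by
    ext z; unfold eF; rw [hpS]
  rw [heF] at hmain
  have hlog : ∑ i, Real.log (ev i) = Real.log (‖M.det‖ ^ 2 / ∏ a : Fin (k + 1), (k.choose a : ℝ)) := by
    rw [← Real.log_prod (fun i _ => (hev0 i).ne')]
    congr 1
    have h1 := hH.det_eq_prod_eigenvalues
    rw [Matrix.det_mul, Matrix.det_conjTranspose, RCLike.star_def, Complex.conj_mul'] at h1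
    have h2 : ‖Cm.det‖ ^ 2 = ∏ i, ev i := by
      apply Complex.ofReal_injective
      push_cast
      exact h1
    rw [← h2, hCm, Matrix.det_mul, Matrix.det_diagonal, norm_mul, norm_prod, mul_pow, div_eq_mul_inv,
      ← Finset.prod_pow, ← Finset.prod_inv_distrib]
    congr 1
    refine Finset.prod_congr rfl fun a _ => ?_
    rw [norm_inv, Complex.norm_real, Real.norm_of_nonneg (hD0 a).le, inv_pow, hD2]
  rw [hlog] at hmain
  exact hmain

noncomputable def w0 (z : ℂ) : ℝ := Real.pi⁻¹ * ((1 + ‖z‖ ^ 2) ^ 2)⁻¹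

lemma w0_pos (z : ℂ) : 0 < w0 z := by unfold w0; have := Real.pi_pos; positivity

lemma continuous_w0 : Continuous w0 := by
  unfold w0
  refine continuous_const.mul (Continuous.inv₀ (by fun_prop) fun z => by positivity)

lemma integrable_w0 : Integrable w0 := integrable_base.const_mul _

lemma integral_w0 : ∫ z, w0 z = 1 := by
  unfold w0
  rw [integral_const_mul]
  have := Ik_zero 0
  unfold Ik at this
  simp only [pow_zero, one_mul, Nat.cast_zero, zero_add, div_one] at this
  rw [this, inv_mul_cancel₀ Real.pi_ne_zero]

/-- change of variables by a Möbius map preserving the sphere measure -/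
lemma mobius_cov (α β : ℂ) (hab : α ≠ 0 ∨ β ≠ 0) (h : ℂ → ℂ) :
    ∫ z, h ((α * z + β) / (-(starRingEnd ℂ β) * z + starRingEnd ℂ α)) * w0 z = ∫ z, h z * w0 z := by
  obtain ⟨n, hn⟩ : ∃ n : ℝ, n = Complex.normSq α + Complex.normSq β := ⟨_, rfl⟩
  have hn0 : 0 < n := by
    rcases hab with h | h
    · have := Complex.normSq_pos.2 h; have := Complex.normSq_nonneg β; linarith
    · have := Complex.normSq_pos.2 h; have := Complex.normSq_nonneg α; linarith
  have hnc : (n : ℂ) = α * starRingEnd ℂ α + β * starRingEnd ℂ β := by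
    rw [Complex.mul_conj, Complex.mul_conj, hn]; push_cast; rfl
  have hnc0 : (n : ℂ) ≠ 0 := by exact_mod_cast hn0.ne'
  set den : ℂ → ℂ := fun z => -(starRingEnd ℂ β) * z + starRingEnd ℂ α with hden
  set g : ℂ → ℂ := fun z => (α * z + β) / den z with hg
  set s : Set ℂ := {z | den z ≠ 0} with hs
  have hsub : ∀ a b : ℂ, (a ≠ 0 ∨ b ≠ 0) → volume {z : ℂ | a * z + b = 0} = 0 := by
    intro a b hab
    refine Set.Subsingleton.measure_zero ?_ _
    intro x hx y hy
    simp only [Set.mem_setOf_eq] at hx hy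
    by_cases ha : a = 0
    · subst ha; simp_all
    · exact mul_left_cancel₀ ha (by linear_combination hx - hy)
  have hs0 : volume sᶜ = 0 := by
    have : sᶜ = {z : ℂ | -(starRingEnd ℂ β) * z + starRingEnd ℂ α = 0} := by
      ext z; simp [hs, hden]
    rw [this]
    apply hsub
    rcases hab with h | h
    · right; simpa using h
    · left; simpa using h
  have hsm : MeasurableSet s := by
    have : IsOpen s := isOpen_ne_fun (by fun_prop) continuous_const
    exact this.measurableSet
  have hgd : ∀ z ∈ s, HasDerivAt g (n / den z ^ 2) z := by
    intro z hz
    have h1 : HasDerivAt (fun z => α * z + β) α z := by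
      simpa using ((hasDerivAt_id z).const_mul α).add_const β
    have h2 : HasDerivAt den (-(starRingEnd ℂ β)) z := by
      exact (((hasDerivAt_id z).const_mul (-(starRingEnd ℂ β))).add_const
        (starRingEnd ℂ α)).congr_deriv (mul_one _)
    refine (h1.div h2 hz).congr_deriv ?_
    rw [hnc]; congr 1; simp only [hden]; ring
  have hinj : Set.InjOn g s := by
    intro x hx y hy hxy
    simp only [hg] at hxy
    rw [div_eq_div_iff hx hy] at hxy
    simp only [hden] at hxy
    refine mul_left_cancel₀ hnc0 ?_
    rw [hnc]
    linear_combination hxy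
  have hdet : ∀ c : ℂ, ((ContinuousLinearMap.toSpanSingleton ℂ c).restrictScalars ℝ).det = ‖c‖ ^ 2 := by
    intro c
    rw [← Complex.normSq_eq_norm_sq, ← Algebra.norm_complex_apply]
    have : (((ContinuousLinearMap.toSpanSingleton ℂ c).restrictScalars ℝ : ℂ →L[ℝ] ℂ) : ℂ →ₗ[ℝ] ℂ) =
      (((ContinuousLinearMap.toSpanSingleton ℂ c : ℂ →L[ℂ] ℂ) : ℂ →ₗ[ℂ] ℂ)).restrictScalars ℝ := rfl
    rw [ContinuousLinearMap.det, this, LinearMap.det_restrictScalars]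
    simp
  have cov := integral_image_eq_integral_abs_det_fderiv_smul volume hsm
    (fun z hz => ((hgd z hz).hasFDerivAt.restrictScalars ℝ).hasFDerivWithinAt) hinj
    (fun z => h z * (w0 z : ℂ))
  have hl : ∫ z in g '' s, h z * (w0 z : ℂ) = ∫ z, h z * (w0 z : ℂ) := by
    refine Eq.trans ?_ setIntegral_univ
    refine setIntegral_congr_set (ae_eq_univ.2 ?_)
    refine measure_mono_null ?_ (hsub (starRingEnd ℂ β) α ?_)
    · intro w hw
      by_contra hne
      refine hw ⟨(starRingEnd ℂ α * w - β) / (starRingEnd ℂ β * w + α), ?_, ?_⟩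
      · simp only [hs, hden, Set.mem_setOf_eq]
        have hne' : starRingEnd ℂ β * w + α ≠ 0 := hne
        rw [show -(starRingEnd ℂ) β * (((starRingEnd ℂ) α * w - β) / ((starRingEnd ℂ) β * w + α)) +
          (starRingEnd ℂ) α = n / ((starRingEnd ℂ) β * w + α) by rw [hnc]; field_simp; ring]
        exact div_ne_zero hnc0 hne'
      · have hne' : starRingEnd ℂ β * w + α ≠ 0 := hne
        simp only [hg, hden]
        rw [show -(starRingEnd ℂ) β * (((starRingEnd ℂ) α * w - β) / ((starRingEnd ℂ) β * w + α)) +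
          (starRingEnd ℂ) α = n / ((starRingEnd ℂ) β * w + α) by rw [hnc]; field_simp; ring]
        rw [show α * (((starRingEnd ℂ) α * w - β) / ((starRingEnd ℂ) β * w + α)) + β =
          n * w / ((starRingEnd ℂ) β * w + α) by
            rw [hnc, mul_div_assoc', div_add' _ _ _ hne']; congr 1; ring]
        rw [div_div_div_cancel_right₀ hne', mul_div_cancel_left₀ _ hnc0]
    · rcases hab with h | h
      · exact Or.inr h
      · left; simpa using h
  have hr : ∫ z in s, h (g z) * (w0 z : ℂ) = ∫ z, h (g z) * (w0 z : ℂ) := by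
    refine Eq.trans ?_ setIntegral_univ
    exact setIntegral_congr_set (ae_eq_univ.2 hs0)
  rw [← hl, cov, ← hr]
  refine setIntegral_congr_fun hsm fun z hz => ?_
  have hz' : den z ≠ 0 := hz
  have hzn : 0 < ‖den z‖ := norm_pos_iff.2 hz'
  have h1 : 1 + ‖g z‖ ^ 2 = n * (1 + ‖z‖ ^ 2) / ‖den z‖ ^ 2 := by
    simp only [hg]
    rw [norm_div, div_pow, eq_div_iff (by positivity), add_mul, div_mul_cancel₀ _ (by positivity)]
    rw [← Complex.normSq_eq_norm_sq, ← Complex.normSq_eq_norm_sq, ← Complex.normSq_eq_norm_sq, hn]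
    simp only [hden, Complex.normSq_apply, Complex.add_re, Complex.mul_re, Complex.add_im,
      Complex.mul_im, Complex.neg_re, Complex.neg_im, Complex.conj_re, Complex.conj_im]
    ring
  have h2 : ‖(n : ℂ) / den z ^ 2‖ ^ 2 * w0 (g z) = w0 z := by
    unfold w0
    rw [h1, norm_div, norm_pow, Complex.norm_real, Real.norm_of_nonneg hn0.le]
    have := Real.pi_pos
    field_simp
  rw [hdet, abs_of_nonneg (by positivity), ← h2, Complex.real_smul]
  push_cast
  ring

noncomputable def stereo (z : ℂ) : E3 :=
  !₂[2 * z.re / (1 + ‖z‖ ^ 2), 2 * z.im / (1 + ‖z‖ ^ 2), (‖z‖ ^ 2 - 1) / (1 + ‖z‖ ^ 2)]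

lemma stereo_cont : Continuous stereo := by
  unfold stereo
  refine (PiLp.continuous_toLp 2 _).comp (continuous_pi fun i => ?_)
  have h : ∀ z : ℂ, 1 + ‖z‖ ^ 2 ≠ 0 := fun z => by positivity
  fin_cases i
  · exact Continuous.div (by fun_prop) (by fun_prop) h
  · exact Continuous.div (by fun_prop) (by fun_prop) h
  · exact Continuous.div (by fun_prop) (by fun_prop) h

lemma E3_inner (x y : E3) : inner ℝ x y = x 0 * y 0 + x 1 * y 1 + x 2 * y 2 := by
  rw [PiLp.inner_apply, Fin.sum_univ_three]; simp; ring

lemma E3_norm_sq (x : E3) : ‖x‖ ^ 2 = x 0 ^ 2 + x 1 ^ 2 + x 2 ^ 2 := by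
  rw [← real_inner_self_eq_norm_sq, E3_inner]; ring

lemma stereo_norm (z : ℂ) : ‖stereo z‖ = 1 := by
  have : ‖stereo z‖ ^ 2 = 1 := by
    rw [E3_norm_sq]
    simp only [stereo, PiLp.toLp_apply, Matrix.cons_val_zero, Matrix.cons_val_one, Matrix.cons_val]
    have h := Complex.sq_norm z
    rw [Complex.normSq_apply] at h
    have h0 : 1 + ‖z‖ ^ 2 ≠ 0 := by positivity
    field_simp
    rw [h]; ring
  nlinarith [norm_nonneg (stereo z)]

lemma stereo_inner (z : ℂ) (y : E3) : inner ℝ (stereo z) y =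
    (2 * (z.re * y 0 + z.im * y 1) + (‖z‖ ^ 2 - 1) * y 2) / (1 + ‖z‖ ^ 2) := by
  rw [E3_inner]
  simp only [stereo, PiLp.toLp_apply, Matrix.cons_val_zero, Matrix.cons_val_one, Matrix.cons_val]
  ring

noncomputable def nu0 : Measure ℂ := volume.withDensity (fun z => ENNReal.ofReal (w0 z))

lemma integral_nu0 (f : ℂ → ℂ) : ∫ z, f z ∂nu0 = ∫ z, f z * w0 z := by
  unfold nu0
  rw [integral_withDensity_eq_integral_toReal_smul (by exact continuous_w0.measurable.ennreal_ofReal)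
    (Filter.Eventually.of_forall fun z => ENNReal.ofReal_lt_top)]
  refine integral_congr_ae (Filter.Eventually.of_forall fun z => ?_)
  simp only [ENNReal.toReal_ofReal (w0_pos z).le, Complex.real_smul]
  ring

lemma integral_nu0_real (f : ℂ → ℝ) : ∫ z, f z ∂nu0 = ∫ z, f z * w0 z := by
  unfold nu0
  rw [integral_withDensity_eq_integral_toReal_smul (by exact continuous_w0.measurable.ennreal_ofReal)
    (Filter.Eventually.of_forall fun z => ENNReal.ofReal_lt_top)]
  refine integral_congr_ae (Filter.Eventually.of_forall fun z => ?_)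
  simp only [ENNReal.toReal_ofReal (w0_pos z).le, smul_eq_mul]
  ring

instance nu0_prob : IsProbabilityMeasure nu0 := by
  constructor
  unfold nu0
  rw [withDensity_apply _ MeasurableSet.univ, Measure.restrict_univ,
    ← ofReal_integral_eq_lintegral_ofReal integrable_w0
      (Filter.Eventually.of_forall fun z => (w0_pos z).le), integral_w0, ENNReal.ofReal_one]

instance map_prob : IsProbabilityMeasure (nu0.map stereo) :=
  Measure.isProbabilityMeasure_map stereo_cont.measurable.aemeasurable

lemma charFun_nu (y : E3) : charFun (nu0.map stereo) y =
    ∫ z : ℂ, Complex.exp (((2 * (z.re * y 0 + z.im * y 1) + (‖z‖ ^ 2 - 1) * y 2) /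
      (1 + ‖z‖ ^ 2) : ℝ) * Complex.I) * w0 z := by
  rw [charFun_apply, integral_map stereo_cont.measurable.aemeasurable (by fun_prop), integral_nu0]
  simp_rw [stereo_inner]

lemma charFun_nu_radial (y : E3) : charFun (nu0.map stereo) y =
    ∫ z : ℂ, Complex.exp ((((‖z‖ ^ 2 - 1) * ‖y‖) / (1 + ‖z‖ ^ 2) : ℝ) * Complex.I) * w0 z := by
  rw [charFun_nu]
  set r := ‖y‖ with hr
  have hr2 : r ^ 2 = y 0 ^ 2 + y 1 ^ 2 + y 2 ^ 2 := E3_norm_sq y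
  have hr0 : 0 ≤ r := norm_nonneg y
  by_cases hc : r + y 2 = 0
  · have h0 : y 0 = 0 := by
      have : y 2 = -r := by linarith
      rw [this] at hr2; nlinarith [sq_nonneg (y 0), sq_nonneg (y 1)]
    have h1 : y 1 = 0 := by
      have : y 2 = -r := by linarith
      rw [this] at hr2; nlinarith [sq_nonneg (y 0), sq_nonneg (y 1)]
    have h2 : y 2 = -r := by linarith
    rw [← mobius_cov 0 1 (Or.inr one_ne_zero)]
    refine integral_congr_ae ?_
    have : ∀ᵐ z : ℂ, z ≠ 0 := by
      refine (measure_eq_zero_iff_ae_notMem).1 (measure_singleton (0 : ℂ))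
    filter_upwards [this] with z hz
    congr 4
    rw [h0, h1, h2]
    simp only [map_one, map_zero, zero_mul, zero_add, add_zero, norm_div, norm_one, norm_mul, norm_neg, one_mul]
    have := norm_pos_iff.2 hz
    field_simp
    ring
  · set α : ℂ := ((r + y 2 : ℝ) : ℂ) with hα
    set β : ℂ := ⟨-(y 0), -(y 1)⟩ with hβ
    have hα0 : α ≠ 0 := by rw [hα]; exact_mod_cast hc
    rw [← mobius_cov α β (Or.inl hα0)]
    refine integral_congr_ae ?_
    have : ∀ᵐ z : ℂ, -(starRingEnd ℂ β) * z + starRingEnd ℂ α ≠ 0 := by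
      refine (measure_eq_zero_iff_ae_notMem (s := {z : ℂ | -(starRingEnd ℂ β) * z + starRingEnd ℂ α = 0})).1 ?_
      refine Set.Subsingleton.measure_zero ?_ _
      intro x hx y' hy
      simp only [Set.mem_setOf_eq] at hx hy
      by_cases ha : -(starRingEnd ℂ β) = 0
      · rw [ha] at hx; simp_all
      · exact mul_left_cancel₀ ha (by linear_combination hx - hy)
    filter_upwards [this] with z hz
    congr 4
    set d := -(starRingEnd ℂ β) * z + starRingEnd ℂ α with hd
    set nm := α * z + β with hnm
    have hd2 : 0 < ‖d‖ ^ 2 := by have := norm_pos_iff.2 hz; positivity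
    have hdn := Complex.sq_norm d
    have hre : (nm / d).re = (nm.re * d.re + nm.im * d.im) / ‖d‖ ^ 2 := by
      rw [Complex.div_re, ← hdn]; ring
    have him : (nm / d).im = (nm.im * d.re - nm.re * d.im) / ‖d‖ ^ 2 := by
      rw [Complex.div_im, ← hdn]; ring
    rw [hre, him, norm_div, div_pow]
    have hnn : ‖nm‖ ^ 2 = nm.re * nm.re + nm.im * nm.im := by
      rw [Complex.sq_norm, Complex.normSq_apply]
    have hdd : ‖d‖ ^ 2 = d.re * d.re + d.im * d.im := by
      rw [Complex.sq_norm, Complex.normSq_apply]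
    have hzz : ‖z‖ ^ 2 = z.re * z.re + z.im * z.im := by
      rw [Complex.sq_norm, Complex.normSq_apply]
    have h3 : ∀ a b c dd : ℝ, 0 < dd → (2 * (a / dd * y 0 + b / dd * y 1) + (c / dd - 1) * y 2) /
        (1 + c / dd) = (2 * (a * y 0 + b * y 1) + (c - dd) * y 2) / (dd + c) := by
      intro a b c dd hdd
      rw [← mul_div_mul_left _ _ hdd.ne']
      congr 1 <;> field_simp
    rw [h3 _ _ _ _ hd2]
    have e1 : nm.re = (r + y 2) * z.re - y 0 := by simp [hnm, hα, hβ]; ring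
    have e2 : nm.im = (r + y 2) * z.im - y 1 := by simp [hnm, hα, hβ]; ring
    have e3 : d.re = y 0 * z.re + y 1 * z.im + (r + y 2) := by simp [hd, hα, hβ]; ring
    have e4 : d.im = y 0 * z.im - y 1 * z.re := by simp [hd, hα, hβ]; ring
    have hK : 2 * r * (r + y 2) ≠ 0 := by
      refine mul_ne_zero (mul_ne_zero two_ne_zero ?_) hc
      intro hr00
      apply hc
      rw [hr00] at hr2 ⊢
      nlinarith [sq_nonneg (y 0), sq_nonneg (y 1), sq_nonneg (y 2)]
    rw [hnn, hdd, hzz, e1, e2, e3, e4, ← mul_div_mul_left ((z.re * z.re + z.im * z.im - 1) * r) _ hK]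
    congr 1
    · linear_combination (-(2 * r + y 2) * (z.re * z.re + z.im * z.im - 1) +
        2 * (y 0 * z.re + y 1 * z.im)) * hr2
    · linear_combination (-(1 + (z.re * z.re + z.im * z.im))) * hr2

lemma charFun_sigma (σ : Measure E3) (hσinv : ∀ R : E3 ≃ₗᵢ[ℝ] E3, σ.map R = σ) (x y : E3)
    (h : ‖x‖ = ‖y‖) : charFun σ x = charFun σ y := by
  set R : E3 ≃ₗᵢ[ℝ] E3 := Submodule.reflection (ℝ ∙ (x - y))ᗮ with hR
  have hRx : R x = y := Submodule.reflection_sub h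
  rw [← hRx]
  conv_rhs => rw [← hσinv R]
  rw [charFun_apply, charFun_apply, integral_map (by fun_prop) (by fun_prop)]
  simp_rw [LinearIsometryEquiv.inner_map_map]

lemma eq_of_radial (σ τ : Measure E3) [IsProbabilityMeasure σ] [IsProbabilityMeasure τ]
    (hσ : ∀ᵐ x ∂σ, ‖x‖ = 1) (hτ : ∀ᵐ x ∂τ, ‖x‖ = 1)
    (h1 : ∀ x y : E3, ‖x‖ = ‖y‖ → charFun σ x = charFun σ y)
    (h2 : ∀ x y : E3, ‖x‖ = ‖y‖ → charFun τ x = charFun τ y) : σ = τ := by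
  apply Measure.ext_of_charFun
  ext t
  have hItg : Integrable (fun p : E3 × E3 => Complex.exp ((inner ℝ p.1 (‖t‖ • p.2) : ℝ) * Complex.I))
      (σ.prod τ) := by
    refine Integrable.of_bound (C := 1) (by fun_prop) (Filter.Eventually.of_forall fun p => ?_)
    rw [Complex.norm_exp_ofReal_mul_I]
  have e1 : ∫ y, ∫ x, Complex.exp ((inner ℝ x (‖t‖ • y) : ℝ) * Complex.I) ∂σ ∂τ = charFun σ t := by
    rw [integral_congr_ae (g := fun _ => charFun σ t)]
    · simp
    · filter_upwards [hτ] with y hy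
      rw [← h1 (‖t‖ • y) t (by rw [norm_smul, hy]; simp), charFun_apply]
  have e2 : ∫ x, ∫ y, Complex.exp ((inner ℝ x (‖t‖ • y) : ℝ) * Complex.I) ∂τ ∂σ = charFun τ t := by
    rw [integral_congr_ae (g := fun _ => charFun τ t)]
    · simp
    · filter_upwards [hσ] with x hx
      rw [← h2 (‖t‖ • x) t (by rw [norm_smul, hx]; simp), charFun_apply]
      refine integral_congr_ae (Filter.Eventually.of_forall fun y => ?_)
      simp only [inner_smul_right, real_inner_comm]
  rw [← e1, ← e2]
  exact (integral_integral_swap hItg).symm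

theorem sigma_eq (σ : Measure E3) (hσ1 : IsProbabilityMeasure σ)
    (hσs : σ (Metric.sphere (0 : E3) 1) = 1)
    (hσinv : ∀ R : E3 ≃ₗᵢ[ℝ] E3, σ.map R = σ) : σ = nu0.map stereo := by
  refine eq_of_radial σ _ ?_ ?_ (charFun_sigma σ hσinv) (fun x y h => by
    rw [charFun_nu_radial, charFun_nu_radial, h])
  · have := (prob_compl_eq_zero_iff (μ := σ) Metric.isClosed_sphere.measurableSet).2 hσs
    rw [measure_eq_zero_iff_ae_notMem] at this
    filter_upwards [this] with x hx
    simpa using hx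
  · rw [ae_map_iff stereo_cont.measurable.aemeasurable (measurableSet_eq_fun (by fun_prop) (by fun_prop))]
    exact Filter.Eventually.of_forall stereo_norm

lemma gibbs {α : Type*} [MeasurableSpace α] (μ σ : Measure α) [IsProbabilityMeasure μ]
    [IsProbabilityMeasure σ] (hac : μ ≪ σ) (hItg : Integrable (llr μ σ) μ)
    {w : α → ℝ} (hw : Integrable w μ) (he : Integrable (fun x => Real.exp (w x)) σ) :
    ∫ x, w x ∂μ - Real.log (∫ x, Real.exp (w x) ∂σ) ≤ ∫ x, llr μ σ x ∂μ := by
  have h1 := integral_llr_tilted_right hac hw he hItg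
  have hp : IsProbabilityMeasure (σ.tilted w) := isProbabilityMeasure_tilted he
  have h2 := InformationTheory.integral_llr_add_sub_measure_univ_nonneg (μ := μ) (ν := σ.tilted w)
    (hac.trans (absolutelyContinuous_tilted he)) (integrable_llr_tilted_right hac hw hItg he)
  simp only [probReal_univ] at h2
  linarith

noncomputable def proj (x : E3) : ℂ := ⟨x 0 / (1 - x 2), x 1 / (1 - x 2)⟩

lemma measurable_proj : Measurable proj := by
  have : proj = fun x : E3 => ((x 0 / (1 - x 2) : ℝ) : ℂ) + ((x 1 / (1 - x 2) : ℝ) : ℂ) * Complex.I := by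
    ext x
    apply Complex.ext <;> simp only [proj, Complex.add_re, Complex.add_im, Complex.re_ofReal_mul,
      Complex.im_ofReal_mul, Complex.ofReal_re, Complex.ofReal_im, Complex.I_re, Complex.I_im] <;> ring
  rw [this]
  have h : ∀ i : Fin 3, Measurable (fun x : E3 => x i) := fun i => by fun_prop
  have h0 := h 0
  have h1 := h 1
  have h2 := h 2
  exact (Complex.measurable_ofReal.comp (h0.div (measurable_const.sub h2))).add
    ((Complex.measurable_ofReal.comp (h1.div (measurable_const.sub h2))).mul_const _)

lemma stereo_0 (z : ℂ) : stereo z 0 = 2 * z.re / (1 + ‖z‖ ^ 2) := rfl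
lemma stereo_1 (z : ℂ) : stereo z 1 = 2 * z.im / (1 + ‖z‖ ^ 2) := rfl
lemma stereo_2 (z : ℂ) : stereo z 2 = (‖z‖ ^ 2 - 1) / (1 + ‖z‖ ^ 2) := rfl

lemma proj_stereo (z : ℂ) : proj (stereo z) = z := by
  have h0 : 1 + ‖z‖ ^ 2 ≠ 0 := by positivity
  unfold proj
  rw [stereo_0, stereo_1, stereo_2]
  apply Complex.ext
  · simp only
    rw [one_sub_div h0]; field_simp; ring
  · simp only
    rw [one_sub_div h0]; field_simp; ring

lemma mu_eq (μ : Measure E3) (hac : μ ≪ nu0.map stereo) : (μ.map proj).map stereo = μ := by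
  rw [Measure.map_map stereo_cont.measurable measurable_proj]
  have : stereo ∘ proj =ᵐ[μ] id := by
    refine hac.ae_le ?_
    have hm : MeasurableSet {x : E3 | (stereo ∘ proj) x = id x} :=
      measurableSet_eq_fun (stereo_cont.measurable.comp measurable_proj) measurable_id
    refine (ae_map_iff stereo_cont.measurable.aemeasurable hm).2 ?_
    exact Filter.Eventually.of_forall fun z => by simp [proj_stereo]
  rw [Measure.map_congr this, Measure.map_id]

lemma gibbsC (μ : Measure E3) [IsProbabilityMeasure μ] (hac : μ ≪ nu0.map stereo)
    (hItg : Integrable (llr μ (nu0.map stereo)) μ) {W : ℂ → ℝ} (hW : Measurable W) {C : ℝ}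
    (hC : ∀ z, |W z| ≤ C) :
    ∫ z, W z ∂(μ.map proj) - Real.log (∫ z, Real.exp (W z) ∂nu0) ≤
      ∫ x, llr μ (nu0.map stereo) x ∂μ := by
  have hm : Measurable (fun x => W (proj x)) := hW.comp measurable_proj
  have h := gibbs μ (nu0.map stereo) hac hItg (w := fun x => W (proj x))
    (Integrable.of_bound hm.aestronglyMeasurable C (Filter.Eventually.of_forall fun x => hC _))
    (Integrable.of_bound (Real.measurable_exp.comp hm).aestronglyMeasurable (Real.exp C)
      (Filter.Eventually.of_forall fun x => by
        rw [Real.norm_of_nonneg (Real.exp_pos _).le]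
        exact Real.exp_le_exp.2 ((le_abs_self _).trans (hC _))))
  have hem : Measurable (fun x => Real.exp (W (proj x))) := Real.measurable_exp.comp hm
  rw [integral_map stereo_cont.measurable.aemeasurable hem.aestronglyMeasurable] at h
  simp only [proj_stereo] at h
  rw [integral_map measurable_proj.aemeasurable hW.aestronglyMeasurable]
  exact h

lemma log_chord {A c : ℝ} (hc : 0 ≤ c) (hA : c < A) :
    ∃ m : ℝ, ∀ t, |t| ≤ c → (1 / 2) * Real.log (A ^ 2 - c ^ 2) + m * t ≤ Real.log (A + t) := by
  have e : Real.log (A ^ 2 - c ^ 2) = Real.log (A + c) + Real.log (A - c) := by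
    rw [← Real.log_mul (by linarith) (by linarith)]; congr 1; ring
  rcases hc.eq_or_lt with h0 | h0
  · refine ⟨0, fun t ht => ?_⟩
    have : t = 0 := by rw [← h0] at ht; exact abs_nonpos_iff.1 ht
    rw [e, this, ← h0]; simp
    linarith
  · refine ⟨(Real.log (A + c) - Real.log (A - c)) / (2 * c), fun t ht => ?_⟩
    have ht' := abs_le.1 ht
    have hcv := strictConcaveOn_log_Ioi.concaveOn
    have hx : A + c ∈ Set.Ioi (0 : ℝ) := by simp only [Set.mem_Ioi]; linarith
    have hy : A - c ∈ Set.Ioi (0 : ℝ) := by simp only [Set.mem_Ioi]; linarith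
    have ha : 0 ≤ (c + t) / (2 * c) := div_nonneg (by linarith) (by linarith)
    have hb : 0 ≤ (c - t) / (2 * c) := div_nonneg (by linarith) (by linarith)
    have := hcv.2 hx hy ha hb (by field_simp; ring)
    simp only [smul_eq_mul] at this
    rw [show (c + t) / (2 * c) * (A + c) + (c - t) / (2 * c) * (A - c) = A + t by
      field_simp; ring] at this
    refine le_trans (le_of_eq ?_) this
    rw [e]; field_simp; ring

/-- the centred Gibbs inequality -/
lemma centered (μ : Measure E3) [IsProbabilityMeasure μ] (hac : μ ≪ nu0.map stereo)
    (hItg : Integrable (llr μ (nu0.map stereo)) μ) (h0 : ∫ x, x ∂μ = 0)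
    {U : ℂ → ℝ} (hU : Measurable U) {C : ℝ} (hC : ∀ z, |U z| ≤ C) {A : ℝ} {B : E3}
    (hA : ∫ z, Real.exp (U z) ∂nu0 = A) (hB : ∀ i, ∫ z, stereo z i * Real.exp (U z) ∂nu0 = B i)
    (hAB : ‖B‖ < A) :
    ∫ z, U z ∂(μ.map proj) - (1 / 2) * Real.log (A ^ 2 - ‖B‖ ^ 2) ≤
      ∫ x, llr μ (nu0.map stereo) x ∂μ := by
  have hν : IsProbabilityMeasure (μ.map proj) :=
    Measure.isProbabilityMeasure_map measurable_proj.aemeasurable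
  set ν := μ.map proj with hνd
  obtain ⟨m, hm⟩ := log_chord (norm_nonneg B) hAB
  have hib : ∀ z, |inner ℝ B (stereo z)| ≤ ‖B‖ := fun z => by
    have := abs_real_inner_le_norm B (stereo z); rwa [stereo_norm, mul_one] at this
  have hpos : ∀ z, 0 < A - inner ℝ B (stereo z) := fun z => by
    have := (abs_le.1 (hib z)).2; linarith
  have hmeas : Measurable (fun z => inner ℝ B (stereo z)) :=
    (Continuous.inner continuous_const stereo_cont).measurable
  have hlm : Measurable (fun z => Real.log (A - inner ℝ B (stereo z))) :=
    Real.measurable_log.comp (measurable_const.sub hmeas)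
  have hlb : ∀ z, |Real.log (A - inner ℝ B (stereo z))| ≤ |Real.log (A - ‖B‖)| + |Real.log (A + ‖B‖)| := by
    intro z
    have h1 := (abs_le.1 (hib z))
    have l1 : Real.log (A - ‖B‖) ≤ Real.log (A - inner ℝ B (stereo z)) :=
      Real.log_le_log (by linarith) (by linarith)
    have l2 : Real.log (A - inner ℝ B (stereo z)) ≤ Real.log (A + ‖B‖) :=
      Real.log_le_log (hpos z) (by linarith)
    rw [abs_le]
    constructor
    · have := neg_abs_le (Real.log (A - ‖B‖)); have := abs_nonneg (Real.log (A + ‖B‖)); linarith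
    · have := le_abs_self (Real.log (A + ‖B‖)); have := abs_nonneg (Real.log (A - ‖B‖)); linarith
  have hg := gibbsC μ hac hItg (W := fun z => U z + Real.log (A - inner ℝ B (stereo z)))
    (hU.add hlm) (C := C + (|Real.log (A - ‖B‖)| + |Real.log (A + ‖B‖)|))
    (fun z => (abs_add_le _ _).trans (add_le_add (hC z) (hlb z)))
  have iU : Integrable U ν := Integrable.of_bound hU.aestronglyMeasurable C
    (Filter.Eventually.of_forall hC)
  have il : Integrable (fun z => Real.log (A - inner ℝ B (stereo z))) ν :=
    Integrable.of_bound hlm.aestronglyMeasurable _ (Filter.Eventually.of_forall hlb)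
  have ii : Integrable (fun z => inner ℝ B (stereo z)) ν :=
    Integrable.of_bound hmeas.aestronglyMeasurable _ (Filter.Eventually.of_forall hib)
  have iz : ∫ z, inner ℝ B (stereo z) ∂ν = 0 := by
    have ist : Integrable stereo ν := Integrable.of_bound stereo_cont.aestronglyMeasurable 1
      (Filter.Eventually.of_forall fun z => (stereo_norm z).le)
    have h2 : ∫ z, stereo z ∂ν = 0 := by
      have h5 := integral_map (μ := ν) stereo_cont.measurable.aemeasurable
        (f := fun x : E3 => x) (by fun_prop)
      rw [mu_eq μ hac, h0] at h5
      exact h5.symm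
    rw [integral_inner ist, h2, inner_zero_right]
  have h3 : (1 / 2) * Real.log (A ^ 2 - ‖B‖ ^ 2) ≤ ∫ z, Real.log (A - inner ℝ B (stereo z)) ∂ν := by
    have : ∫ z, ((1 / 2) * Real.log (A ^ 2 - ‖B‖ ^ 2) + (-m) * inner ℝ B (stereo z)) ∂ν ≤
        ∫ z, Real.log (A - inner ℝ B (stereo z)) ∂ν := by
      refine integral_mono ((integrable_const _).add (ii.const_mul _)) il fun z => ?_
      have := hm (-inner ℝ B (stereo z)) (by rw [abs_neg]; exact hib z)
      simp only [sub_eq_add_neg] at this ⊢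
      linarith
    rw [integral_add (integrable_const _) (ii.const_mul _), integral_const_mul (-m), iz] at this
    simpa using this
  have ieU : Integrable (fun z => Real.exp (U z)) nu0 :=
    Integrable.of_bound (Real.measurable_exp.comp hU).aestronglyMeasurable (Real.exp C)
      (Filter.Eventually.of_forall fun x => by
        rw [Real.norm_of_nonneg (Real.exp_pos _).le]
        exact Real.exp_le_exp.2 ((le_abs_self _).trans (hC _)))
  have iei : ∀ i, Integrable (fun z => stereo z i * Real.exp (U z)) nu0 := fun i => by
    refine Integrable.bdd_mul (c := 1) ieU ?_ (Filter.Eventually.of_forall fun z => ?_)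
    · have : Measurable (fun z => stereo z i) :=
        (by fun_prop : Measurable (fun x : E3 => x i)).comp stereo_cont.measurable
      exact this.aestronglyMeasurable
    · exact (PiLp.norm_apply_le (stereo z) i).trans (stereo_norm z).le
  have h4 : ∫ z, Real.exp (U z + Real.log (A - inner ℝ B (stereo z))) ∂nu0 = A ^ 2 - ‖B‖ ^ 2 := by
    have e : ∀ z, Real.exp (U z + Real.log (A - inner ℝ B (stereo z))) =
        A * Real.exp (U z) - (B 0 * (stereo z 0 * Real.exp (U z)) +
          B 1 * (stereo z 1 * Real.exp (U z)) + B 2 * (stereo z 2 * Real.exp (U z))) := by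
      intro z
      rw [Real.exp_add, Real.exp_log (hpos z), E3_inner]; ring
    simp_rw [e]
    have j01 : Integrable (fun z => B 0 * (stereo z 0 * Real.exp (U z)) +
          B 1 * (stereo z 1 * Real.exp (U z))) nu0 := ((iei 0).const_mul _).add ((iei 1).const_mul _)
    have j : Integrable (fun z => B 0 * (stereo z 0 * Real.exp (U z)) +
          B 1 * (stereo z 1 * Real.exp (U z)) + B 2 * (stereo z 2 * Real.exp (U z))) nu0 :=
      j01.add ((iei 2).const_mul _)
    rw [integral_sub (ieU.const_mul _) j, integral_add j01 ((iei 2).const_mul _),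
      integral_add ((iei 0).const_mul _) ((iei 1).const_mul _)]
    simp_rw [integral_const_mul]
    rw [hA, hB, hB, hB, E3_norm_sq]; ring
  rw [h4, integral_add iU il] at hg
  linarith

lemma ent_dF (μ : Measure E3) [IsProbabilityMeasure μ] (hac : μ ≪ nu0.map stereo)
    (hItg : Integrable (llr μ (nu0.map stereo)) μ) (h0 : ∫ x, x ∂μ = 0)
    {E : ℂ → ℝ} (hE : Continuous E) {C : ℝ}
    (hC : ∀ z, Real.exp (-C) * jw z ≤ E z ∧ E z ≤ Real.exp C * jw z) (hd : 0 < dF E) :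
    ∫ z, Real.log (E z / jw z) ∂(μ.map proj) -
      (1 / 2) * (Real.log (dF E) - Real.log ((Real.pi / 2) ^ 2)) ≤
      ∫ x, llr μ (nu0.map stereo) x ∂μ := by
  have hE0 : ∀ z, 0 < E z := fun z => lt_of_lt_of_le (mul_pos (Real.exp_pos _) (jw_pos z)) (hC z).1
  have hpi := Real.pi_pos
  have hUb : ∀ z, |Real.log (E z / jw z)| ≤ C := by
    intro z
    have hj := jw_pos z
    rw [abs_le]
    constructor
    · rw [Real.le_log_iff_exp_le (div_pos (hE0 z) hj), le_div_iff₀ hj]; exact (hC z).1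
    · rw [Real.log_le_iff_le_exp (div_pos (hE0 z) hj), div_le_iff₀ hj]; exact (hC z).2
  have hUm : Measurable (fun z => Real.log (E z / jw z)) :=
    Real.measurable_log.comp (hE.measurable.div continuous_jw.measurable)
  have hexp : ∀ z, Real.exp (Real.log (E z / jw z)) * w0 z = Real.pi⁻¹ * ((1 + ‖z‖ ^ 2) * E z) := by
    intro z
    rw [Real.exp_log (div_pos (hE0 z) (jw_pos z))]
    unfold w0 jw
    have h1 : (0 : ℝ) < 1 + ‖z‖ ^ 2 := by positivity
    field_simp
  have hintE : ∀ f : ℂ → ℝ, Continuous f → (∀ z, |f z| ≤ 1 * (1 + ‖z‖ ^ 2)) →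
      Integrable (fun z => f z * E z) := by
    intro f hf hfb
    refine Integrable.mono' ((integrable_jw_of_le (f := fun z => |f z|) hf.abs (C := 1)
      (fun z => by rw [abs_abs]; exact hfb z)).const_mul (Real.exp C))
      (hf.mul hE).aestronglyMeasurable (Filter.Eventually.of_forall fun z => ?_)
    rw [Real.norm_eq_abs, abs_mul, abs_of_pos (hE0 z)]
    have := mul_le_mul_of_nonneg_left (hC z).2 (abs_nonneg (f z))
    linarith
  have i1 := hintE (fun _ => 1) continuous_const (fun z => by
    rw [abs_one]; nlinarith [sq_nonneg ‖z‖])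
  have iN := hintE (fun z => ‖z‖ ^ 2) (by fun_prop) (fun z => by
    rw [abs_of_nonneg (sq_nonneg _)]; linarith)
  set a := ∫ z, 1 * E z with ha
  set b := ∫ z : ℂ, ‖z‖ ^ 2 * E z with hb
  set c := ∫ z : ℂ, z.re * E z with hc
  set d := ∫ z : ℂ, z.im * E z with hdd
  have hA : ∫ z, Real.exp (Real.log (E z / jw z)) ∂nu0 = Real.pi⁻¹ * (a + b) := by
    rw [integral_nu0_real, ← integral_add i1 iN, ← integral_const_mul]
    refine integral_congr_ae (Filter.Eventually.of_forall fun z => ?_)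
    simp only [hexp]; ring
  have hp : ∀ z : ℂ, (1 + ‖z‖ ^ 2) ≠ 0 := fun z => by positivity
  have hB0 : ∫ z, stereo z 0 * Real.exp (Real.log (E z / jw z)) ∂nu0 = Real.pi⁻¹ * 2 * c := by
    rw [integral_nu0_real, ← integral_const_mul]
    refine integral_congr_ae (Filter.Eventually.of_forall fun z => ?_)
    simp only [mul_assoc, hexp, stereo_0]
    have := hp z
    field_simp
  have hB1 : ∫ z, stereo z 1 * Real.exp (Real.log (E z / jw z)) ∂nu0 = Real.pi⁻¹ * 2 * d := by
    rw [integral_nu0_real, ← integral_const_mul]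
    refine integral_congr_ae (Filter.Eventually.of_forall fun z => ?_)
    simp only [mul_assoc, hexp, stereo_1]
    have := hp z
    field_simp
  have hB2 : ∫ z, stereo z 2 * Real.exp (Real.log (E z / jw z)) ∂nu0 = Real.pi⁻¹ * (b - a) := by
    rw [integral_nu0_real, ← integral_sub iN i1, ← integral_const_mul]
    refine integral_congr_ae (Filter.Eventually.of_forall fun z => ?_)
    simp only [mul_assoc, hexp, stereo_2]
    have := hp z
    field_simp
  have hdF : dF E = a * b - c ^ 2 - d ^ 2 := rfl
  set B : E3 := !₂[Real.pi⁻¹ * 2 * c, Real.pi⁻¹ * 2 * d, Real.pi⁻¹ * (b - a)] with hBd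
  have hB : ∀ i, ∫ z, stereo z i * Real.exp (Real.log (E z / jw z)) ∂nu0 = B i := by
    intro i
    fin_cases i
    · exact hB0
    · exact hB1
    · exact hB2
  have hn : (Real.pi⁻¹ * (a + b)) ^ 2 - ‖B‖ ^ 2 = dF E / (Real.pi / 2) ^ 2 := by
    rw [E3_norm_sq, hdF]
    simp only [hBd, PiLp.toLp_apply, Matrix.cons_val_zero, Matrix.cons_val_one, Matrix.cons_val]
    field_simp
    ring
  have ha0 : 0 ≤ a := integral_nonneg fun z => by simpa using (hE0 z).le
  have hb0 : 0 ≤ b := integral_nonneg fun z => mul_nonneg (sq_nonneg _) (hE0 z).le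
  have hA0 : 0 ≤ Real.pi⁻¹ * (a + b) := by positivity
  have hAB : ‖B‖ < Real.pi⁻¹ * (a + b) := by
    have : 0 < dF E / (Real.pi / 2) ^ 2 := by positivity
    rw [← hn] at this
    exact lt_of_pow_lt_pow_left₀ 2 hA0 (by linarith)
  have := centered μ hac hItg h0 hUm hUb hA hB hAB
  rw [hn, Real.log_div hd.ne' (by positivity)] at this
  exact this

noncomputable def kap (z w : ℂ) : ℝ := ‖z - w‖ ^ 2 / ((1 + ‖z‖ ^ 2) * (1 + ‖w‖ ^ 2))

lemma kap_symm (z w : ℂ) : kap z w = kap w z := by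
  unfold kap; rw [norm_sub_rev, mul_comm]

lemma kap_nonneg (z w : ℂ) : 0 ≤ kap z w := by unfold kap; positivity

lemma kap_pos {z w : ℂ} (h : z ≠ w) : 0 < kap z w := by
  have := norm_pos_iff.2 (sub_ne_zero.2 h)
  unfold kap; positivity

lemma kap_le_one (z w : ℂ) : kap z w ≤ 1 := by
  unfold kap
  rw [div_le_one (by positivity)]
  simp only [Complex.sq_norm, Complex.normSq_apply, Complex.sub_re, Complex.sub_im]
  nlinarith [sq_nonneg (1 + z.re * w.re + z.im * w.im), sq_nonneg (z.re * w.im - z.im * w.re)]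

lemma measurable_kap : Measurable (fun p : ℂ × ℂ => kap p.1 p.2) := by
  unfold kap
  have : Continuous (fun p : ℂ × ℂ => ‖p.1 - p.2‖ ^ 2 / ((1 + ‖p.1‖ ^ 2) * (1 + ‖p.2‖ ^ 2))) :=
    Continuous.div (by fun_prop) (by fun_prop) fun p => by positivity
  exact this.measurable

lemma log_prod_choose (k : ℕ) :
    Real.log (∏ a : Fin (k + 1), (k.choose a : ℝ)) ≤ k * (k + 1) / 2 := by
  rw [Fin.prod_univ_eq_prod_range (fun a => (k.choose a : ℝ))]
  induction k with
  | zero => simp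
  | succ k ih =>
    have hpos : ∀ k : ℕ, 0 < ∏ a ∈ Finset.range (k + 1), (k.choose a : ℝ) := fun k =>
      Finset.prod_pos fun a ha => by
        exact_mod_cast Nat.choose_pos (Nat.lt_succ_iff.1 (Finset.mem_range.1 ha))
    have e : (∏ a ∈ Finset.range (k + 1 + 1), ((k + 1).choose a : ℝ)) * ((k + 1).factorial : ℝ) =
        (∏ a ∈ Finset.range (k + 1), (k.choose a : ℝ)) * ((k : ℝ) + 1) ^ (k + 1) := by
      rw [Finset.prod_range_succ, Nat.choose_self, Nat.cast_one, mul_one]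
      have h1 : ((k + 1).factorial : ℝ) = ∏ a ∈ Finset.range (k + 1), ((k + 1 - a : ℕ) : ℝ) := by
        rw [← Finset.prod_range_add_one_eq_factorial, ← Finset.prod_range_reflect]
        push_cast
        refine Finset.prod_congr rfl fun a ha => ?_
        have := Finset.mem_range.1 ha
        have h2 : k + 1 - a = (k + 1 - 1 - a) + 1 := by omega
        rw [h2]; push_cast; rfl
      have h5 : ((k : ℝ) + 1) ^ (k + 1) = ∏ _a ∈ Finset.range (k + 1), ((k : ℝ) + 1) := by
        rw [Finset.prod_const, Finset.card_range]
      rw [h1, h5, ← Finset.prod_mul_distrib, ← Finset.prod_mul_distrib]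
      refine Finset.prod_congr rfl fun a _ => ?_
      have := Nat.choose_mul_succ_eq k a
      exact_mod_cast this.symm
    have hf : (0 : ℝ) < ((k + 1).factorial : ℝ) := by exact_mod_cast Nat.factorial_pos _
    have e2 : (∏ a ∈ Finset.range (k + 1 + 1), ((k + 1).choose a : ℝ)) =
        (∏ a ∈ Finset.range (k + 1), (k.choose a : ℝ)) * (((k : ℝ) + 1) ^ (k + 1) / ((k + 1).factorial : ℝ)) := by
      rw [mul_div_assoc', eq_div_iff hf.ne', e]
    have h3 := Real.pow_div_factorial_le_exp (x := (k : ℝ) + 1) (by positivity) (k + 1)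
    rw [e2, Real.log_mul (hpos k).ne' (by positivity)]
    have h4 : Real.log (((k : ℝ) + 1) ^ (k + 1) / ((k + 1).factorial : ℝ)) ≤ k + 1 := by
      rw [Real.log_le_iff_le_exp (by positivity)]; exact h3
    push_cast
    linarith

noncomputable def lag {n : ℕ} (ζ : Fin n → ℂ) (j : Fin n) : Polynomial ℂ :=
  Polynomial.C (∏ i ∈ ({j}ᶜ : Finset (Fin n)), ((√(1 + ‖ζ i‖ ^ 2))⁻¹ : ℂ)) *
    ∏ i ∈ ({j}ᶜ : Finset (Fin n)), (Polynomial.X - Polynomial.C (ζ i))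

lemma lag_deg {k : ℕ} (ζ : Fin (k + 1) → ℂ) (j : Fin (k + 1)) : (lag ζ j).natDegree ≤ k := by
  unfold lag
  refine (Polynomial.natDegree_C_mul_le _ _).trans ?_
  rw [Polynomial.natDegree_finsetProd_X_sub_C_eq_card, Finset.card_compl]
  simp

lemma lag_eval {n : ℕ} (ζ : Fin n → ℂ) (j : Fin n) (z : ℂ) : ‖(lag ζ j).eval z‖ ^ 2 =
    ∏ i ∈ ({j}ᶜ : Finset (Fin n)), (‖z - ζ i‖ ^ 2 / (1 + ‖ζ i‖ ^ 2)) := by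
  unfold lag
  rw [Polynomial.eval_mul, Polynomial.eval_C, Polynomial.eval_prod, ← Finset.prod_mul_distrib,
    norm_prod, ← Finset.prod_pow]
  refine Finset.prod_congr rfl fun i _ => ?_
  rw [Polynomial.eval_sub, Polynomial.eval_X, Polynomial.eval_C, norm_mul, norm_inv,
    Complex.norm_real, Real.norm_of_nonneg (Real.sqrt_nonneg _), mul_pow, inv_pow,
    Real.sq_sqrt (by positivity)]
  ring

lemma lag_det {k : ℕ} (ζ : Fin (k + 1) → ℂ) (hζ : Function.Injective ζ) :
    (Matrix.of fun j a : Fin (k + 1) => (lag ζ j).coeff (a : ℕ)).det ≠ 0 ∧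
    (‖(Matrix.of fun j a : Fin (k + 1) => (lag ζ j).coeff (a : ℕ)).det‖ ^ 2) ^ 2 =
      ∏ j, ∏ i ∈ ({j}ᶜ : Finset (Fin (k + 1))), kap (ζ j) (ζ i) := by
  set M : Matrix (Fin (k + 1)) (Fin (k + 1)) ℂ := Matrix.of fun j a => (lag ζ j).coeff (a : ℕ) with hM
  have h1 : M * (Matrix.vandermonde ζ).transpose = Matrix.diagonal (fun j => (lag ζ j).eval (ζ j)) := by
    ext j l
    rw [Matrix.mul_apply]
    have e : ∑ a : Fin (k + 1), M j a * (Matrix.vandermonde ζ).transpose a l = (lag ζ j).eval (ζ l) := by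
      rw [Polynomial.eval_eq_sum_range' (Nat.lt_succ_of_le (lag_deg ζ j)),
        ← Fin.sum_univ_eq_sum_range (fun a => (lag ζ j).coeff a * ζ l ^ a)]
      rfl
    rw [e]
    by_cases hjl : j = l
    · subst hjl; rw [Matrix.diagonal_apply_eq]
    · rw [Matrix.diagonal_apply_ne _ hjl]
      unfold lag
      have h0 : ∏ i ∈ ({j}ᶜ : Finset (Fin (k + 1))),
          (Polynomial.X - Polynomial.C (ζ i)).eval (ζ l) = 0 :=
        Finset.prod_eq_zero (i := l) (by
          rw [Finset.mem_compl, Finset.mem_singleton]; exact fun h => hjl h.symm) (by simp)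
      rw [Polynomial.eval_mul, Polynomial.eval_prod, h0, mul_zero]
  have h2 := congrArg Matrix.det h1
  rw [Matrix.det_mul, Matrix.det_transpose, Matrix.det_diagonal] at h2
  set v := (Matrix.vandermonde ζ).det with hv
  set P : ℝ := ∏ j, ∏ i ∈ ({j}ᶜ : Finset (Fin (k + 1))), ‖ζ j - ζ i‖ ^ 2 with hP
  set Q : ℝ := ∏ j : Fin (k + 1), ∏ i ∈ ({j}ᶜ : Finset (Fin (k + 1))), (1 + ‖ζ i‖ ^ 2) with hQ
  have hPpos : 0 < P := Finset.prod_pos fun j _ => Finset.prod_pos fun i hi => by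
    have : ζ j ≠ ζ i := fun h => by
      have := hζ h
      simp only [Finset.mem_compl, Finset.mem_singleton] at hi
      exact hi this.symm
    have := norm_pos_iff.2 (sub_ne_zero.2 this)
    positivity
  have hQpos : 0 < Q := Finset.prod_pos fun j _ => Finset.prod_pos fun i hi => by positivity
  have hQ' : ∏ j : Fin (k + 1), ∏ i ∈ ({j}ᶜ : Finset (Fin (k + 1))), (1 + ‖ζ j‖ ^ 2) = Q := by
    rw [hQ, ← Finset.prod_prod_Ioi_mul_eq_prod_prod_off_diag (fun j i => 1 + ‖ζ j‖ ^ 2),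
      ← Finset.prod_prod_Ioi_mul_eq_prod_prod_off_diag (fun j i => 1 + ‖ζ i‖ ^ 2)]
    refine Finset.prod_congr rfl fun j _ => Finset.prod_congr rfl fun i _ => mul_comm _ _
  have hvP : (‖v‖ ^ 2) ^ 2 = P := by
    rw [hP, ← Finset.prod_prod_Ioi_mul_eq_prod_prod_off_diag (fun i j => ‖ζ j - ζ i‖ ^ 2), hv,
      Matrix.det_vandermonde, norm_prod, ← pow_mul, ← Finset.prod_pow]
    refine Finset.prod_congr rfl fun j _ => ?_
    rw [norm_prod, ← Finset.prod_pow]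
    refine Finset.prod_congr rfl fun i _ => ?_
    rw [norm_sub_rev (ζ j) (ζ i)]; ring
  have h3 : ‖M.det‖ ^ 2 * ‖v‖ ^ 2 = P / Q := by
    rw [← mul_pow, ← norm_mul, h2, norm_prod, ← Finset.prod_pow, hP, hQ, ← Finset.prod_div_distrib]
    refine Finset.prod_congr rfl fun j _ => ?_
    rw [lag_eval, ← Finset.prod_div_distrib]
  constructor
  · intro h0
    rw [h0] at h3
    have : 0 < P / Q := by positivity
    rw [← h3, norm_zero] at this
    norm_num at this
  · have h4 : (‖M.det‖ ^ 2) ^ 2 * P = (P / Q) ^ 2 := by rw [← h3, mul_pow, hvP]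
    have h5 : (‖M.det‖ ^ 2) ^ 2 = P / (Q * Q) := by
      rw [eq_div_iff (by positivity)]
      have h6 : (‖M.det‖ ^ 2) ^ 2 * P * (Q * Q) = P * P := by
        rw [h4]; field_simp
      refine mul_right_cancel₀ hPpos.ne' ?_
      linarith
    rw [h5]
    nth_rewrite 1 [← hQ']
    rw [hQ, hP, ← Finset.prod_mul_distrib, ← Finset.prod_div_distrib]
    refine Finset.prod_congr rfl fun j _ => ?_
    rw [← Finset.prod_mul_distrib, ← Finset.prod_div_distrib]
    rfl

theorem ent_lag (μ : Measure E3) [IsProbabilityMeasure μ] (hac : μ ≪ nu0.map stereo)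
    (hItg : Integrable (llr μ (nu0.map stereo)) μ) (h0 : ∫ x, x ∂μ = 0) {k : ℕ} (hk : 1 ≤ k)
    (ζ : Fin (k + 1) → ℂ) (hζ : Function.Injective ζ) :
    -(1 / (2 * (k + 1))) * (∑ j, ∑ i ∈ ({j}ᶜ : Finset (Fin (k + 1))), -Real.log (kap (ζ j) (ζ i)))
      - k / 2 - ∫ z, Real.log (∑ j, ∏ i ∈ ({j}ᶜ : Finset (Fin (k + 1))), kap z (ζ i)) ∂(μ.map proj)
      ≤ k / 3 * ∫ x, llr μ (nu0.map stereo) x ∂μ := by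
  have hk0 : (0 : ℝ) < k := by exact_mod_cast hk
  obtain ⟨hd1, hd2⟩ := lag_det ζ hζ
  obtain ⟨hF, hlog, C, hC⟩ := star2 hk (lag ζ) (lag_deg ζ) hd1
  set M : Matrix (Fin (k + 1)) (Fin (k + 1)) ℂ := Matrix.of fun j a => (lag ζ j).coeff (a : ℕ) with hM
  set S : ℂ → ℝ := fun z => ∑ j, ‖(lag ζ j).eval z‖ ^ 2 with hS
  have hSpos : ∀ z, 0 < S z := by
    intro z
    have h1 : 0 ≤ S z := Finset.sum_nonneg fun j _ => by positivity
    refine lt_of_le_of_ne h1 fun h => ?_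
    have h2 := lt_of_lt_of_le (mul_pos (Real.exp_pos _) (jw_pos z)) (hC z).1
    change 0 < (S z) ^ (-(3 / (k : ℝ))) at h2
    rw [← h, Real.zero_rpow (by
      have : (0 : ℝ) < 3 / k := by positivity
      linarith)] at h2
    exact lt_irrefl _ h2
  have hScont : Continuous S := continuous_finsetSum _ fun j _ =>
    ((lag ζ j).continuous.norm.pow 2)
  have hEc : Continuous (fun z => (S z) ^ (-(3 / (k : ℝ)))) :=
    hScont.rpow_const fun z => Or.inl (hSpos z).ne'
  have hmain := ent_dF μ hac hItg h0 hEc hC hF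
  have hT : ∀ z, (∑ j, ∏ i ∈ ({j}ᶜ : Finset (Fin (k + 1))), kap z (ζ i)) = S z / (1 + ‖z‖ ^ 2) ^ k := by
    intro z
    rw [hS, Finset.sum_div]
    refine Finset.sum_congr rfl fun j _ => ?_
    have hcard : ({j}ᶜ : Finset (Fin (k + 1))).card = k := by rw [Finset.card_compl]; simp
    rw [lag_eval]
    have h5 : (1 + ‖z‖ ^ 2) ^ k = ∏ _i ∈ ({j}ᶜ : Finset (Fin (k + 1))), (1 + ‖z‖ ^ 2) := by
      rw [Finset.prod_const, hcard]
    rw [h5, ← Finset.prod_div_distrib]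
    refine Finset.prod_congr rfl fun i _ => ?_
    unfold kap
    rw [div_div, mul_comm (1 + ‖z‖ ^ 2)]
  have hl : ∀ z, Real.log ((S z) ^ (-(3 / (k : ℝ))) / jw z) =
      -(3 / (k : ℝ)) * Real.log (∑ j, ∏ i ∈ ({j}ᶜ : Finset (Fin (k + 1))), kap z (ζ i)) := by
    intro z
    have h1 : (0 : ℝ) < 1 + ‖z‖ ^ 2 := by positivity
    rw [hT, Real.log_div (hSpos z).ne' (by positivity), Real.log_div
      (Real.rpow_pos_of_pos (hSpos z) _).ne' (jw_pos z).ne', Real.log_rpow (hSpos z)]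
    unfold jw
    rw [Real.log_inv, Real.log_pow, Real.log_pow]
    push_cast
    field_simp
    ring
  simp_rw [hl] at hmain
  rw [integral_const_mul] at hmain
  have hprodpos : 0 < ∏ a : Fin (k + 1), (k.choose a : ℝ) := Finset.prod_pos fun a _ => by
    exact_mod_cast Nat.choose_pos (Nat.lt_succ_iff.1 a.2)
  have hMpos : 0 < ‖M.det‖ := norm_pos_iff.2 hd1
  have hlogM : 2 * Real.log (‖M.det‖ ^ 2) =
      ∑ j, ∑ i ∈ ({j}ᶜ : Finset (Fin (k + 1))), Real.log (kap (ζ j) (ζ i)) := by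
    have hkp : ∀ j, ∀ i ∈ ({j}ᶜ : Finset (Fin (k + 1))), kap (ζ j) (ζ i) ≠ 0 := by
      intro j i hi
      refine (kap_pos fun h => ?_).ne'
      simp only [Finset.mem_compl, Finset.mem_singleton] at hi
      exact hi (hζ h).symm
    have := congrArg Real.log hd2
    rw [Real.log_pow, Real.log_prod (fun j _ => Finset.prod_ne_zero_iff.2 (hkp j))] at this
    push_cast at this
    rw [this]
    exact Finset.sum_congr rfl fun j _ => Real.log_prod (hkp j)
  rw [Real.log_div (by positivity) hprodpos.ne'] at hlog
  have hpc := log_prod_choose k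
  simp_rw [Finset.sum_neg_distrib]
  rw [← hlogM]
  set I := ∫ z, Real.log (∑ j, ∏ i ∈ ({j}ᶜ : Finset (Fin (k + 1))), kap z (ζ i)) ∂(μ.map proj) with hI
  set D := ∫ x, llr μ (nu0.map stereo) x ∂μ with hD
  set lM := Real.log (‖M.det‖ ^ 2) with hlM
  set lP := Real.log (∏ a : Fin (k + 1), (k.choose a : ℝ)) with hlP
  have s1 : -(3 / (k : ℝ)) * I + (1 / 2) * (6 / (k * (k + 1)) * (lM - k * (k + 1) / 2)) ≤ D := by
    have s2 : 6 / ((k : ℝ) * (k + 1)) * (lM - k * (k + 1) / 2) ≤ 6 / (k * (k + 1)) * (lM - lP) :=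
      mul_le_mul_of_nonneg_left (by linarith) (by positivity)
    linarith
  have s3 := mul_le_mul_of_nonneg_left s1 (show (0 : ℝ) ≤ k / 3 by positivity)
  refine le_trans (le_of_eq ?_) s3
  field_simp
  ring

noncomputable def xk (z w : ℂ) : ℝ := -Real.log (kap z w)

lemma xk_symm (z w : ℂ) : xk z w = xk w z := by unfold xk; rw [kap_symm]

lemma xk_nonneg (z w : ℂ) : 0 ≤ xk z w :=
  neg_nonneg.2 (Real.log_nonpos (kap_nonneg z w) (kap_le_one z w))

lemma measurable_xk : Measurable (fun p : ℂ × ℂ => xk p.1 p.2) :=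
  (Real.measurable_log.comp measurable_kap).neg

lemma measurable_xk_left (w : ℂ) : Measurable (fun z => xk z w) := by
  exact Measurable.of_uncurry_right (f := xk) measurable_xk

lemma kap_mob (ζ z : ℂ) (hd : -z - starRingEnd ℂ ζ ≠ 0) :
    kap ((-ζ * z + 1) / (-z - starRingEnd ℂ ζ)) ζ = (1 + ‖z‖ ^ 2)⁻¹ := by
  have hd' : ‖-z - starRingEnd ℂ ζ‖ ^ 2 ≠ 0 := pow_ne_zero _ (norm_ne_zero_iff.2 hd)
  have e1 : (-ζ * z + 1) / (-z - starRingEnd ℂ ζ) - ζ =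
      ((1 + ‖ζ‖ ^ 2 : ℝ) : ℂ) / (-z - starRingEnd ℂ ζ) := by
    rw [div_sub' hd]
    congr 1
    push_cast
    rw [← Complex.mul_conj']
    ring
  have e2 : 1 + ‖(-ζ * z + 1) / (-z - starRingEnd ℂ ζ)‖ ^ 2 =
      (1 + ‖z‖ ^ 2) * (1 + ‖ζ‖ ^ 2) / ‖-z - starRingEnd ℂ ζ‖ ^ 2 := by
    rw [norm_div, div_pow, eq_div_iff hd', add_mul, div_mul_cancel₀ _ hd']
    simp only [Complex.sq_norm, Complex.normSq_apply, Complex.sub_re, Complex.sub_im,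
      Complex.neg_re, Complex.neg_im, Complex.add_re, Complex.add_im, Complex.mul_re,
      Complex.mul_im, Complex.one_re, Complex.one_im, Complex.conj_re, Complex.conj_im]
    ring
  unfold kap
  rw [e1, e2, norm_div, Complex.norm_real, Real.norm_of_nonneg (by positivity), div_pow]
  have h1 : 1 + ‖z‖ ^ 2 ≠ 0 := by positivity
  have h2 : 1 + ‖ζ‖ ^ 2 ≠ 0 := by positivity
  generalize ‖-z - starRingEnd ℂ ζ‖ ^ 2 = d at *
  field_simp

lemma kap_cov (ζ : ℂ) (h : ℝ → ℝ) :
    ∫ z, h (kap z ζ) ∂nu0 = ∫ z, h ((1 + ‖z‖ ^ 2)⁻¹) ∂nu0 := by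
  have hc := mobius_cov (-ζ) 1 (Or.inr one_ne_zero) (fun z => ((h (kap z ζ) : ℝ) : ℂ))
  have h1 : ∫ z, ((h (kap z ζ) : ℝ) : ℂ) * w0 z = ((∫ z, h (kap z ζ) * w0 z : ℝ) : ℂ) := by
    rw [← integral_complex_ofReal]
    refine integral_congr_ae (Filter.Eventually.of_forall fun z => ?_)
    push_cast; rfl
  have h2 : ∫ z : ℂ, ((h (kap ((-ζ * z + 1) / (-(starRingEnd ℂ 1) * z + starRingEnd ℂ (-ζ))) ζ) : ℝ) : ℂ)
      * w0 z = ((∫ z : ℂ, h ((1 + ‖z‖ ^ 2)⁻¹) * w0 z : ℝ) : ℂ) := by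
    rw [← integral_complex_ofReal]
    have hae : ∀ᵐ z : ℂ, z ≠ -starRingEnd ℂ ζ := by
      rw [ae_iff]; simp
    refine integral_congr_ae (hae.mono fun z hz => ?_)
    have hd : -z - starRingEnd ℂ ζ ≠ 0 := fun h => hz (by linear_combination -h)
    have e : -(starRingEnd ℂ 1) * z + starRingEnd ℂ (-ζ) = -z - starRingEnd ℂ ζ := by
      rw [map_one, map_neg]; ring
    simp only
    rw [e, kap_mob ζ z hd]
    push_cast; rfl
  rw [integral_nu0_real, integral_nu0_real]
  have := h1.symm.trans (hc.symm.trans h2)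
  exact_mod_cast this

lemma integrable_nu0 {f : ℂ → ℝ} : Integrable f nu0 ↔ Integrable (fun z => f z * w0 z) := by
  unfold nu0
  rw [integrable_withDensity_iff (by exact continuous_w0.measurable.ennreal_ofReal)
    (Filter.Eventually.of_forall fun z => ENNReal.ofReal_lt_top)]
  simp only [ENNReal.toReal_ofReal (w0_pos _).le]

lemma integrable_sqrt : Integrable (fun z : ℂ => √(1 + ‖z‖ ^ 2)) nu0 := by
  rw [integrable_nu0]
  have := (integrable_rpow_neg_one_add_norm_sq (E := ℂ) (μ := volume) (r := 3)
    (by rw [Complex.finrank_real_complex]; norm_num)).const_mul (Real.pi⁻¹)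
  refine this.congr (Filter.Eventually.of_forall fun z => ?_)
  have hp : (0 : ℝ) < 1 + ‖z‖ ^ 2 := by positivity
  simp only [w0]
  rw [Real.sqrt_eq_rpow, ← Real.rpow_natCast (1 + ‖z‖ ^ 2) 2, ← Real.rpow_neg hp.le]
  rw [mul_left_comm, ← Real.rpow_add hp]
  norm_num

lemma log_le_sqrt {t : ℝ} (ht : 0 < t) : Real.log t ≤ 2 * √t := by
  have h1 := Real.log_le_self (Real.sqrt_nonneg t)
  rw [Real.log_sqrt ht.le] at h1
  linarith

lemma integrable_log_nu0 : Integrable (fun z : ℂ => Real.log (1 + ‖z‖ ^ 2)) nu0 := by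
  refine (integrable_sqrt.const_mul 2).mono' ?_ (Filter.Eventually.of_forall fun z => ?_)
  · exact (by fun_prop : Measurable (fun z : ℂ => Real.log (1 + ‖z‖ ^ 2))).aestronglyMeasurable
  · rw [Real.norm_of_nonneg (Real.log_nonneg (by nlinarith [norm_nonneg z]))]
    exact log_le_sqrt (by positivity)

lemma integral_log_nu0 : ∫ z : ℂ, Real.log (1 + ‖z‖ ^ 2) ∂nu0 = 1 := by
  have hi := integrable_nu0.1 integrable_log_nu0
  rw [integral_nu0_real]
  have := radial_ftc (g := fun y => Real.log (1 + y ^ 2) * (Real.pi⁻¹ * ((1 + y ^ 2) ^ 2)⁻¹))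
    (F := fun y => -(Real.pi⁻¹ * ((Real.log (1 + y ^ 2) + 1) / (1 + y ^ 2)))) (m := 0) hi ?_ ?_
  · refine Eq.trans this ?_
    have := Real.pi_ne_zero
    simp [this]
  · intro y _
    have hp : (1 + y ^ 2) ≠ 0 := by positivity
    have h1 : HasDerivAt (fun y : ℝ => 1 + y ^ 2) (2 * y) y := by
      simpa using (hasDerivAt_pow 2 y).const_add 1
    have h2 := ((((h1.log hp).add_const 1).div h1 hp).const_mul (Real.pi⁻¹)).neg
    refine h2.congr_deriv ?_
    have := Real.pi_ne_zero
    field_simp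
    ring
  · have ht : Filter.Tendsto (fun y : ℝ => 1 + y ^ 2) Filter.atTop Filter.atTop :=
      Filter.tendsto_atTop_add_const_left _ _ (Filter.tendsto_pow_atTop two_ne_zero)
    have h1 : Filter.Tendsto (fun t : ℝ => (Real.log t + 1) / t) Filter.atTop (nhds 0) := by
      have a := Real.isLittleO_log_id_atTop.tendsto_div_nhds_zero
      have b := tendsto_inv_atTop_zero (𝕜 := ℝ)
      have := a.add b
      rw [add_zero] at this
      refine this.congr fun t => ?_
      simp only [id]; rw [add_div, one_div]
    have := ((h1.comp ht).const_mul (Real.pi⁻¹)).neg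
    simpa using this

lemma integral_xk_nu0 (ζ : ℂ) : ∫ z, xk z ζ ∂nu0 = 1 := by
  have := kap_cov ζ (fun t => -Real.log t)
  simp only [Real.log_inv, neg_neg] at this
  exact this.trans integral_log_nu0

lemma lintegral_xk_nu0 (ζ : ℂ) (c : ℝ) (hc : 0 ≤ c) :
    ∫⁻ z, ENNReal.ofReal (c * xk z ζ) ∂nu0 = ENNReal.ofReal c := by
  have hi : Integrable (fun z => xk z ζ) nu0 := by
    by_contra h
    have := integral_xk_nu0 ζ
    rw [integral_undef h] at this
    exact zero_ne_one this
  rw [← ofReal_integral_eq_lintegral_ofReal (hi.const_mul c)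
    (Filter.Eventually.of_forall fun z => mul_nonneg hc (xk_nonneg _ _)), integral_const_mul,
    integral_xk_nu0, mul_one]

lemma xk_fin (μ : Measure E3) [IsProbabilityMeasure μ] (hac : μ ≪ nu0.map stereo)
    (hItg : Integrable (llr μ (nu0.map stereo)) μ) :
    ∃ B : ℝ, ∀ ζ, ∫⁻ z, ENNReal.ofReal (xk z ζ) ∂(μ.map proj) ≤ ENNReal.ofReal B := by
  have hν : IsProbabilityMeasure (μ.map proj) :=
    Measure.isProbabilityMeasure_map measurable_proj.aemeasurable
  set ν := μ.map proj with hνd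
  set D := ∫ x, llr μ (nu0.map stereo) x ∂μ with hD
  set K := ∫ z : ℂ, √(1 + ‖z‖ ^ 2) ∂nu0 with hK
  refine ⟨2 * (D + K), fun ζ => ?_⟩
  have hm := measurable_xk_left ζ
  have hmN : ∀ N : ℕ, Measurable (fun z => min (xk z ζ / 2) (N : ℝ)) := fun N =>
    (hm.div_const 2).min measurable_const
  have hb : ∀ (N : ℕ) z, |min (xk z ζ / 2) (N : ℝ)| ≤ N := fun N z => by
    rw [abs_of_nonneg (le_min (div_nonneg (xk_nonneg _ _) (by norm_num)) (Nat.cast_nonneg _))]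
    exact min_le_right _ _
  have h1 : ∀ N : ℕ, ∫ z, min (xk z ζ / 2) (N : ℝ) ∂ν ≤ D + K := by
    intro N
    have hg := gibbsC μ hac hItg (hmN N) (hb N)
    have hc := kap_cov ζ (fun t => Real.exp (min (-Real.log t / 2) (N : ℝ)))
    have hle : ∫ z, Real.exp (min (xk z ζ / 2) (N : ℝ)) ∂nu0 ≤ K := by
      refine (le_of_eq hc).trans ?_
      refine integral_mono_of_nonneg (Filter.Eventually.of_forall fun z => (Real.exp_pos _).le)
        integrable_sqrt (Filter.Eventually.of_forall fun z => ?_)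
      have hp : (0 : ℝ) < 1 + ‖z‖ ^ 2 := by positivity
      refine (Real.exp_le_exp.2 (min_le_left _ _)).trans (le_of_eq ?_)
      rw [Real.log_inv, neg_neg, ← Real.log_sqrt hp.le, Real.exp_log (Real.sqrt_pos.2 hp)]
    have hl := Real.log_le_self (integral_nonneg (μ := nu0) (f := fun z => Real.exp (min (xk z ζ / 2) (N : ℝ)))
      fun z => (Real.exp_pos _).le)
    linarith
  have h2 : ∀ N : ℕ, ∫⁻ z, ENNReal.ofReal (min (xk z ζ / 2) (N : ℝ)) ∂ν ≤ ENNReal.ofReal (D + K) := by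
    intro N
    rw [← ofReal_integral_eq_lintegral_ofReal (Integrable.of_bound (hmN N).aestronglyMeasurable N
      (Filter.Eventually.of_forall (hb N))) (Filter.Eventually.of_forall fun z =>
        le_min (div_nonneg (xk_nonneg _ _) (by norm_num)) (Nat.cast_nonneg _))]
    exact ENNReal.ofReal_le_ofReal (h1 N)
  have h3 := lintegral_tendsto_of_tendsto_of_monotone (μ := ν)
    (f := fun (N : ℕ) z => ENNReal.ofReal (min (xk z ζ / 2) (N : ℝ)))
    (F := fun z => ENNReal.ofReal (xk z ζ / 2)) (fun N => (hmN N).ennreal_ofReal.aemeasurable)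
    (Filter.Eventually.of_forall fun z a b hab => ENNReal.ofReal_le_ofReal
      (min_le_min_left _ (Nat.cast_le.2 hab)))
    (Filter.Eventually.of_forall fun z => by
      obtain ⟨n, hn⟩ := exists_nat_ge (xk z ζ / 2)
      refine tendsto_const_nhds.congr' ?_
      filter_upwards [Filter.eventually_ge_atTop n] with m hm
      rw [min_eq_left (hn.trans (Nat.cast_le.2 hm))])
  have h4 := le_of_tendsto' h3 h2
  have h5 : ∀ z, ENNReal.ofReal (xk z ζ) = ENNReal.ofReal 2 * ENNReal.ofReal (xk z ζ / 2) := fun z => by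
    rw [← ENNReal.ofReal_mul (by norm_num)]; congr 1; ring
  simp_rw [h5]
  rw [lintegral_const_mul _ (hm.div_const 2).ennreal_ofReal, ENNReal.ofReal_mul (by norm_num)]
  gcongr

lemma noatoms_proj (μ : Measure E3) (hac : μ ≪ nu0.map stereo) : NullSingletonClass (μ.map proj) := by
  constructor
  intro z
  have h1 : μ.map proj ≪ volume := by
    have h2 := hac.map measurable_proj
    rw [Measure.map_map measurable_proj stereo_cont.measurable] at h2
    have : proj ∘ stereo = id := by ext1 z; exact proj_stereo z
    rw [this, Measure.map_id] at h2
    exact h2.trans (withDensity_absolutelyContinuous _ _)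
  exact h1 (measure_singleton z)

lemma xk_integrable_prod (μ : Measure E3) [IsProbabilityMeasure μ] (hac : μ ≪ nu0.map stereo)
    (hItg : Integrable (llr μ (nu0.map stereo)) μ) :
    Integrable (fun p : ℂ × ℂ => xk p.1 p.2) ((μ.map proj).prod (μ.map proj)) := by
  have hν : IsProbabilityMeasure (μ.map proj) :=
    Measure.isProbabilityMeasure_map measurable_proj.aemeasurable
  obtain ⟨B, hB⟩ := xk_fin μ hac hItg
  refine ⟨measurable_xk.aestronglyMeasurable, ?_⟩
  rw [hasFiniteIntegral_iff_ofReal (Filter.Eventually.of_forall fun p => xk_nonneg _ _),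
    lintegral_prod _ measurable_xk.ennreal_ofReal.aemeasurable]
  refine lt_of_le_of_lt (lintegral_mono (g := fun _ => ENNReal.ofReal B) fun z => ?_) ?_
  · simp_rw [xk_symm z]; exact hB z
  · simp

lemma pair_mp (ν : Measure ℂ) [IsProbabilityMeasure ν] {n : ℕ} {i j : Fin n} (hij : j ≠ i) :
    MeasurePreserving (fun ζ : Fin n → ℂ => (ζ j, ζ i)) (Measure.pi fun _ => ν) (ν.prod ν) := by
  refine ⟨by fun_prop, ?_⟩
  have h1 := (ProbabilityTheory.iIndepFun_pi (μ := fun _ : Fin n => ν) (X := fun _ => id)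
    (fun _ => aemeasurable_id)).indepFun hij
  have h2 := (ProbabilityTheory.indepFun_iff_map_prod_eq_prod_map_map
    (measurable_pi_apply j).aemeasurable (measurable_pi_apply i).aemeasurable).1 h1
  rw [h2]
  have e : ∀ l : Fin n, (Measure.pi fun _ : Fin n => ν).map (fun ζ => ζ l) = ν := fun l =>
    (measurePreserving_eval (fun _ : Fin n => ν) l).map_eq
  rw [e, e]

lemma mp_int {α β : Type*} [MeasurableSpace α] [MeasurableSpace β] {P : Measure α} {Q : Measure β}
    {φ : α → β} (h : MeasurePreserving φ P Q) {f : β → ℝ} (hf : Integrable f Q) :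
    Integrable (fun x => f (φ x)) P ∧ ∫ x, f (φ x) ∂P = ∫ y, f y ∂Q := by
  refine ⟨h.integrable_comp_of_integrable hf, ?_⟩
  have := integral_map (μ := P) h.measurable.aemeasurable (f := f)
    (by rw [h.map_eq]; exact hf.aestronglyMeasurable)
  rw [← this, h.map_eq]

lemma diag_null (ν : Measure ℂ) [IsProbabilityMeasure ν] (hν : NullSingletonClass ν) :
    ∀ᵐ p ∂(ν.prod ν), p.1 ≠ p.2 := by
  have hm : MeasurableSet {p : ℂ × ℂ | p.1 = p.2} := measurableSet_eq_fun measurable_fst measurable_snd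
  rw [ae_iff]
  simp only [not_not]
  rw [Measure.measure_prod_null hm]
  refine Filter.Eventually.of_forall fun x => ?_
  have : Prod.mk x ⁻¹' {p : ℂ × ℂ | p.1 = p.2} = {x} := by
    ext y; simp [eq_comm]
  simp only [this, Pi.zero_apply]
  exact measure_singleton x

lemma avg (ν : Measure ℂ) [IsProbabilityMeasure ν] (hν : NullSingletonClass ν) {k : ℕ} {f : ℂ → ℝ}
    (hf : Integrable f ν) {G : ℂ × ℂ → ℝ} (hG : Integrable G (ν.prod ν)) {R c : ℝ}
    (h : ∀ ζ : Fin (k + 1) → ℂ, Function.Injective ζ →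
      c * (∑ j, ∑ i ∈ ({j}ᶜ : Finset (Fin (k + 1))), G (ζ j, ζ i)) + ∑ i, f (ζ i) ≤ R) :
    c * ((k + 1) * (k * ∫ p, G p ∂(ν.prod ν))) + (k + 1) * ∫ z, f z ∂ν ≤ R := by
  set P := Measure.pi fun _ : Fin (k + 1) => ν with hP
  have hinj : ∀ᵐ ζ ∂P, Function.Injective ζ := by
    have : ∀ i j : Fin (k + 1), ∀ᵐ ζ ∂P, j ≠ i → ζ j ≠ ζ i := by
      intro i j
      by_cases hij : j = i
      · exact Filter.Eventually.of_forall fun _ h => absurd hij h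
      · have := (pair_mp ν hij).quasiMeasurePreserving.ae (diag_null ν hν)
        filter_upwards [this] with ζ hζ _ using hζ
    have h2 := ae_all_iff.2 fun i => ae_all_iff.2 (this i)
    filter_upwards [h2] with ζ hζ a b hab
    by_contra hne
    exact hζ b a hne hab
  have i1 : ∀ j, ∀ i ∈ ({j}ᶜ : Finset (Fin (k + 1))), Integrable (fun ζ : Fin (k + 1) → ℂ => G (ζ j, ζ i)) P ∧
      ∫ ζ : Fin (k + 1) → ℂ, G (ζ j, ζ i) ∂P = ∫ p, G p ∂(ν.prod ν) := by
    intro j i hi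
    simp only [Finset.mem_compl, Finset.mem_singleton] at hi
    exact mp_int (pair_mp ν (fun h => hi h.symm)) hG
  have i2 : ∀ i, Integrable (fun ζ : Fin (k + 1) → ℂ => f (ζ i)) P ∧
      ∫ ζ : Fin (k + 1) → ℂ, f (ζ i) ∂P = ∫ z, f z ∂ν := fun i =>
    mp_int (measurePreserving_eval (fun _ : Fin (k + 1) => ν) i) hf
  have j1 : Integrable (fun ζ : Fin (k + 1) → ℂ => c * ∑ j, ∑ i ∈ ({j}ᶜ : Finset (Fin (k + 1))), G (ζ j, ζ i)) P :=
    (integrable_finsetSum _ fun j _ => integrable_finsetSum _ fun i hi => (i1 j i hi).1).const_mul c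
  have j2 : Integrable (fun ζ : Fin (k + 1) → ℂ => ∑ i, f (ζ i)) P :=
    integrable_finsetSum _ fun i _ => (i2 i).1
  have hmono := integral_mono_ae (μ := P) (j1.add j2) (integrable_const R)
    (hinj.mono fun ζ hζ => h ζ hζ)
  rw [integral_const, probReal_univ, one_smul] at hmono
  have hs : ∫ ζ, ((fun ζ : Fin (k + 1) → ℂ => c * ∑ j, ∑ i ∈ ({j}ᶜ : Finset (Fin (k + 1))), G (ζ j, ζ i)) +
      (fun ζ : Fin (k + 1) → ℂ => ∑ i, f (ζ i))) ζ ∂P =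
      c * ((k + 1) * (k * ∫ p, G p ∂(ν.prod ν))) + (k + 1) * ∫ z, f z ∂ν := by
    simp only [Pi.add_apply]
    rw [integral_add j1 j2, integral_const_mul c, integral_finsetSum _ fun j _ =>
      integrable_finsetSum _ fun i hi => (i1 j i hi).1, integral_finsetSum _ fun i _ => (i2 i).1]
    congr 1
    · congr 1
      have : ∀ j ∈ (Finset.univ : Finset (Fin (k + 1))),
          ∫ ζ : Fin (k + 1) → ℂ, ∑ i ∈ ({j}ᶜ : Finset (Fin (k + 1))), G (ζ j, ζ i) ∂P =
          k * ∫ p, G p ∂(ν.prod ν) := by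
        intro j _
        rw [integral_finsetSum _ fun i hi => (i1 j i hi).1, Finset.sum_congr rfl fun i hi => (i1 j i hi).2,
          Finset.sum_const, Finset.card_compl]
        simp
      rw [Finset.sum_congr rfl this, Finset.sum_const]
      simp
    · rw [Finset.sum_congr rfl fun i _ => (i2 i).2, Finset.sum_const]
      simp
  exact hs.symm.le.trans hmono

lemma pt_bound {k : ℕ} (ζ : Fin (k + 1) → ℂ) (z : ℂ) (hz : ∀ i, z ≠ ζ i) {M : ℝ} :
    Real.log (∑ j, ∏ i ∈ ({j}ᶜ : Finset (Fin (k + 1))), kap z (ζ i)) ≤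
      Real.log (k + 1) + M + ∑ i, max (xk z (ζ i) - M) 0 - ∑ i, xk z (ζ i) ∧
    |Real.log (∑ j, ∏ i ∈ ({j}ᶜ : Finset (Fin (k + 1))), kap z (ζ i))| ≤
      Real.log (k + 1) + ∑ i, xk z (ζ i) := by
  have hp : ∀ i, 0 < kap z (ζ i) := fun i => kap_pos (hz i)
  have hk : (0 : ℝ) < k + 1 := by positivity
  have hlk : 0 ≤ Real.log (k + 1 : ℝ) := Real.log_nonneg (by linarith [(Nat.cast_nonneg k : (0 : ℝ) ≤ k)])
  have hx0 : 0 ≤ ∑ i, xk z (ζ i) := Finset.sum_nonneg fun i _ => xk_nonneg _ _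
  have hex : ∀ i, kap z (ζ i) = Real.exp (-xk z (ζ i)) := fun i => by
    unfold xk; rw [neg_neg, Real.exp_log (hp i)]
  have hpr : ∀ j, ∏ i ∈ ({j}ᶜ : Finset (Fin (k + 1))), kap z (ζ i) =
      Real.exp (xk z (ζ j) - ∑ i, xk z (ζ i)) := by
    intro j
    rw [Finset.prod_congr rfl fun i _ => hex i, ← Real.exp_sum, Finset.sum_neg_distrib]
    congr 1
    have := Finset.sum_compl_add_sum ({j} : Finset (Fin (k + 1))) (fun i => xk z (ζ i))
    rw [Finset.sum_singleton] at this
    linarith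
  have hTpos : 0 < ∑ j, ∏ i ∈ ({j}ᶜ : Finset (Fin (k + 1))), kap z (ζ i) :=
    Finset.sum_pos (fun j _ => Finset.prod_pos fun i _ => hp i) Finset.univ_nonempty
  have hub : ∀ A : ℝ, (∀ j, xk z (ζ j) - ∑ i, xk z (ζ i) ≤ A) →
      Real.log (∑ j, ∏ i ∈ ({j}ᶜ : Finset (Fin (k + 1))), kap z (ζ i)) ≤ Real.log (k + 1) + A := by
    intro A hA
    rw [Real.log_le_iff_le_exp hTpos, Real.exp_add, Real.exp_log hk]
    refine (Finset.sum_le_card_nsmul _ _ (Real.exp A) fun j _ => ?_).trans (le_of_eq ?_)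
    · rw [hpr]; exact Real.exp_le_exp.2 (hA j)
    · simp
  have hsing : ∀ j, xk z (ζ j) ≤ ∑ i, xk z (ζ i) := fun j =>
    Finset.single_le_sum (fun i _ => xk_nonneg z (ζ i)) (Finset.mem_univ j)
  constructor
  · have := hub (M + ∑ i, max (xk z (ζ i) - M) 0 - ∑ i, xk z (ζ i)) fun j => by
      have h1 : max (xk z (ζ j) - M) 0 ≤ ∑ i, max (xk z (ζ i) - M) 0 :=
        Finset.single_le_sum (f := fun i => max (xk z (ζ i) - M) 0)
          (fun i _ => le_max_right _ _) (Finset.mem_univ j)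
      have := le_max_left (xk z (ζ j) - M) 0
      linarith
    linarith
  · rw [abs_le]
    constructor
    · have h1 : Real.exp (-∑ i, xk z (ζ i)) ≤ ∑ j, ∏ i ∈ ({j}ᶜ : Finset (Fin (k + 1))), kap z (ζ i) := by
        refine le_trans ?_ (Finset.single_le_sum (f := fun j => ∏ i ∈ ({j}ᶜ : Finset (Fin (k + 1))), kap z (ζ i))
          (fun j _ => Finset.prod_nonneg fun i _ => (hp i).le) (Finset.mem_univ 0))
        simp only [hpr]
        exact Real.exp_le_exp.2 (by linarith [xk_nonneg z (ζ 0)])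
      have := (Real.le_log_iff_exp_le hTpos).2 h1
      linarith
    · have := hub 0 fun j => by linarith [hsing j]
      linarith

lemma lim_a {a b : ℝ} (h : ∀ k : ℕ, 1 ≤ k → 0 ≤ k * a + b + Real.log (k + 1)) : 0 ≤ a := by
  have t1 : Filter.Tendsto (fun k : ℕ => a + (b + Real.log 2) * ((k : ℝ))⁻¹ + Real.log k / k)
      Filter.atTop (nhds (a + (b + Real.log 2) * 0 + 0)) := by
    have a1 := (Real.isLittleO_log_id_atTop.tendsto_div_nhds_zero).comp (tendsto_natCast_atTop_atTop (R := ℝ))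
    have b1 := (tendsto_inv_atTop_zero (𝕜 := ℝ)).comp (tendsto_natCast_atTop_atTop (R := ℝ))
    exact (tendsto_const_nhds.add (tendsto_const_nhds.mul b1)).add a1
  rw [mul_zero, add_zero, add_zero] at t1
  refine ge_of_tendsto t1 ?_
  filter_upwards [Filter.eventually_ge_atTop 1] with k hk
  have hk1 : (1 : ℝ) ≤ k := by exact_mod_cast hk
  have hk0 : (0 : ℝ) < k := by linarith
  have h1 := h k hk
  have h2 : Real.log (k + 1) ≤ Real.log 2 + Real.log k := by
    rw [← Real.log_mul (by norm_num) hk0.ne']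
    exact Real.log_le_log (by linarith) (by linarith)
  have h3 : 0 ≤ (k * a + b + Real.log 2 + Real.log k) / k := div_nonneg (by linarith) hk0.le
  refine h3.trans (le_of_eq ?_)
  field_simp
  ring

theorem ent_main (μ : Measure E3) [IsProbabilityMeasure μ] (hac : μ ≪ nu0.map stereo)
    (hItg : Integrable (llr μ (nu0.map stereo)) μ) (h0 : ∫ x, x ∂μ = 0) :
    3 / 2 * (∫ p, xk p.1 p.2 ∂((μ.map proj).prod (μ.map proj)) - 1) ≤
      ∫ x, llr μ (nu0.map stereo) x ∂μ := by
  have hν : IsProbabilityMeasure (μ.map proj) :=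
    Measure.isProbabilityMeasure_map measurable_proj.aemeasurable
  have hna := noatoms_proj μ hac
  have hX := xk_integrable_prod μ hac hItg
  obtain ⟨B, hB⟩ := xk_fin μ hac hItg
  have hlag := fun {k : ℕ} (hk : 1 ≤ k) => ent_lag μ hac hItg h0 hk
  set D := ∫ x, llr μ (nu0.map stereo) x ∂μ with hD
  clear_value D
  clear hac hItg h0
  generalize μ.map proj = ν at *
  set l := ∫ p, xk p.1 p.2 ∂(ν.prod ν) with hl
  have hx1 : ∀ ζ, Integrable (fun z => xk z ζ) ν := fun ζ => by
    refine ⟨(measurable_xk_left ζ).aestronglyMeasurable, ?_⟩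
    rw [hasFiniteIntegral_iff_ofReal (Filter.Eventually.of_forall fun p => xk_nonneg _ _)]
    exact lt_of_le_of_lt (hB ζ) ENNReal.ofReal_lt_top
  set e : ℝ → ℝ := fun M => ∫ p, max (xk p.1 p.2 - M) 0 ∂(ν.prod ν) with he
  have hXM : ∀ M, Integrable (fun p : ℂ × ℂ => max (xk p.1 p.2 - M) 0) (ν.prod ν) := fun M =>
    (hX.sub (integrable_const M)).pos_part
  have hxM : ∀ M ζ, Integrable (fun z => max (xk z ζ - M) 0) ν := fun M ζ =>
    ((hx1 ζ).sub (integrable_const M)).pos_part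
  have step : ∀ M : ℝ, 0 ≤ D / 3 - l / 2 + 1 / 2 + e M := by
    intro M
    refine lim_a (b := M + e M - l) fun k hk => ?_
    have hf : Integrable (fun ζ => ∫ z, (xk z ζ - max (xk z ζ - M) 0) ∂ν) ν :=
      (hX.sub (hXM M)).integral_prod_right
    have hfi : ∫ ζ, ∫ z, (xk z ζ - max (xk z ζ - M) 0) ∂ν ∂ν = l - e M := by
      have := integral_prod_symm (μ := ν) (ν := ν) _ (hX.sub (hXM M))
      refine this.symm.trans ?_
      rw [hl, he, ← integral_sub hX (hXM M)]
      rfl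
    have ha := avg ν hna (k := k) hf hX (c := -(1 / (2 * (k + 1))))
      (R := k / 3 * D + k / 2 + Real.log (k + 1) + M) fun ζ hζ => by
      have hL := hlag hk ζ hζ
      have haez : ∀ᵐ z ∂ν, ∀ i, z ≠ ζ i := ae_all_iff.2 fun i => by
        rw [ae_iff]; simp
      have hTm : Measurable (fun z => Real.log (∑ j, ∏ i ∈ ({j}ᶜ : Finset (Fin (k + 1))), kap z (ζ i))) := by
        refine Real.measurable_log.comp ?_
        refine Finset.measurable_fun_sum _ fun j _ => Finset.measurable_fun_prod _ fun i _ => ?_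
        exact Measurable.of_uncurry_right (f := kap) measurable_kap
      have iT : Integrable (fun z => Real.log (∑ j, ∏ i ∈ ({j}ᶜ : Finset (Fin (k + 1))), kap z (ζ i))) ν := by
        refine Integrable.mono' (g := fun z => Real.log (k + 1) + ∑ i, xk z (ζ i))
          ((integrable_const _).add (integrable_finsetSum _ fun i _ => hx1 (ζ i)))
          hTm.aestronglyMeasurable (haez.mono fun z hz => ?_)
        exact (pt_bound ζ z hz (M := M)).2
      have isi : ∀ i ∈ (Finset.univ : Finset (Fin (k + 1))),
          Integrable (fun z => xk z (ζ i) - max (xk z (ζ i) - M) 0) ν :=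
        fun i _ => (hx1 (ζ i)).sub (hxM M (ζ i))
      have is : Integrable (fun z => ∑ i, (xk z (ζ i) - max (xk z (ζ i) - M) 0)) ν :=
        integrable_finsetSum _ fun i _ => (hx1 (ζ i)).sub (hxM M (ζ i))
      have hle : ∫ z, Real.log (∑ j, ∏ i ∈ ({j}ᶜ : Finset (Fin (k + 1))), kap z (ζ i)) ∂ν ≤
          ∫ z, ((Real.log (k + 1) + M) - ∑ i, (xk z (ζ i) - max (xk z (ζ i) - M) 0)) ∂ν := by
        refine integral_mono_ae iT ((integrable_const _).sub is) (haez.mono fun z hz => ?_)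
        refine (pt_bound ζ z hz (M := M)).1.trans (le_of_eq ?_)
        simp only [Finset.sum_sub_distrib]
        ring
      rw [integral_sub (integrable_const _) is, integral_const, probReal_univ, one_smul,
        integral_finsetSum _ isi] at hle
      simp only [xk] at hle ⊢
      linarith
    rw [hfi] at ha
    have hk0 : (0 : ℝ) < k + 1 := by positivity
    have e1 : -(1 / (2 * ((k : ℝ) + 1))) * ((k + 1) * (k * l)) = -(k * l / 2) := by
      field_simp
    rw [e1] at ha
    linarith
  have hlim : Filter.Tendsto (fun n : ℕ => e n) Filter.atTop (nhds 0) := by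
    have := tendsto_integral_of_dominated_convergence (μ := ν.prod ν)
      (F := fun (n : ℕ) (p : ℂ × ℂ) => max (xk p.1 p.2 - n) 0) (f := fun _ => 0)
      (fun p => xk p.1 p.2) (fun n => (hXM n).aestronglyMeasurable) hX
      (fun n => Filter.Eventually.of_forall fun p => by
        rw [Real.norm_of_nonneg (le_max_right _ _)]
        have : (0 : ℝ) ≤ n := Nat.cast_nonneg n
        exact max_le (by linarith) (xk_nonneg _ _))
      (Filter.Eventually.of_forall fun p => by
        obtain ⟨n, hn⟩ := exists_nat_ge (xk p.1 p.2)
        refine tendsto_const_nhds.congr' ?_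
        filter_upwards [Filter.eventually_ge_atTop n] with m hm
        have : (n : ℝ) ≤ m := Nat.cast_le.2 hm
        rw [max_eq_right (by linarith)])
    rw [integral_zero] at this
    exact this
  have hfin := ge_of_tendsto' (tendsto_const_nhds.add hlim) fun n : ℕ => step n
  linarith

lemma stereo_dist_sq (z w : ℂ) : dist (stereo z) (stereo w) ^ 2 = 4 * kap z w := by
  have h1 : 1 + ‖z‖ ^ 2 ≠ 0 := by positivity
  have h2 : 1 + ‖w‖ ^ 2 ≠ 0 := by positivity
  rw [dist_eq_norm, norm_sub_sq_real, stereo_norm, stereo_norm, E3_inner, stereo_0, stereo_1, stereo_2,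
    stereo_0, stereo_1, stereo_2]
  unfold kap
  have e : ‖z - w‖ ^ 2 = ‖z‖ ^ 2 + ‖w‖ ^ 2 - 2 * (z.re * w.re + z.im * w.im) := by
    simp only [Complex.sq_norm, Complex.normSq_apply, Complex.sub_re, Complex.sub_im]; ring
  rw [e]
  field_simp
  ring

lemma log_dist {z w : ℂ} (h : z ≠ w) :
    Real.log 2 - Real.log (dist (stereo z) (stereo w)) = 1 / 2 * xk z w := by
  have hk := kap_pos h
  have h1 := congrArg Real.log (stereo_dist_sq z w)
  rw [Real.log_pow, Real.log_mul (by norm_num) hk.ne', show (4 : ℝ) = 2 ^ 2 by norm_num,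
    Real.log_pow] at h1
  push_cast at h1
  unfold xk
  linarith

lemma energy_map (ν : Measure ℂ) [IsProbabilityMeasure ν] (hν : NullSingletonClass ν) :
    ∫⁻ p : E3 × E3, ENNReal.ofReal (Real.log 2 - Real.log (dist p.1 p.2))
      ∂((ν.map stereo).prod (ν.map stereo)) =
    ∫⁻ p : ℂ × ℂ, ENNReal.ofReal (1 / 2 * xk p.1 p.2) ∂(ν.prod ν) := by
  have hm : Measurable (fun p : E3 × E3 => ENNReal.ofReal (Real.log 2 - Real.log (dist p.1 p.2))) := by
    fun_prop
  rw [Measure.map_prod_map ν ν stereo_cont.measurable stereo_cont.measurable,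
    lintegral_map hm (stereo_cont.measurable.prodMap stereo_cont.measurable)]
  refine lintegral_congr_ae ((diag_null ν hν).mono fun p hp => ?_)
  simp only [Prod.map_fst, Prod.map_snd]
  rw [log_dist hp]

lemma nu0_noatoms : NullSingletonClass nu0 := by
  constructor
  intro z
  exact (withDensity_absolutelyContinuous _ _ : nu0 ≪ volume) (measure_singleton z)

lemma energy_sigma : ∫⁻ p : E3 × E3, ENNReal.ofReal (Real.log 2 - Real.log (dist p.1 p.2))
      ∂((nu0.map stereo).prod (nu0.map stereo)) = ENNReal.ofReal (1 / 2) := by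
  rw [energy_map nu0 nu0_noatoms, lintegral_prod_symm _ (measurable_xk.const_mul _).ennreal_ofReal.aemeasurable]
  simp only [lintegral_xk_nu0 _ (1 / 2) (by norm_num)]
  simp

lemma energy_mu (μ : Measure E3) [IsProbabilityMeasure μ] (hac : μ ≪ nu0.map stereo)
    (hItg : Integrable (llr μ (nu0.map stereo)) μ) (h0 : ∫ x, x ∂μ = 0)
    {γ : ℝ} (hγ0 : 0 ≤ γ) (hγ : γ ≤ 3 / 2) :
    ENNReal.ofReal (2 * γ) * (∫⁻ p : E3 × E3,
        ENNReal.ofReal (Real.log 2 - Real.log (dist p.1 p.2)) ∂(μ.prod μ)) ≤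
      ENNReal.ofReal (∫ x, llr μ (nu0.map stereo) x ∂μ) + ENNReal.ofReal γ := by
  have hν : IsProbabilityMeasure (μ.map proj) :=
    Measure.isProbabilityMeasure_map measurable_proj.aemeasurable
  have h1 := energy_map (μ.map proj) (noatoms_proj μ hac)
  rw [mu_eq μ hac] at h1
  have hX := xk_integrable_prod μ hac hItg
  have hm := ent_main μ hac hItg h0
  have hD : 0 ≤ ∫ x, llr μ (nu0.map stereo) x ∂μ := by
    have := gibbsC μ hac hItg (W := fun _ => 0) measurable_const (C := 0) (fun z => by simp)
    simpa using this
  rw [h1, ← ofReal_integral_eq_lintegral_ofReal (hX.const_mul (1 / 2))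
    (Filter.Eventually.of_forall fun p => mul_nonneg (by norm_num) (xk_nonneg _ _)),
    ← ENNReal.ofReal_mul (by linarith), ← ENNReal.ofReal_add hD hγ0, integral_const_mul]
  refine ENNReal.ofReal_le_ofReal ?_
  set l := ∫ p, xk p.1 p.2 ∂((μ.map proj).prod (μ.map proj))
  set D := ∫ x, llr μ (nu0.map stereo) x ∂μ
  rcases le_total l 1 with h | h
  · nlinarith
  · nlinarith

/-- **Nonnegativity of the free energy `F_γ` on measures with vanishing moment for
`γ ≤ 3/2`.** Let `σ` be the rotation-invariant Borel probability measure on the unit sphere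
`S² ⊂ ℝ³` and `γ ∈ [0, 3/2]`. Every Borel probability measure `μ` on `S²` with
`∫ x dμ = 0` satisfies `D(μ‖σ) ≥ γ E(μ)`, where
`E(μ) = 2 ∬ log(1/|x-y|) dμ dμ + 2 log 2 - 1`. Writing
`L(μ) = ∫⁻ (log 2 - log |x-y|) d(μ×μ) ∈ [0,∞]`, one has `E(μ) = 2 L(μ) - 1`, so the
inequality reads `2γ L(μ) ≤ D(μ‖σ) + γ` in `ℝ≥0∞`. Equality holds when `μ = σ`, for which
both sides vanish: `D(σ‖σ) = 0` and `L(σ) = 1/2` (i.e. `E(σ) = 0`). -/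
theorem free_energy_nonneg_up_to_three_halves
    (σ : Measure E3) (hσ1 : IsProbabilityMeasure σ)
    (hσs : σ (Metric.sphere (0 : E3) 1) = 1)
    (hσinv : ∀ R : E3 ≃ₗᵢ[ℝ] E3, σ.map R = σ)
    (γ : ℝ) (hγ0 : 0 ≤ γ) (hγ : γ ≤ 3 / 2) :
    (∀ μ : Measure E3, IsProbabilityMeasure μ →
        μ (Metric.sphere (0 : E3) 1) = 1 → (∫ x, x ∂μ) = 0 →
        ENNReal.ofReal (2 * γ) *
            (∫⁻ p : E3 × E3,
              ENNReal.ofReal (Real.log 2 - Real.log (dist p.1 p.2)) ∂(μ.prod μ)) ≤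
          relEnt μ σ + ENNReal.ofReal γ) ∧
    relEnt σ σ = 0 ∧
    (∫⁻ p : E3 × E3,
        ENNReal.ofReal (Real.log 2 - Real.log (dist p.1 p.2)) ∂(σ.prod σ)) =
      ENNReal.ofReal (1 / 2) := by
  have hσ := sigma_eq σ hσ1 hσs hσinv
  subst hσ
  refine ⟨fun μ hμ _ h0 => ?_, ?_, energy_sigma⟩
  · by_cases h : μ ≪ nu0.map stereo ∧
        Integrable (fun x => Real.log (μ.rnDeriv (nu0.map stereo) x).toReal) μ
    · unfold relEnt
      rw [if_pos h]
      exact energy_mu μ h.1 h.2 h0 hγ0 hγ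
    · unfold relEnt
      rw [if_neg h, top_add]
      exact le_top
  · have h1 : (fun x => Real.log ((nu0.map stereo).rnDeriv (nu0.map stereo) x).toReal)
        =ᵐ[nu0.map stereo] fun _ => (0 : ℝ) := by
      filter_upwards [Measure.rnDeriv_self (nu0.map stereo)] with x hx
      rw [hx]; simp
    unfold relEnt
    split_ifs with h
    · rw [integral_congr_ae h1, integral_zero, ENNReal.ofReal_zero]
    · exact absurd ⟨Measure.AbsolutelyContinuous.refl _, (integrable_zero _ _ _).congr h1.symm⟩ h
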